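/- Let 2 < p < ∞, v ∈ ℤ, and l ∈ ℕ. Then there is a constant C (depending on p and γ, but not on v, l, or f) such that, for every Schwartz function f on ℝ², ‖sup_{u∈[1,2]} (∑_{k∈E_v} |A_{2^v u, l₀(v,k)−l} P¹_{k₁} P²_k f|²)^{1/2}‖_{L^p(ℝ²)} ≤ C (l+1)⁵ ‖(∑_{k∈E_v} |P¹_{k₁} P²_k f|²)^{1/2}‖_{L^p(ℝ²)}, where for each k ∈ E_v one takes l₀ = l₀(v,k) and k₁ = k₁(v,k,l₀−l). -/

import Mathlib

open MeasureTheory Set Filter ENNReal NNReal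

/-- The Fourier transform on `ℝ²`. -/
noncomputable def ft (f : ℝ × ℝ → ℂ) (ξ : ℝ × ℝ) : ℂ :=
  ∫ x : ℝ × ℝ, Complex.exp (-2 * Real.pi * Complex.I * (x.1 * ξ.1 + x.2 * ξ.2)) * f x

/-- The inverse Fourier transform on `ℝ²`. -/
noncomputable def ftInv (f : ℝ × ℝ → ℂ) (x : ℝ × ℝ) : ℂ :=
  ∫ ξ : ℝ × ℝ, Complex.exp (2 * Real.pi * Complex.I * (x.1 * ξ.1 + x.2 * ξ.2)) * f ξ

/-- The Fourier multiplier operator `a(D)f = (a f̂)^∨` with symbol `a`. -/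
noncomputable def op (a : ℝ × ℝ → ℂ) (f : ℝ × ℝ → ℂ) : ℝ × ℝ → ℂ :=
  ftInv (fun ξ => a ξ * ft f ξ)

/-- The Littlewood–Paley projection in the second variable. -/
noncomputable def P2 (φ : ℝ → ℝ) (k : ℤ) (f : ℝ × ℝ → ℂ) : ℝ × ℝ → ℂ :=
  op (fun ξ => (φ ((2 : ℝ) ^ (-k) * ξ.2) : ℂ)) f

/-- The Littlewood–Paley projection in the first variable. -/
noncomputable def P1 (φ : ℝ → ℝ) (k : ℤ) (f : ℝ × ℝ → ℂ) : ℝ × ℝ → ℂ :=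
  op (fun ξ => (φ ((2 : ℝ) ^ (-k) * ξ.1) : ℂ)) f

/-- The dyadic piece `A_{u,l}` of the Hilbert transform along `(t, uγ(t))`. -/
noncomputable def Aop (γ : ℝ → ℝ) (φ φt : ℝ → ℝ) (u : ℝ) (l : ℤ)
    (g : ℝ × ℝ → ℂ) (x : ℝ × ℝ) : ℂ :=
  ∫ t : ℝ, g (x.1 - t, x.2 - u * γ t) * ((φ ((2 : ℝ) ^ l * t) * φt t : ℝ) : ℂ) / t

/-- polynomial weight -/
noncomputable def wt (N : ℕ) (y : ℝ) : ℝ≥0∞ := ENNReal.ofReal (((1 + |y|) ^ N)⁻¹)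

/-- positive averaging operator -/
noncomputable def Pos (N : ℕ) (a b : ℝ) (F : ℝ × ℝ → ℝ≥0∞) (x : ℝ × ℝ) : ℝ≥0∞ :=
  ∫⁻ y : ℝ × ℝ, wt N y.1 * wt N y.2 * F (x.1 - a * y.1, x.2 - b * y.2)

/-- slowly varying weights -/
def Slow (M : ℕ) (A B : ℝ) (W : ℝ × ℝ → ℝ≥0∞) : Prop :=
  ∀ x y : ℝ × ℝ, W x ≤
    ENNReal.ofReal (((1 + |x.1 - y.1| / A) * (1 + |x.2 - y.2| / B)) ^ M) * W y

lemma wt_meas (N : ℕ) : Measurable (wt N) := by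
  unfold wt; fun_prop

lemma wt_anti {N M : ℕ} (h : M ≤ N) (y : ℝ) : wt N y ≤ wt M y := by
  unfold wt
  apply ENNReal.ofReal_le_ofReal
  have h1 : (1:ℝ) ≤ 1 + |y| := by linarith [abs_nonneg y]
  apply inv_anti₀ (by positivity)
  exact pow_le_pow_right₀ h1 h

lemma wt_shift (N : ℕ) (y d : ℝ) :
    wt N (y + d) ≤ ENNReal.ofReal ((1 + |d|) ^ N) * wt N y := by
  unfold wt
  rw [← ENNReal.ofReal_mul (by positivity)]
  apply ENNReal.ofReal_le_ofReal
  rw [← div_eq_mul_inv, le_div_iff₀ (by positivity), inv_mul_le_iff₀ (by positivity), ← mul_pow]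
  apply pow_le_pow_left₀ (by positivity)
  have : |y| ≤ |y + d| + |d| := by
    have := abs_sub (y + d) d
    simpa using this
  nlinarith [abs_nonneg (y+d), abs_nonneg d]

lemma wt_neg (N : ℕ) (y : ℝ) : wt N (-y) = wt N y := by simp [wt]

lemma wt_mul_pow (M : ℕ) (y : ℝ) : wt (M + 2) y * ENNReal.ofReal ((1 + |y|) ^ M) = wt 2 y := by
  unfold wt
  rw [← ENNReal.ofReal_mul (by positivity)]
  congr 1
  have : (0:ℝ) < 1 + |y| := by positivity
  field_simp
  ring

/-- mass of the weight -/
noncomputable def c2 : ℝ≥0∞ := ∫⁻ y, wt 2 y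

lemma c2_lt_top : c2 < ∞ := by
  unfold c2 wt
  have : Integrable (fun y : ℝ => ((1 + |y|) ^ 2)⁻¹) := by
    have h := integrable_inv_one_add_sq
    refine Integrable.mono h (by fun_prop) ?_
    filter_upwards with y
    rw [Real.norm_of_nonneg (by positivity), Real.norm_of_nonneg (by positivity)]
    apply inv_anti₀ (by positivity)
    have := sq_abs y
    nlinarith [abs_nonneg y]
  exact this.lintegral_lt_top

lemma wt_pos (N : ℕ) (y : ℝ) : 0 < wt N y := by
  unfold wt; rw [ENNReal.ofReal_pos]; positivity

lemma lint_wt2 : ∫⁻ y : ℝ × ℝ, wt 2 y.1 * wt 2 y.2 = c2 * c2 := by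
  have := lintegral_prod_mul (μ := (volume : Measure ℝ)) (ν := (volume : Measure ℝ))
    (wt_meas 2).aemeasurable (wt_meas 2).aemeasurable
  rw [Measure.volume_eq_prod]
  exact this

lemma pos_meas (N : ℕ) (a b : ℝ) {F : ℝ × ℝ → ℝ≥0∞} (hF : Measurable F) :
    Measurable (Pos N a b F) := by
  unfold Pos
  have h1 := wt_meas N
  apply Measurable.lintegral_prod_right'
    (f := fun z : (ℝ × ℝ) × (ℝ × ℝ) => wt N z.2.1 * wt N z.2.2 *
      F (z.1.1 - a * z.2.1, z.1.2 - b * z.2.2))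
  fun_prop

lemma pos_mono {N : ℕ} {a b : ℝ} {F G : ℝ × ℝ → ℝ≥0∞} (h : ∀ x, F x ≤ G x) (x) :
    Pos N a b F x ≤ Pos N a b G x := by
  unfold Pos
  apply lintegral_mono
  intro y
  dsimp only
  gcongr
  exact h _

lemma pos_anti {N M : ℕ} (hNM : M ≤ N) {a b : ℝ} {F : ℝ × ℝ → ℝ≥0∞} (x) :
    Pos N a b F x ≤ Pos M a b F x := by
  unfold Pos
  apply lintegral_mono
  intro y
  dsimp only
  gcongr
  · exact wt_anti hNM _
  · exact wt_anti hNM _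

lemma pos_of_slow {M : ℕ} {K A B a b : ℝ} (hK : 1 ≤ K) (hA : 0 < A) (hB : 0 < B) (ha : 0 < a)
    (hb : 0 < b) (haA : a ≤ K * A) (hbB : b ≤ K * B) {W : ℝ × ℝ → ℝ≥0∞}
    (hW : Slow M A B W) (x : ℝ × ℝ) :
    Pos (M + 2) a b W x ≤ ENNReal.ofReal (K ^ (2 * M)) * (c2 * c2) * W x := by
  unfold Pos
  have key : ∀ y : ℝ × ℝ, wt (M+2) y.1 * wt (M+2) y.2 * W (x.1 - a * y.1, x.2 - b * y.2) ≤
      (wt 2 y.1 * wt 2 y.2) * (ENNReal.ofReal (K ^ (2 * M)) * W x) := by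
    intro y
    have h1 := hW (x.1 - a * y.1, x.2 - b * y.2) x
    have h2 : ((1 + |x.1 - a * y.1 - x.1| / A) * (1 + |x.2 - b * y.2 - x.2| / B)) ^ M ≤
        K ^ (2 * M) * ((1 + |y.1|)^M * (1 + |y.2|)^M) := by
      have e1 : |x.1 - a * y.1 - x.1| = a * |y.1| := by
        rw [show x.1 - a * y.1 - x.1 = -(a * y.1) by ring, abs_neg, abs_mul, abs_of_pos ha]
      have e2 : |x.2 - b * y.2 - x.2| = b * |y.2| := by
        rw [show x.2 - b * y.2 - x.2 = -(b * y.2) by ring, abs_neg, abs_mul, abs_of_pos hb]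
      rw [e1, e2]
      have f1 : 1 + a * |y.1| / A ≤ K * (1 + |y.1|) := by
        have : a * |y.1| / A ≤ K * |y.1| := by
          rw [div_le_iff₀ hA]; nlinarith [abs_nonneg y.1]
        linarith
      have f2 : 1 + b * |y.2| / B ≤ K * (1 + |y.2|) := by
        have : b * |y.2| / B ≤ K * |y.2| := by
          rw [div_le_iff₀ hB]; nlinarith [abs_nonneg y.2]
        linarith
      calc _ ≤ ((K * (1 + |y.1|)) * (K * (1 + |y.2|))) ^ M := by
              apply pow_le_pow_left₀ (by positivity)
              exact mul_le_mul f1 f2 (by positivity) (by positivity)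
        _ = _ := by rw [mul_pow, mul_pow, mul_pow, two_mul, pow_add]; ring
    have h3 := ENNReal.ofReal_le_ofReal h2
    rw [ENNReal.ofReal_mul (by positivity), ENNReal.ofReal_mul (by positivity)] at h3
    calc _ ≤ wt (M+2) y.1 * wt (M+2) y.2 * (ENNReal.ofReal (K ^ (2 * M)) *
          (ENNReal.ofReal ((1 + |y.1|)^M) * ENNReal.ofReal ((1 + |y.2|)^M)) * W x) := by
            gcongr
            exact h1.trans (by gcongr)
      _ = (wt (M+2) y.1 * ENNReal.ofReal ((1 + |y.1|)^M)) * (wt (M+2) y.2 *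
          ENNReal.ofReal ((1 + |y.2|)^M)) * (ENNReal.ofReal (K ^ (2 * M)) * W x) := by ring
      _ = _ := by rw [wt_mul_pow, wt_mul_pow]
  calc _ ≤ ∫⁻ y : ℝ × ℝ, (wt 2 y.1 * wt 2 y.2) * (ENNReal.ofReal (K ^ (2 * M)) * W x) :=
        lintegral_mono key
    _ = _ := by
      rw [lintegral_mul_const _ (by have := wt_meas 2; fun_prop), lint_wt2]; ring

lemma pos_symm (N : ℕ) (a b : ℝ) {F W : ℝ × ℝ → ℝ≥0∞} (hF : Measurable F) (hW : Measurable W) :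
    ∫⁻ x, Pos N a b F x * W x = ∫⁻ x, F x * Pos N a b W x := by
  have hw := wt_meas N
  unfold Pos
  calc _ = ∫⁻ x : ℝ × ℝ, ∫⁻ y : ℝ × ℝ, wt N y.1 * wt N y.2 *
        F (x.1 - a * y.1, x.2 - b * y.2) * W x := by
        congr 1; ext x
        rw [lintegral_mul_const]
        fun_prop
    _ = ∫⁻ y : ℝ × ℝ, ∫⁻ x : ℝ × ℝ, wt N y.1 * wt N y.2 *
        F (x.1 - a * y.1, x.2 - b * y.2) * W x := by
        apply lintegral_lintegral_swap
        apply Measurable.aemeasurable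
        simp only [Function.uncurry_def]
        fun_prop
    _ = ∫⁻ y : ℝ × ℝ, ∫⁻ x : ℝ × ℝ, wt N y.1 * wt N y.2 *
        F x * W (x.1 + a * y.1, x.2 + b * y.2) := by
        congr 1; ext y
        have := lintegral_add_right_eq_self (μ := (volume : Measure (ℝ × ℝ)))
          (fun x => wt N y.1 * wt N y.2 * F (x.1 - a * y.1, x.2 - b * y.2) * W x)
          (a * y.1, b * y.2)
        rw [← this]
        simp only [Prod.fst_add, Prod.snd_add, add_sub_cancel_right]
        rfl
    _ = ∫⁻ y : ℝ × ℝ, ∫⁻ x : ℝ × ℝ, wt N y.1 * wt N y.2 *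
        F x * W (x.1 - a * y.1, x.2 - b * y.2) := by
        rw [← lintegral_neg_eq_self]
        simp only [Prod.fst_neg, Prod.snd_neg, wt_neg, mul_neg, sub_eq_add_neg]
    _ = ∫⁻ x : ℝ × ℝ, ∫⁻ y : ℝ × ℝ, wt N y.1 * wt N y.2 *
        F x * W (x.1 - a * y.1, x.2 - b * y.2) := by
        apply lintegral_lintegral_swap
        apply Measurable.aemeasurable
        simp only [Function.uncurry_def]
        fun_prop
    _ = _ := by
        congr 1; ext x
        rw [← lintegral_const_mul]
        · congr 1; ext y; ring
        · fun_prop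

lemma pos_slow (N : ℕ) {a b : ℝ} (ha : 0 < a) (hb : 0 < b) {F : ℝ × ℝ → ℝ≥0∞}
    (hF : Measurable F) : Slow N a b (Pos N a b F) := by
  intro x x'
  have hw := wt_meas N
  unfold Pos
  have := lintegral_add_right_eq_self (μ := (volume : Measure (ℝ × ℝ)))
    (fun y => wt N y.1 * wt N y.2 * F (x.1 - a * y.1, x.2 - b * y.2))
    ((x.1 - x'.1)/a, (x.2 - x'.2)/b)
  rw [← this, ← lintegral_const_mul _ (by fun_prop)]
  apply lintegral_mono
  intro y
  simp only [Prod.fst_add, Prod.snd_add]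
  have e1 : x.1 - a * (y.1 + (x.1 - x'.1)/a) = x'.1 - a * y.1 := by field_simp; ring
  have e2 : x.2 - b * (y.2 + (x.2 - x'.2)/b) = x'.2 - b * y.2 := by field_simp; ring
  rw [e1, e2]
  have s1 := wt_shift N y.1 ((x.1 - x'.1)/a)
  have s2 := wt_shift N y.2 ((x.2 - x'.2)/b)
  rw [abs_div, abs_of_pos ha] at s1
  rw [abs_div, abs_of_pos hb] at s2
  rw [mul_pow, ENNReal.ofReal_mul (by positivity)]
  calc _ ≤ (_ * wt N y.1) * (_ * wt N y.2) * F (x'.1 - a * y.1, x'.2 - b * y.2) := by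
        gcongr
    _ = _ := by ring

lemma Slow.mono_scale {M : ℕ} {A B A' B' : ℝ} (hA : 0 < A) (hB : 0 < B) (h1 : A ≤ A')
    (h2 : B ≤ B') {W : ℝ × ℝ → ℝ≥0∞} (hW : Slow M A' B' W) : Slow M A B W := by
  intro x y
  refine (hW x y).trans ?_
  have hA' : 0 < A' := hA.trans_le h1
  have hB' : 0 < B' := hB.trans_le h2
  gcongr

lemma Slow.sum {ι : Type*} {M : ℕ} {A B : ℝ} (s : Finset ι) {W : ι → ℝ × ℝ → ℝ≥0∞}
    (hW : ∀ i ∈ s, Slow M A B (W i)) : Slow M A B (fun x => ∑ i ∈ s, W i x) := by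
  intro x y
  simp only
  rw [Finset.mul_sum]
  exact Finset.sum_le_sum fun i hi => hW i hi x y

lemma Slow.rpow {M : ℕ} {A B : ℝ} (hA : 0 < A) (hB : 0 < B) {W : ℝ × ℝ → ℝ≥0∞}
    (hW : Slow M A B W) {r : ℝ} (hr : 0 ≤ r) {M' : ℕ} (hM : M * r ≤ M') :
    Slow M' A B (fun x => W x ^ r) := by
  intro x y
  simp only
  have h := ENNReal.rpow_le_rpow (hW x y) hr
  refine h.trans ?_
  rw [ENNReal.mul_rpow_of_nonneg _ _ hr]
  gcongr
  rw [ENNReal.ofReal_rpow_of_nonneg (by positivity) hr]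
  apply ENNReal.ofReal_le_ofReal
  rw [← Real.rpow_natCast, ← Real.rpow_natCast, ← Real.rpow_mul (by positivity)]
  apply Real.rpow_le_rpow_of_exponent_le _ hM
  have : (1:ℝ) ≤ 1 + |x.1 - y.1| / A := by
    have : 0 ≤ |x.1 - y.1| / A := by positivity
    linarith
  have h' : (1:ℝ) ≤ 1 + |x.2 - y.2| / B := by
    have : 0 ≤ |x.2 - y.2| / B := by positivity
    linarith
  nlinarith

/-- Jensen -/
lemma jensen {α : Type*} [MeasurableSpace α] (μ : Measure α) {q : ℝ} (hq : 1 < q)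
    {f : α → ℝ≥0∞} (hf : AEMeasurable f μ) :
    (∫⁻ x, f x ∂μ) ^ q ≤ (μ univ) ^ (q - 1) * ∫⁻ x, f x ^ q ∂μ := by
  have hc : q.HolderConjugate (q / (q - 1)) := Real.HolderConjugate.conjExponent hq
  have h := ENNReal.lintegral_mul_le_Lp_mul_Lq μ hc hf (aemeasurable_const (b := (1:ℝ≥0∞)))
  simp only [Pi.mul_apply, mul_one, ENNReal.one_rpow, lintegral_one] at h
  have h2 := ENNReal.rpow_le_rpow h (by linarith : 0 ≤ q)
  rw [ENNReal.mul_rpow_of_nonneg _ _ (by linarith), ← ENNReal.rpow_mul, ← ENNReal.rpow_mul] at h2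
  have e1 : 1 / q * q = 1 := by field_simp
  have e2 : 1 / (q / (q - 1)) * q = q - 1 := by
    have : q - 1 ≠ 0 := by linarith
    field_simp
  rw [e1, e2, ENNReal.rpow_one] at h2
  rw [mul_comm]; exact h2

lemma jensen_wt {α : Type*} [MeasurableSpace α] (μ : Measure α) {q : ℝ} (hq : 1 < q)
    {w f : α → ℝ≥0∞} (hw : Measurable w) (hf : Measurable f) :
    (∫⁻ x, w x * f x ∂μ) ^ q ≤ (∫⁻ x, w x ∂μ) ^ (q - 1) * ∫⁻ x, w x * f x ^ q ∂μ := by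
  have := jensen (μ.withDensity w) hq hf.aemeasurable
  rw [lintegral_withDensity_eq_lintegral_mul _ hw hf,
    lintegral_withDensity_eq_lintegral_mul _ hw (hf.pow_const q),
    withDensity_apply _ MeasurableSet.univ] at this
  simpa using this

lemma lc1 {r : ℝ} (hr : 0 < r) (y : ℝ≥0∞) :
    ∫⁻ s in Ioi (0:ℝ), (if ENNReal.ofReal s < y then ENNReal.ofReal (s ^ (r-1)) else 0)
      = ENNReal.ofReal (1/r) * y ^ r := by
  have fin : ∀ z : ℝ, 0 ≤ z → ∫⁻ s in Ioi (0:ℝ),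
      (if ENNReal.ofReal s < ENNReal.ofReal z then ENNReal.ofReal (s ^ (r-1)) else 0)
      = ENNReal.ofReal (1/r) * (ENNReal.ofReal z) ^ r := by
    intro z hz
    have e : ∀ s ∈ Ioi (0:ℝ), (if ENNReal.ofReal s < ENNReal.ofReal z then
        ENNReal.ofReal (s ^ (r-1)) else 0) =
        (Iio z).indicator (fun s => ENNReal.ofReal (s ^ (r-1))) s := by
      intro s hs
      simp only [indicator, mem_Iio]
      by_cases h : s < z
      · rw [if_pos h, if_pos]
        rw [ENNReal.ofReal_lt_ofReal_iff_of_nonneg (le_of_lt hs)]; exact h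
      · rw [if_neg h, if_neg]
        rw [ENNReal.ofReal_lt_ofReal_iff_of_nonneg (le_of_lt hs)]; exact h
    rw [setLIntegral_congr_fun measurableSet_Ioi e, lintegral_indicator measurableSet_Iio,
      Measure.restrict_restrict measurableSet_Iio, inter_comm, Ioi_inter_Iio]
    rw [setLIntegral_congr (Ioo_ae_eq_Ioc)]
    have hi : IntervalIntegrable (fun s : ℝ => s ^ (r-1)) volume 0 z :=
      intervalIntegral.intervalIntegrable_rpow' (by linarith)
    have hi' := (intervalIntegrable_iff_integrableOn_Ioc_of_le hz).1 hi
    rw [← ofReal_integral_eq_lintegral_ofReal hi', ← intervalIntegral.integral_of_le hz,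
      integral_rpow (Or.inl (by linarith))]
    · rw [ENNReal.ofReal_rpow_of_nonneg hz hr.le, ← ENNReal.ofReal_mul (by positivity)]
      congr 1
      have : r - 1 + 1 = r := by ring
      rw [this, Real.zero_rpow hr.ne']
      field_simp; ring
    · filter_upwards [ae_restrict_mem measurableSet_Ioc] with s hs
      exact Real.rpow_nonneg hs.1.le _
  by_cases hy : y = ∞
  · subst hy
    have h1 : (ENNReal.ofReal (1/r)) * (∞ : ℝ≥0∞) ^ r = ∞ := by
      rw [ENNReal.top_rpow_of_pos hr, ENNReal.mul_top]
      simp [hr]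
    rw [h1, eq_top_iff]
    apply ENNReal.le_of_forall_nnreal_lt
    intro N _
    have h2 := fin ((r * N) ^ (1/r)) (by positivity)
    have h3 : ENNReal.ofReal (1/r) * ENNReal.ofReal ((r * N) ^ (1/r)) ^ r = N := by
      rw [ENNReal.ofReal_rpow_of_nonneg (by positivity) hr.le, ← Real.rpow_mul (by positivity),
        ← ENNReal.ofReal_mul (by positivity)]
      have : 1 / r * (r * (N:ℝ)) ^ (1/r*r) = N := by
        rw [one_div_mul_cancel hr.ne', Real.rpow_one]; field_simp
      rw [this]; simp
    rw [h3] at h2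
    rw [← h2]
    apply lintegral_mono
    intro s
    dsimp only
    by_cases h : ENNReal.ofReal s < ENNReal.ofReal ((r * N) ^ (1/r))
    · rw [if_pos h, if_pos (by simp)]
    · rw [if_neg h]; simp
  · have := fin y.toReal ENNReal.toReal_nonneg
    rwa [ENNReal.ofReal_toReal hy] at this

lemma marc {α : Type*} [MeasurableSpace α] (μ : Measure α) [SFinite μ] {p p0 : ℝ} (hp0 : 0 < p0)
    (hp : p0 < p) {F f : α → ℝ≥0∞} (hF : Measurable F) (hf : Measurable f) (D : ℝ≥0∞)
    (h : ∀ s : ℝ, 0 < s → μ {x | ENNReal.ofReal s < F x} ≤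
      D * ENNReal.ofReal (s ^ (-p0)) * ∫⁻ x, (if ENNReal.ofReal s < f x then f x ^ p0 else 0) ∂μ) :
    ∫⁻ x, F x ^ p ∂μ ≤ ENNReal.ofReal (p / (p - p0)) * D * ∫⁻ x, f x ^ p ∂μ := by
  have hp' : 0 < p := hp0.trans hp
  have hpp : 0 < p - p0 := by linarith
  have m1 : Measurable fun z : α × ℝ => (if ENNReal.ofReal z.2 < F z.1 then
      ENNReal.ofReal (z.2 ^ (p-1)) else 0) := by
    apply Measurable.ite
    · exact measurableSet_lt (by fun_prop) (by fun_prop)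
    · fun_prop
    · fun_prop
  have m2 : Measurable fun z : ℝ × α => (if ENNReal.ofReal z.1 < f z.2 then
      ENNReal.ofReal (z.1 ^ (p-p0-1)) * f z.2 ^ p0 else 0) := by
    apply Measurable.ite
    · exact measurableSet_lt (by fun_prop) (by fun_prop)
    · fun_prop
    · fun_prop
  have e0 : ∀ y : ℝ≥0∞, y ^ p = ENNReal.ofReal p * ∫⁻ s in Ioi (0:ℝ),
      (if ENNReal.ofReal s < y then ENNReal.ofReal (s ^ (p-1)) else 0) := by
    intro y
    rw [lc1 hp', ← mul_assoc, ← ENNReal.ofReal_mul hp'.le, mul_one_div_cancel hp'.ne']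
    simp
  calc ∫⁻ x, F x ^ p ∂μ = ENNReal.ofReal p * ∫⁻ x, (∫⁻ s in Ioi (0:ℝ),
      (if ENNReal.ofReal s < F x then ENNReal.ofReal (s ^ (p-1)) else 0)) ∂μ := by
        rw [← lintegral_const_mul]
        · congr 1; ext x; exact e0 _
        · exact m1.lintegral_prod_right'
    _ = ENNReal.ofReal p * ∫⁻ s in Ioi (0:ℝ), ∫⁻ x,
      (if ENNReal.ofReal s < F x then ENNReal.ofReal (s ^ (p-1)) else 0) ∂μ := by
        rw [lintegral_lintegral_swap]
        exact m1.aemeasurable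
    _ ≤ ENNReal.ofReal p * ∫⁻ s in Ioi (0:ℝ), ∫⁻ x, D * (if ENNReal.ofReal s < f x then
      ENNReal.ofReal (s ^ (p-p0-1)) * f x ^ p0 else 0) ∂μ := by
        gcongr ENNReal.ofReal p * ?_
        apply setLIntegral_mono_ae'  measurableSet_Ioi
        filter_upwards with s hs
        have hs : 0 < s := hs
        have a1 : ∫⁻ x, (if ENNReal.ofReal s < F x then ENNReal.ofReal (s ^ (p-1)) else 0) ∂μ
            = ENNReal.ofReal (s ^ (p-1)) * μ {x | ENNReal.ofReal s < F x} := by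
          rw [← lintegral_indicator_const (measurableSet_lt measurable_const hF)]
          congr 1; ext x; simp [indicator]
        rw [a1]
        calc _ ≤ ENNReal.ofReal (s ^ (p-1)) * (D * ENNReal.ofReal (s ^ (-p0)) *
              ∫⁻ x, (if ENNReal.ofReal s < f x then f x ^ p0 else 0) ∂μ) := by
                gcongr; exact h s hs
          _ = D * (ENNReal.ofReal (s ^ (p-p0-1)) *
              ∫⁻ x, (if ENNReal.ofReal s < f x then f x ^ p0 else 0) ∂μ) := by
                rw [show p - p0 - 1 = (p - 1) + (-p0) by ring, Real.rpow_add hs,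
                  ENNReal.ofReal_mul (by positivity)]
                ring
          _ = _ := by
                rw [lintegral_const_mul, ← lintegral_const_mul]
                · congr 2; ext x; split_ifs <;> simp
                · exact Measurable.ite (measurableSet_lt measurable_const hf) (by fun_prop)
                    (by fun_prop)
                · exact m2.comp measurable_prodMk_left
    _ = ENNReal.ofReal p * ∫⁻ x, (∫⁻ s in Ioi (0:ℝ), D * (if ENNReal.ofReal s < f x then
      ENNReal.ofReal (s ^ (p-p0-1)) * f x ^ p0 else 0)) ∂μ := by
        rw [lintegral_lintegral_swap]
        exact (m2.const_mul D).aemeasurable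
    _ = ENNReal.ofReal p * ∫⁻ x, D * (ENNReal.ofReal (1/(p-p0)) * f x ^ p) ∂μ := by
        congr 2; ext x
        have mm : Measurable fun s : ℝ => (if ENNReal.ofReal s < f x then
          ENNReal.ofReal (s ^ (p-p0-1)) * f x ^ p0 else 0) :=
          m2.comp (measurable_id.prodMk measurable_const)
        rw [lintegral_const_mul _ mm]
        congr 1
        have : f x ^ p = f x ^ (p - p0) * f x ^ p0 := by
          rw [← ENNReal.rpow_add_of_nonneg _ _ hpp.le hp0.le]; congr 1; ring
        rw [this, ← mul_assoc, ← lc1 hpp, ← lintegral_mul_const]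
        · congr 1; ext s; split_ifs <;> simp
        · exact Measurable.ite (measurableSet_lt (by fun_prop) measurable_const) (by fun_prop)
                    (by fun_prop)
    _ = _ := by
        rw [lintegral_const_mul _ (by fun_prop), lintegral_const_mul _ (by fun_prop)]
        rw [div_eq_mul_one_div p, ENNReal.ofReal_mul hp'.le]
        ring

/-- centered average -/
noncomputable def avg (r : ℝ) (F : ℝ → ℝ≥0∞) (x : ℝ) : ℝ≥0∞ :=
  ENNReal.ofReal (1/(2*r)) * ∫⁻ z, (if |z - x| ≤ r then F z else 0)

lemma avg_meas (r : ℝ) {F : ℝ → ℝ≥0∞} (hF : Measurable F) : Measurable (avg r F) := by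
  unfold avg
  apply Measurable.const_mul
  apply Measurable.lintegral_prod_right' (f := fun z : ℝ × ℝ => if |z.2 - z.1| ≤ r then F z.2 else 0)
  exact Measurable.ite (measurableSet_le (by fun_prop) (by fun_prop)) (by fun_prop) (by fun_prop)

lemma avg_eq (r : ℝ) (F : ℝ → ℝ≥0∞) (x : ℝ) :
    avg r F x = ENNReal.ofReal (1/(2*r)) * ∫⁻ z in Metric.closedBall x r, F z := by
  unfold avg
  rw [← lintegral_indicator Metric.isClosed_closedBall.measurableSet]
  congr 2

lemma hl_weak {ι : Type*} (J : Finset ι) (r : ι → ℝ) (hr : ∀ j ∈ J, 0 < r j) {F : ℝ → ℝ≥0∞}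
    (hF : Measurable F) {s : ℝ} (hs : 0 < s) :
    volume {x | ENNReal.ofReal s < J.sup (fun j => avg (r j) F x)} ≤
      5 * ENNReal.ofReal (s⁻¹) * ∫⁻ z, F z := by
  set t := {x | ENNReal.ofReal s < J.sup (fun j => avg (r j) F x)} with ht
  have h1 : ∀ x ∈ t, ∃ j ∈ J, ENNReal.ofReal s < avg (r j) F x := by
    intro x hx
    exact Finset.lt_sup_iff.1 hx
  rcases J.eq_empty_or_nonempty with hJ0 | ⟨j0, hj0⟩
  · have : t = ∅ := by
      ext x
      simp [ht, hJ0]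
    rw [this]; simp
  have : Nonempty ι := ⟨j0⟩
  choose! jj hjJ hj using h1
  obtain ⟨R, hR⟩ : ∃ R : ℝ, ∀ j ∈ J, r j ≤ R := by
    obtain ⟨R, hR⟩ := (J.image r).bddAbove
    exact ⟨R, fun j hj => hR (by simpa using ⟨j, hj, rfl⟩)⟩
  obtain ⟨u, hut, hdis, hcov⟩ := Vitali.exists_disjoint_subfamily_covering_enlargement_closedBall
    t (fun x => x) (fun x => r (jj x)) R (fun x hx => hR _ (hjJ x hx)) 5 (by norm_num)
  have hcount : u.Countable := by
    apply hdis.countable_of_nonempty_interior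
    intro x hx
    refine ⟨x, ?_⟩
    rw [interior_closedBall _ (hr _ (hjJ x (hut hx))).ne']
    exact Metric.mem_ball_self (hr _ (hjJ x (hut hx)))
  have hsub : t ⊆ ⋃ x ∈ u, Metric.closedBall x (5 * r (jj x)) := by
    intro x hx
    obtain ⟨b, hb, hb2⟩ := hcov x hx
    simp only [mem_iUnion]
    exact ⟨b, hb, hb2 (Metric.mem_closedBall_self (hr _ (hjJ x hx)).le)⟩
  calc volume t ≤ volume (⋃ x ∈ u, Metric.closedBall x (5 * r (jj x))) := measure_mono hsub
    _ ≤ ∑' x : u, volume (Metric.closedBall (x:ℝ) (5 * r (jj x))) := measure_biUnion_le _ hcount _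
    _ ≤ ∑' x : u, 5 * ENNReal.ofReal (s⁻¹) * ∫⁻ z in Metric.closedBall (x:ℝ) (r (jj x)), F z := by
        apply ENNReal.tsum_le_tsum
        rintro ⟨x, hx⟩
        have h2 := hj x (hut hx)
        have hr0 := hr _ (hjJ x (hut hx))
        simp only
        rw [Real.volume_closedBall]
        rw [avg_eq] at h2
        set I := ∫⁻ z in Metric.closedBall (x:ℝ) (r (jj x)), F z
        set ρ := r (jj x)
        calc ENNReal.ofReal (2 * (5 * ρ)) =
            5 * ENNReal.ofReal (s⁻¹) * (ENNReal.ofReal (2*ρ) * ENNReal.ofReal s) := by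
              rw [show (5:ℝ≥0∞) = ENNReal.ofReal 5 by norm_num, ← ENNReal.ofReal_mul (by positivity),
                ← ENNReal.ofReal_mul (by positivity), ← ENNReal.ofReal_mul (by positivity)]
              congr 1; field_simp
          _ ≤ 5 * ENNReal.ofReal (s⁻¹) * (ENNReal.ofReal (2*ρ) * (ENNReal.ofReal (1/(2*ρ)) * I)) := by
              gcongr
          _ = _ := by
              rw [← mul_assoc (ENNReal.ofReal (2*ρ)), ← ENNReal.ofReal_mul (by positivity),
                mul_one_div_cancel (by positivity)]
              simp
    _ = 5 * ENNReal.ofReal (s⁻¹) * ∫⁻ z in ⋃ x ∈ u, Metric.closedBall (x:ℝ) (r (jj x)), F z := by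
        rw [ENNReal.tsum_mul_left, lintegral_biUnion hcount
          (fun _ _ => Metric.isClosed_closedBall.measurableSet) hdis]
    _ ≤ _ := by gcongr; exact Measure.restrict_le_self

lemma sup_meas {ι α : Type*} [MeasurableSpace α] (J : Finset ι) {f : ι → α → ℝ≥0∞}
    (hf : ∀ j, Measurable (f j)) : Measurable fun x => J.sup (fun j => f j x) := by
  classical
  induction J using Finset.induction_on with
  | empty => simp
  | insert a s ha ih =>
    simp only [Finset.sup_insert]
    exact (hf a).sup ih

lemma hl1d {ι : Type*} (J : Finset ι) (r : ι → ℝ) (hr : ∀ j ∈ J, 0 < r j) {F : ℝ → ℝ≥0∞}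
    (hF : Measurable F) {p : ℝ} (hp : 1 < p) :
    ∫⁻ x, (J.sup (fun j => avg (r j) F x)) ^ p ≤
      ENNReal.ofReal (p / (p - 1)) * 5 * ∫⁻ x, (2 * F x) ^ p := by
  apply marc volume one_pos hp
  · apply sup_meas
    intro j
    exact avg_meas _ hF
  · fun_prop
  intro s hs
  set F1 : ℝ → ℝ≥0∞ := fun x => if ENNReal.ofReal s < 2 * F x then F x else 0 with hF1
  have mF1 : Measurable F1 :=
    Measurable.ite (measurableSet_lt (by fun_prop) (by fun_prop)) (by fun_prop) (by fun_prop)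
  have hle : ∀ x, F x ≤ F1 x + ENNReal.ofReal (s/2) := by
    intro x
    simp only [hF1]
    split_ifs with h
    · exact le_self_add
    · push Not at h
      rw [zero_add]
      rw [ENNReal.ofReal_div_of_pos (by norm_num)]
      rw [ENNReal.le_div_iff_mul_le (by simp) (by simp)]
      rw [mul_comm]; simpa using h
  have havg : ∀ j ∈ J, ∀ x, avg (r j) F x ≤ avg (r j) F1 x + ENNReal.ofReal (s/2) := by
    intro j hj x
    have hr0 := hr j hj
    rw [avg_eq, avg_eq]
    calc _ ≤ ENNReal.ofReal (1/(2*r j)) * ∫⁻ z in Metric.closedBall x (r j),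
          (F1 z + ENNReal.ofReal (s/2)) := by
          gcongr; exact hle _
      _ = ENNReal.ofReal (1/(2*r j)) * (∫⁻ z in Metric.closedBall x (r j), F1 z) +
          (ENNReal.ofReal (1/(2*r j)) * ENNReal.ofReal (2 * r j)) * ENNReal.ofReal (s/2) := by
          rw [lintegral_add_left mF1, mul_add, setLIntegral_const, Real.volume_closedBall]
          ring
      _ = _ := by
          rw [← ENNReal.ofReal_mul (by positivity), one_div_mul_cancel (by positivity)]
          simp
  have hsub : {x | ENNReal.ofReal s < J.sup (fun j => avg (r j) F x)} ⊆
      {x | ENNReal.ofReal (s/2) < J.sup (fun j => avg (r j) F1 x)} := by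
    intro x hx
    simp only [mem_ofPred_eq, Finset.lt_sup_iff] at hx ⊢
    obtain ⟨j, hj, h⟩ := hx
    refine ⟨j, hj, ?_⟩
    by_contra hcon
    push Not at hcon
    have := (h.trans_le (havg j hj x)).trans_le (add_le_add_left hcon _)
    rw [← ENNReal.ofReal_add (by positivity) (by positivity)] at this
    simp at this
  refine (measure_mono hsub).trans ((hl_weak J r hr mF1 (by positivity : 0 < s/2)).trans ?_)
  have e1 : ENNReal.ofReal ((s/2)⁻¹) = ENNReal.ofReal (s ^ (-1:ℝ)) * 2 := by
    rw [Real.rpow_neg_one, show (2:ℝ≥0∞) = ENNReal.ofReal 2 by norm_num,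
      ← ENNReal.ofReal_mul (by positivity)]
    congr 1; field_simp
  rw [e1, ← mul_assoc, mul_assoc (5 * _)]
  rw [← lintegral_const_mul _ mF1]
  gcongr with x
  simp only [hF1, ENNReal.rpow_one]
  split_ifs <;> simp

/-- weighted average in one dimension -/
noncomputable def Av (a : ℝ) (F : ℝ → ℝ≥0∞) (x : ℝ) : ℝ≥0∞ := ∫⁻ y, wt 2 y * F (x - a * y)

lemma wt2_le (y : ℝ) : wt 2 y ≤
    ∑' s : ℕ, ENNReal.ofReal (4 * (1/4)^s) * (if |y| ≤ 2^s then 1 else 0) := by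
  obtain ⟨n, hn⟩ : ∃ n : ℕ, |y| ≤ 2^n := by
    obtain ⟨n, hn⟩ := pow_unbounded_of_one_lt |y| (by norm_num : (1:ℝ) < 2)
    exact ⟨n, hn.le⟩
  classical
  have hex : ∃ n : ℕ, |y| ≤ 2^n := ⟨n, hn⟩
  set m := Nat.find hex
  have hm : |y| ≤ 2^m := Nat.find_spec hex
  refine le_trans ?_ (ENNReal.le_tsum m)
  rw [if_pos hm, mul_one]
  unfold wt
  apply ENNReal.ofReal_le_ofReal
  rcases Nat.eq_zero_or_pos m with h0 | h0
  · rw [h0]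
    have : ((1 + |y|)^2)⁻¹ ≤ 1 := by
      apply inv_le_one_of_one_le₀
      nlinarith [abs_nonneg y]
    simp; linarith
  · have h2 : ¬ |y| ≤ 2^(m-1) := Nat.find_min hex (by omega)
    push Not at h2
    have e : (4:ℝ) * (1/4)^m = ((2^(m-1))^2)⁻¹ := by
      obtain ⟨k, hk⟩ : ∃ k, m = k+1 := ⟨m-1, by omega⟩
      rw [hk]; simp only [Nat.add_sub_cancel]
      rw [← pow_mul, mul_comm k 2, pow_mul, pow_succ, one_div, inv_pow]
      norm_num; ring
    rw [e]
    apply inv_anti₀ (by positivity)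
    apply pow_le_pow_left₀ (by positivity)
    linarith

lemma lint_scale {a : ℝ} (ha : 0 < a) {G : ℝ → ℝ≥0∞} (hG : Measurable G) (x : ℝ) :
    ∫⁻ y, G (x - a * y) = ENNReal.ofReal a⁻¹ * ∫⁻ z, G z := by
  have h1 : ∫⁻ y, G (x - a * y) = ∫⁻ z, G (x - z) ∂(Measure.map (a * ·) volume) := by
    rw [lintegral_map (by fun_prop) (by fun_prop)]
  rw [h1, Real.map_volume_mul_left ha.ne', lintegral_smul_measure, lintegral_sub_left_eq_self,
    abs_of_pos (by positivity)]
  rfl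

lemma Av_le {a : ℝ} (ha : 0 < a) {F : ℝ → ℝ≥0∞} (hF : Measurable F) (x : ℝ) :
    Av a F x ≤ ∑' s : ℕ, ENNReal.ofReal (8 * (1/2)^s) * avg (a * 2^s) F x := by
  unfold Av
  calc _ ≤ ∫⁻ y, ∑' s : ℕ, ENNReal.ofReal (4 * (1/4)^s) *
        ((if |y| ≤ 2^s then F (x - a * y) else 0)) := by
        apply lintegral_mono
        intro y
        dsimp only
        refine (mul_le_mul_left (wt2_le y) _).trans ?_
        rw [← ENNReal.tsum_mul_right]
        apply ENNReal.tsum_le_tsum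
        intro s
        split_ifs <;> simp
    _ = ∑' s : ℕ, ENNReal.ofReal (4 * (1/4)^s) *
        ∫⁻ y, (if |y| ≤ 2^s then F (x - a * y) else 0) := by
        have mm : ∀ s : ℕ, Measurable fun y : ℝ => (if |y| ≤ 2^s then F (x - a * y) else 0) := by
          intro s
          exact Measurable.ite (measurableSet_le (by fun_prop) (by fun_prop)) (by fun_prop)
            (by fun_prop)
        rw [lintegral_tsum]
        · congr 1; ext s
          rw [lintegral_const_mul _ (mm s)]
        · intro s
          exact ((mm s).const_mul _).aemeasurable
    _ = _ := by
        congr 1; ext s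
        unfold avg
        have h1 := lint_scale ha (G := fun z => if |z - x| ≤ a * 2^s then F z else 0)
          (Measurable.ite (measurableSet_le (by fun_prop) (by fun_prop)) (by fun_prop)
            (by fun_prop)) x
        have h2 : ∀ y, (if |y| ≤ 2^s then F (x - a * y) else 0) =
            (if |x - a * y - x| ≤ a * 2^s then F (x - a * y) else 0) := by
          intro y
          have : |x - a * y - x| = a * |y| := by
            rw [show x - a * y - x = -(a * y) by ring, abs_neg, abs_mul, abs_of_pos ha]
          rw [this]
          simp only [mul_le_mul_iff_right₀ ha]
        simp_rw [h2]
        rw [h1, ← mul_assoc, ← mul_assoc, ← ENNReal.ofReal_mul (by positivity),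
          ← ENNReal.ofReal_mul (by positivity)]
        congr 2
        have : (1/4:ℝ)^s = (1/2)^s * (1/2)^s := by rw [← mul_pow]; norm_num
        rw [this]
        have : ((1:ℝ)/2)^s = (2^s)⁻¹ := by rw [one_div, inv_pow]
        rw [this]
        field_simp
        norm_num

lemma jensen_tsum {q : ℝ} (hq : 1 < q) (w f : ℕ → ℝ≥0∞) :
    (∑' s, w s * f s) ^ q ≤ (∑' s, w s) ^ (q - 1) * ∑' s, w s * f s ^ q := by
  have := jensen_wt (Measure.count : Measure ℕ) hq (w := w) (f := f)
    (measurable_of_countable _) (measurable_of_countable _)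
  simpa [lintegral_count] using this

lemma tsum_w : ∑' s : ℕ, ENNReal.ofReal (8 * (1/2)^s) = 16 := by
  rw [← ENNReal.ofReal_tsum_of_nonneg (fun s => by positivity)
    (summable_geometric_two.mul_left 8), (hasSum_geometric_two.mul_left 8).tsum_eq]
  norm_num

lemma sup_rpow {ι : Type*} (J : Finset ι) {q : ℝ} (hq : 0 < q) (f : ι → ℝ≥0∞) :
    (J.sup f) ^ q = J.sup (fun j => f j ^ q) := by
  classical
  induction J using Finset.induction_on with
  | empty => simp [hq]
  | insert a s ha ih =>
    rw [Finset.sup_insert, Finset.sup_insert, ← ih]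
    exact (ENNReal.monotone_rpow_of_nonneg hq.le).map_sup _ _

lemma Av_meas (a : ℝ) {F : ℝ → ℝ≥0∞} (hF : Measurable F) : Measurable (Av a F) := by
  unfold Av
  have := wt_meas 2
  apply Measurable.lintegral_prod_right' (f := fun z : ℝ × ℝ => wt 2 z.2 * F (z.1 - a * z.2))
  fun_prop

/-- constant -/
noncomputable def CH (p : ℝ) : ℝ≥0∞ := 16 ^ (p-1) * (16 * (ENNReal.ofReal (p / (p - 1)) * 5 * 2 ^ p))

lemma CH_ne_top {p : ℝ} (hp : 1 < p) : CH p ≠ ∞ := by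
  unfold CH
  refine ENNReal.mul_ne_top (ENNReal.rpow_ne_top_of_nonneg (by linarith) (by simp)) ?_
  refine ENNReal.mul_ne_top (by simp) (ENNReal.mul_ne_top (ENNReal.mul_ne_top (by simp) (by simp)) ?_)
  exact ENNReal.rpow_ne_top_of_nonneg (by linarith) (by simp)

lemma supAv {ι : Type*} (J : Finset ι) (a : ι → ℝ) (ha : ∀ j ∈ J, 0 < a j) {F : ℝ → ℝ≥0∞}
    (hF : Measurable F) {p : ℝ} (hp : 1 < p) :
    ∫⁻ x, (J.sup (fun j => Av (a j) F x)) ^ p ≤ CH p * ∫⁻ x, F x ^ p := by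
  have h0 : ∀ x, J.sup (fun j => Av (a j) F x) ≤
      ∑' s : ℕ, ENNReal.ofReal (8 * (1/2)^s) * J.sup (fun j => avg (a j * 2^s) F x) := by
    intro x
    apply Finset.sup_le
    intro j hj
    refine (Av_le (ha j hj) hF x).trans ?_
    apply ENNReal.tsum_le_tsum
    intro s
    gcongr
    exact Finset.le_sup (f := fun j => avg (a j * 2^s) F x) hj
  have mm : ∀ s : ℕ, Measurable fun x => J.sup (fun j => avg (a j * 2^s) F x) := fun s =>
    sup_meas J (fun j => avg_meas _ hF)
  calc _ ≤ ∫⁻ x, 16 ^ (p-1) * ∑' s : ℕ, ENNReal.ofReal (8 * (1/2)^s) *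
        (J.sup (fun j => avg (a j * 2^s) F x)) ^ p := by
        apply lintegral_mono
        intro x
        dsimp only
        refine (ENNReal.rpow_le_rpow (h0 x) (by linarith)).trans ?_
        refine (jensen_tsum hp _ _).trans ?_
        rw [tsum_w]
    _ = 16 ^ (p-1) * ∑' s : ℕ, ENNReal.ofReal (8 * (1/2)^s) *
        ∫⁻ x, (J.sup (fun j => avg (a j * 2^s) F x)) ^ p := by
        rw [lintegral_const_mul, lintegral_tsum]
        · congr 2; ext s
          rw [lintegral_const_mul _ ((mm s).pow_const p)]
        · intro s
          exact (((mm s).pow_const p).const_mul _).aemeasurable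
        · exact Measurable.tsum fun s => (((mm s).pow_const p).const_mul _)
    _ ≤ 16 ^ (p-1) * ∑' s : ℕ, ENNReal.ofReal (8 * (1/2)^s) *
        (ENNReal.ofReal (p / (p - 1)) * 5 * ∫⁻ x, (2 * F x) ^ p) := by
        gcongr with s
        exact hl1d J _ (fun j hj => mul_pos (ha j hj) (by positivity)) hF hp
    _ = _ := by
        rw [ENNReal.tsum_mul_right, tsum_w]
        simp_rw [ENNReal.mul_rpow_of_nonneg _ _ (by linarith : 0 ≤ p)]
        rw [lintegral_const_mul _ (by fun_prop)]
        unfold CH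
        ring

lemma pos_eq_Av (a b : ℝ) {F : ℝ × ℝ → ℝ≥0∞} (hF : Measurable F) (x : ℝ × ℝ) :
    Pos 2 a b F x = Av a (fun t => Av b (fun s => F (t, s)) x.2) x.1 := by
  have := wt_meas 2
  unfold Pos Av
  rw [Measure.volume_eq_prod, lintegral_prod _ (by fun_prop)]
  congr 1; ext y
  rw [← lintegral_const_mul _ (by fun_prop)]
  congr 1; ext z
  ring

lemma supPos {ι : Type*} (J : Finset ι) (a b : ι → ℝ) (ha : ∀ j ∈ J, 0 < a j)
    (hb : ∀ j ∈ J, 0 < b j) {F : ℝ × ℝ → ℝ≥0∞}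
    (hF : Measurable F) {p : ℝ} (hp : 1 < p) :
    ∫⁻ x, (J.sup (fun j => Pos 2 (a j) (b j) F x)) ^ p ≤ CH p * CH p * ∫⁻ x, F x ^ p := by
  have hw := wt_meas 2
  have mG0 : ∀ j, Measurable fun z : ℝ × ℝ => Av (b j) (fun s => F (z.1, s)) z.2 := by
    intro j
    unfold Av
    apply Measurable.lintegral_prod_right'
      (f := fun z : (ℝ × ℝ) × ℝ => wt 2 z.2 * F (z.1.1, z.1.2 - b j * z.2))
    fun_prop
  set G : ℝ × ℝ → ℝ≥0∞ := fun z => J.sup (fun j => Av (b j) (fun s => F (z.1, s)) z.2) with hG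
  have mG : Measurable G := sup_meas J mG0
  set H : ℝ × ℝ → ℝ≥0∞ := fun z => J.sup (fun j => Av (a j) (fun t => G (t, z.2)) z.1) with hH
  have mH : Measurable H := by
    apply sup_meas J
    intro j
    unfold Av
    apply Measurable.lintegral_prod_right'
      (f := fun z : (ℝ × ℝ) × ℝ => wt 2 z.2 * G (z.1.1 - a j * z.2, z.1.2))
    fun_prop
  have h1 : ∀ x, J.sup (fun j => Pos 2 (a j) (b j) F x) ≤ H x := by
    intro x
    apply Finset.sup_mono_fun
    intro j hj
    rw [pos_eq_Av _ _ hF]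
    unfold Av
    apply lintegral_mono
    intro y
    dsimp only
    gcongr
    exact Finset.le_sup (f := fun i => Av (b i) (fun s => F (x.1 - a j * y, s)) x.2) hj
  calc _ ≤ ∫⁻ x, H x ^ p := by
        apply lintegral_mono
        intro x
        exact ENNReal.rpow_le_rpow (h1 x) (by linarith)
    _ = ∫⁻ x2, ∫⁻ x1, H (x1, x2) ^ p := by
        rw [Measure.volume_eq_prod, lintegral_prod_symm _ (by fun_prop)]
    _ ≤ ∫⁻ x2, CH p * ∫⁻ x1, G (x1, x2) ^ p := by
        apply lintegral_mono
        intro x2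
        exact supAv J a ha (F := fun t => G (t, x2)) (by fun_prop) hp
    _ = CH p * ∫⁻ x1, ∫⁻ x2, G (x1, x2) ^ p := by
        rw [lintegral_const_mul' _ _ (CH_ne_top hp)]
        rw [lintegral_lintegral_swap]
        apply Measurable.aemeasurable
        simp only [Function.uncurry_def]
        fun_prop
    _ ≤ CH p * ∫⁻ x1, CH p * ∫⁻ x2, F (x1, x2) ^ p := by
        gcongr with x1
        exact supAv J b hb (F := fun t => F (x1, t)) (by fun_prop) hp
    _ = _ := by
        rw [lintegral_const_mul' _ _ (CH_ne_top hp), Measure.volume_eq_prod,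
          lintegral_prod _ (by fun_prop)]
        ring

lemma absorb {I A C : ℝ≥0∞} {q : ℝ} (hq : 1 < q) (hI : I ≠ ∞)
    (h : I ≤ A ^ (1/q) * (C * I) ^ (1 - 1/q)) : I ≤ A * C ^ (q-1) := by
  have hq0 : 0 < q := by linarith
  have h1q : 0 ≤ 1 - 1/q := by
    rw [sub_nonneg, div_le_one hq0]; exact hq.le
  rcases eq_or_ne I 0 with h0 | h0
  · rw [h0]; exact zero_le
  have h1 : I ^ (1/q) ≤ A ^ (1/q) * C ^ (1 - 1/q) := by
    rw [ENNReal.mul_rpow_of_nonneg _ _ h1q, ← mul_assoc] at h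
    have e : I = I ^ (1/q) * I ^ (1-1/q) := by
      rw [← ENNReal.rpow_add _ _ h0 hI]; simp
    nth_rewrite 1 [e] at h
    have hne : I ^ (1-1/q) ≠ 0 := by
      simp only [ne_eq, ENNReal.rpow_eq_zero_iff, not_or, not_and]
      exact ⟨fun hh => absurd hh h0, fun hh => absurd hh hI⟩
    have hnt : I ^ (1-1/q) ≠ ∞ := ENNReal.rpow_ne_top_of_nonneg h1q hI
    exact (ENNReal.mul_le_mul_iff_left hne hnt).1 h
  have h2 := ENNReal.rpow_le_rpow h1 hq0.le
  rw [ENNReal.mul_rpow_of_nonneg _ _ hq0.le, ← ENNReal.rpow_mul, ← ENNReal.rpow_mul,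
    ← ENNReal.rpow_mul] at h2
  have e1 : 1/q*q = 1 := by field_simp
  have e2 : (1-1/q)*q = q-1 := by field_simp
  rw [e1, e2] at h2
  simpa using h2

lemma pos_Lq {a b : ℝ} (ha : 0 < a) (hb : 0 < b) {F : ℝ × ℝ → ℝ≥0∞} (hF : Measurable F) {p : ℝ}
    (hp : 1 < p) : ∫⁻ x, Pos 2 a b F x ^ p ≤ CH p * CH p * ∫⁻ x, F x ^ p := by
  simpa using supPos {()} (fun _ => a) (fun _ => b) (fun _ _ => ha) (fun _ _ => hb) hF hp

/-- constant -/
noncomputable def CL (q : ℝ) : ℝ≥0∞ := (CH (q/(q-1)) * CH (q/(q-1))) ^ (q-1)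

lemma CL_ne_top {q : ℝ} (hq : 1 < q) : CL q ≠ ∞ := by
  unfold CL
  have : 1 < q/(q-1) := by rw [lt_div_iff₀ (by linarith)]; linarith
  exact ENNReal.rpow_ne_top_of_nonneg (by linarith)
    (ENNReal.mul_ne_top (CH_ne_top this) (CH_ne_top this))

lemma CH_ne_zero {p : ℝ} (hp : 1 < p) : CH p ≠ 0 := by
  unfold CH
  have : 0 < p / (p-1) := div_pos (by linarith) (by linarith)
  simp [ENNReal.rpow_eq_zero_iff, this]

lemma CL_ne_zero {q : ℝ} (hq : 1 < q) : CL q ≠ 0 := by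
  unfold CL
  have h : 1 < q/(q-1) := by rw [lt_div_iff₀ (by linarith)]; linarith
  have h0 := CH_ne_zero h
  simp only [ne_eq, ENNReal.rpow_eq_zero_iff, not_or, not_and]
  constructor
  · intro h'; simp [h0] at h'
  · intro h'; exact absurd h' (ENNReal.mul_ne_top (CH_ne_top h) (CH_ne_top h))

lemma sumPos {ι : Type*} (J : Finset ι) (a b : ι → ℝ) (ha : ∀ j ∈ J, 0 < a j)
    (hb : ∀ j ∈ J, 0 < b j) {X : ι → ℝ × ℝ → ℝ≥0∞}
    (hX : ∀ j, Measurable (X j)) {q : ℝ} (hq : 1 < q) :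
    ∫⁻ x, (∑ j ∈ J, Pos 2 (a j) (b j) (X j) x) ^ q ≤ CL q * ∫⁻ x, (∑ j ∈ J, X j x) ^ q := by
  have hq0 : 0 < q := by linarith
  have hq' : 1 < q/(q-1) := by rw [lt_div_iff₀ (by linarith)]; linarith
  have hc : q.HolderConjugate (q / (q - 1)) := Real.HolderConjugate.conjExponent hq
  set S : ℝ × ℝ → ℝ≥0∞ := fun x => ∑ j ∈ J, X j x with hS
  set T : ℝ × ℝ → ℝ≥0∞ := fun x => ∑ j ∈ J, Pos 2 (a j) (b j) (X j) x with hT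
  have mP : ∀ j, Measurable (Pos 2 (a j) (b j) (X j)) := fun j => pos_meas _ _ _ (hX j)
  have mS : Measurable S := Finset.measurable_fun_sum _ fun j _ => hX j
  have mT : Measurable T := Finset.measurable_fun_sum _ fun j _ => mP j
  by_cases hA : ∫⁻ x, S x ^ q = ∞
  · rw [hA, ENNReal.mul_top (CL_ne_zero hq)]; exact le_top
  have hfin : ∫⁻ x, T x ^ q ≠ ∞ := by
    have : ∫⁻ x, T x ^ q ≤ (J.card : ℝ≥0∞) ^ (q-1) * ∑ j ∈ J, CH q * CH q * ∫⁻ x, S x ^ q := by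
      calc _ ≤ ∫⁻ x, (J.card : ℝ≥0∞) ^ (q-1) * ∑ j ∈ J, Pos 2 (a j) (b j) (X j) x ^ q := by
            apply lintegral_mono; intro x
            exact ENNReal.rpow_sum_le_const_mul_sum_rpow _ _ hq.le
        _ = (J.card : ℝ≥0∞) ^ (q-1) * ∑ j ∈ J, ∫⁻ x, Pos 2 (a j) (b j) (X j) x ^ q := by
            rw [lintegral_const_mul, lintegral_finsetSum]
            · intro j _; exact (mP j).pow_const q
            · exact Finset.measurable_fun_sum _ fun j _ => (mP j).pow_const q
        _ ≤ _ := by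
            gcongr with j hj
            refine (pos_Lq (ha j hj) (hb j hj) (hX j) hq).trans ?_
            gcongr with x
            exact Finset.single_le_sum (f := fun j => X j x) (fun _ _ => zero_le) hj
    refine ne_top_of_le_ne_top ?_ this
    refine ENNReal.mul_ne_top (ENNReal.rpow_ne_top_of_nonneg (by linarith) (by simp)) ?_
    rw [Finset.sum_const, nsmul_eq_mul]
    exact ENNReal.mul_ne_top (by simp)
      (ENNReal.mul_ne_top (ENNReal.mul_ne_top (CH_ne_top hq) (CH_ne_top hq)) hA)
  have key : ∫⁻ x, T x ^ q ≤ (∫⁻ x, S x ^ q) ^ (1/q) *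
      ((CH (q/(q-1)) * CH (q/(q-1))) * ∫⁻ x, T x ^ q) ^ (1 - 1/q) := by
    set W : ℝ × ℝ → ℝ≥0∞ := fun x => T x ^ (q-1) with hW
    have mW : Measurable W := mT.pow_const _
    set Q : ℝ × ℝ → ℝ≥0∞ := fun x => J.sup (fun j => Pos 2 (a j) (b j) W x) with hQ
    have mQ : Measurable Q := sup_meas J fun j => pos_meas _ _ _ mW
    calc _ = ∫⁻ x, ∑ j ∈ J, Pos 2 (a j) (b j) (X j) x * W x := by
          congr 1; ext x
          rw [← Finset.sum_mul]
          have : q = 1 + (q-1) := by ring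
          conv_lhs => rw [this, ENNReal.rpow_add_of_nonneg _ _ (by norm_num) (by linarith)]
          simp [hW, hT]
      _ = ∑ j ∈ J, ∫⁻ x, Pos 2 (a j) (b j) (X j) x * W x := by
          rw [lintegral_finsetSum]
          intro j _; exact (mP j).mul mW
      _ = ∑ j ∈ J, ∫⁻ x, X j x * Pos 2 (a j) (b j) W x := by
          apply Finset.sum_congr rfl; intro j _
          exact pos_symm _ _ _ (hX j) mW
      _ ≤ ∑ j ∈ J, ∫⁻ x, X j x * Q x := by
          gcongr with j hj x
          exact Finset.le_sup (f := fun j => Pos 2 (a j) (b j) W x) hj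
      _ = ∫⁻ x, S x * Q x := by
          rw [← lintegral_finsetSum]
          · congr 1; ext x; rw [← Finset.sum_mul]
          · intro j _; exact (hX j).mul mQ
      _ ≤ (∫⁻ x, S x ^ q) ^ (1/q) * (∫⁻ x, Q x ^ (q/(q-1))) ^ (1/(q/(q-1))) :=
          ENNReal.lintegral_mul_le_Lp_mul_Lq volume hc mS.aemeasurable mQ.aemeasurable
      _ ≤ _ := by
          have e : 1/(q/(q-1)) = 1 - 1/q := by
            have : q - 1 ≠ 0 := by linarith
            field_simp
          rw [e]
          gcongr
          · rw [sub_nonneg, div_le_one hq0]; exact hq.le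
          refine (supPos J a b ha hb mW hq').trans ?_
          gcongr with x
          simp only [hW]
          rw [← ENNReal.rpow_mul]
          have : (q-1) * (q/(q-1)) = q := by
            have : q - 1 ≠ 0 := by linarith
            field_simp
          rw [this]
  have := absorb hq hfin key
  rw [mul_comm]; exact this

lemma real_step {q s x : ℝ} (hq : 1 < q) (hs : 0 ≤ s) (hx : 0 ≤ x) :
    (s + x) ^ q ≤ s ^ q + q * 2 ^ (q-1) * (x * (s ^ (q-1) + x ^ (q-1))) := by
  rcases eq_or_lt_of_le (add_nonneg hs hx) with h0 | h0
  · have hs0 : s = 0 := by linarith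
    have hx0 : x = 0 := by linarith
    subst hs0 hx0
    simp
  have h1 := one_add_mul_self_le_rpow_one_add (s := -(x/(s+x)))
    (by rw [neg_le_neg_iff, div_le_one h0]; linarith) hq.le
  have e1 : 1 + -(x/(s+x)) = s/(s+x) := by field_simp; ring
  rw [e1, Real.div_rpow hs h0.le, le_div_iff₀ (by positivity)] at h1
  have e2 : (s+x)^q = (s+x)^(q-1) * (s+x) := by
    rw [← Real.rpow_add_one h0.ne']; congr 1; ring
  have e3 : (1 + q * -(x/(s+x))) * (s+x)^q = (s+x)^q - q * x * (s+x)^(q-1) := by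
    rw [e2]; field_simp; ring
  rw [e3] at h1
  have h2 : (s+x)^(q-1) ≤ 2^(q-1) * (s^(q-1) + x^(q-1)) := by
    have : (s+x)^(q-1) ≤ (2 * max s x)^(q-1) := by
      apply Real.rpow_le_rpow h0.le _ (by linarith)
      linarith [le_max_left s x, le_max_right s x]
    refine this.trans ?_
    rw [Real.mul_rpow (by norm_num) (le_max_of_le_left hs)]
    gcongr
    have i1 := Real.rpow_nonneg hs (q-1)
    have i2 := Real.rpow_nonneg hx (q-1)
    rcases le_total s x with h | h
    · rw [max_eq_right h]; linarith
    · rw [max_eq_left h]; linarith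
  have h3 : q * x * (s+x)^(q-1) ≤ q * x * (2^(q-1) * (s^(q-1) + x^(q-1))) := by gcongr
  linarith

lemma enn_step {q : ℝ} (hq : 1 < q) (s x : ℝ≥0∞) :
    (s + x) ^ q ≤ s ^ q + ENNReal.ofReal (q * 2 ^ (q-1)) * (x * (s ^ (q-1) + x ^ (q-1))) := by
  have hq0 : 0 < q := by linarith
  have hq1 : 0 < q-1 := by linarith
  rcases eq_or_ne s ∞ with hs | hs
  · subst hs; simp [hq0]
  rcases eq_or_ne x ∞ with hx | hx
  · subst hx
    have : ENNReal.ofReal (q * 2 ^ (q-1)) * (∞ * (s ^ (q-1) + ∞ ^ (q-1))) = ∞ := by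
      rw [ENNReal.top_rpow_of_pos hq1, add_top, ENNReal.top_mul_top, ENNReal.mul_top]
      simp only [ne_eq, ENNReal.ofReal_eq_zero, not_le]; positivity
    rw [this]; simp
  rw [← ENNReal.ofReal_toReal hs, ← ENNReal.ofReal_toReal hx]
  set s' := s.toReal
  set x' := x.toReal
  have hs' : 0 ≤ s' := ENNReal.toReal_nonneg
  have hx' : 0 ≤ x' := ENNReal.toReal_nonneg
  rw [← ENNReal.ofReal_add hs' hx', ENNReal.ofReal_rpow_of_nonneg (by positivity) hq0.le,
    ENNReal.ofReal_rpow_of_nonneg hs' hq0.le, ENNReal.ofReal_rpow_of_nonneg hs' hq1.le,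
    ENNReal.ofReal_rpow_of_nonneg hx' hq1.le, ← ENNReal.ofReal_add (by positivity) (by positivity),
    ← ENNReal.ofReal_mul hx', ← ENNReal.ofReal_mul (by positivity),
    ← ENNReal.ofReal_add (by positivity) (by positivity)]
  exact ENNReal.ofReal_le_ofReal (real_step hq hs' hx')

lemma telescope {q : ℝ} (hq : 1 < q) (F : Finset ℤ) (X : ℤ → ℝ≥0∞) :
    (∑ i ∈ F, X i) ^ q ≤ ENNReal.ofReal (q * 2 ^ (q-1)) *
      ∑ i ∈ F, (X i * ((∑ j ∈ F with j < i, X j) ^ (q-1) + X i ^ (q-1))) := by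
  induction F using Finset.induction_on_max with
  | empty => simp; linarith
  | insert a s hmax ih =>
    have ha : a ∉ s := fun h => lt_irrefl _ (hmax a h)
    rw [Finset.sum_insert ha, Finset.sum_insert ha, add_comm (X a)]
    refine (enn_step hq _ _).trans ?_
    have e1 : (insert a s).filter (fun j => j < a) = s := by
      ext j; simp only [Finset.mem_filter, Finset.mem_insert]
      constructor
      · rintro ⟨h | h, h2⟩
        · omega
        · exact h
      · intro h; exact ⟨Or.inr h, hmax j h⟩
    have e2 : ∀ i ∈ s, (insert a s).filter (fun j => j < i) = s.filter (fun j => j < i) := by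
      intro i hi
      ext j; simp only [Finset.mem_filter, Finset.mem_insert]
      have := hmax i hi
      constructor
      · rintro ⟨h | h, h2⟩
        · omega
        · exact ⟨h, h2⟩
      · rintro ⟨h, h2⟩; exact ⟨Or.inr h, h2⟩
    refine le_trans ?_ (le_of_eq (mul_add _ _ _).symm)
    refine le_trans (le_of_eq (add_comm _ _)) ?_
    refine add_le_add (le_of_eq (by rw [e1])) ?_
    refine ih.trans (le_of_eq ?_)
    congr 1
    apply Finset.sum_congr rfl
    intro i hi
    rw [e2 i hi]

lemma sum_rpow_le {ι : Type*} {q : ℝ} (hq : 1 < q) (F : Finset ι) (X : ι → ℝ≥0∞) :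
    ∑ i ∈ F, X i ^ q ≤ (∑ i ∈ F, X i) ^ q := by
  classical
  induction F using Finset.induction_on with
  | empty => simp
  | insert a s ha ih =>
    rw [Finset.sum_insert ha, Finset.sum_insert ha]
    refine (add_le_add_right ih _).trans ?_
    exact ENNReal.add_rpow_le_rpow_add _ _ hq.le

lemma recursion {q : ℝ} (hq : 1 < q) {M : ℕ} (hM : 2 * (q-1) ≤ M) (F : Finset ℤ)
    {X G : ℤ → ℝ × ℝ → ℝ≥0∞} (mX : ∀ i, Measurable (X i)) (mG : ∀ i, Measurable (G i))
    {a b τ B : ℤ → ℝ} (ha : ∀ i, 0 < a i) (hb : ∀ i, 0 < b i) (hτ : ∀ i, 0 < τ i)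
    (hB : ∀ i, 0 < B i) {C1 D : ℝ≥0∞} (hD : 1 ≤ D) (hDt : D ≠ ∞)
    (h1 : ∀ i x, X i x ≤ C1 * Pos 2 (a i) (b i) (X i) x)
    (h2 : ∀ i, ∀ W : ℝ × ℝ → ℝ≥0∞, Measurable W → Slow M (τ i) (B i) W →
      ∫⁻ x, X i x * W x ≤ D * ∫⁻ x, G i x * W x)
    (h3 : ∀ i, ∫⁻ x, X i x ^ q ≤ D * ∫⁻ x, G i x ^ q)
    (h4 : ∀ i ∈ F, ∀ j ∈ F, j < i → τ i ≤ a j ∧ B i ≤ b j) :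
    ∫⁻ x, (∑ i ∈ F, X i x) ^ q ≤
      (ENNReal.ofReal (q * 2 ^ (q-1)) * (C1 ^ (q-1) * CL q ^ (1-1/q) + 1) * D) ^ q *
        ∫⁻ x, (∑ i ∈ F, G i x) ^ q := by
  have hq0 : 0 < q := by linarith
  have h1q : 0 ≤ 1 - 1/q := by
    rw [sub_nonneg, div_le_one hq0]; exact hq.le
  set E : ℝ≥0∞ := ENNReal.ofReal (q * 2 ^ (q-1)) * (C1 ^ (q-1) * CL q ^ (1-1/q) + 1) * D with hE
  have hE1 : 1 ≤ E := by
    rw [hE]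
    have : (1:ℝ≥0∞) ≤ ENNReal.ofReal (q * 2 ^ (q-1)) := by
      rw [ENNReal.one_le_ofReal]
      have := Real.one_le_rpow (by norm_num : (1:ℝ) ≤ 2) (by linarith : 0 ≤ q - 1)
      nlinarith
    calc (1:ℝ≥0∞) = 1 * 1 * 1 := by simp
      _ ≤ _ := by gcongr; exact le_add_self
  set S : ℝ × ℝ → ℝ≥0∞ := fun x => ∑ j ∈ F, X j x with hS
  set A := ∫⁻ x, (∑ i ∈ F, G i x) ^ q with hA
  set T : ℝ × ℝ → ℝ≥0∞ := fun x => ∑ j ∈ F, Pos 2 (a j) (b j) (X j) x with hT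
  have mP : ∀ j, Measurable (Pos 2 (a j) (b j) (X j)) := fun j => pos_meas _ _ _ (mX j)
  have mS : Measurable S := Finset.measurable_fun_sum _ fun j _ => mX j
  have mT : Measurable T := Finset.measurable_fun_sum _ fun j _ => mP j
  have mGs : Measurable fun x => ∑ i ∈ F, G i x := Finset.measurable_fun_sum _ fun j _ => mG j
  change ∫⁻ x, S x ^ q ≤ E ^ q * A
  have hE0 : E ^ q ≠ 0 := by
    have : (1:ℝ≥0∞) ≤ E ^ q := by simpa using ENNReal.rpow_le_rpow hE1 hq0.le
    exact (zero_lt_one.trans_le this).ne'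
  by_cases hAt : A = ∞
  · rw [hAt, ENNReal.mul_top hE0]; exact le_top
  have hGi : ∑ i ∈ F, ∫⁻ x, G i x ^ q ≤ A := by
    rw [← lintegral_finsetSum]
    · apply lintegral_mono; intro x; exact sum_rpow_le hq F _
    · intro i _; exact (mG i).pow_const q
  have hXi : ∑ i ∈ F, ∫⁻ x, X i x ^ q ≤ D * A := by
    calc _ ≤ ∑ i ∈ F, D * ∫⁻ x, G i x ^ q := Finset.sum_le_sum fun i _ => h3 i
      _ ≤ _ := by rw [← Finset.mul_sum]; gcongr
  have hfin : ∫⁻ x, S x ^ q ≠ ∞ := by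
    have : ∫⁻ x, S x ^ q ≤ (F.card : ℝ≥0∞) ^ (q-1) * (D * A) := by
      calc _ ≤ ∫⁻ x, (F.card : ℝ≥0∞) ^ (q-1) * ∑ j ∈ F, X j x ^ q := by
            apply lintegral_mono; intro x
            exact ENNReal.rpow_sum_le_const_mul_sum_rpow _ _ hq.le
        _ = (F.card : ℝ≥0∞) ^ (q-1) * ∑ j ∈ F, ∫⁻ x, X j x ^ q := by
            rw [lintegral_const_mul, lintegral_finsetSum]
            · intro j _; exact (mX j).pow_const q
            · exact Finset.measurable_fun_sum _ fun j _ => (mX j).pow_const q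
        _ ≤ _ := by gcongr
    refine ne_top_of_le_ne_top ?_ this
    exact ENNReal.mul_ne_top (ENNReal.rpow_ne_top_of_nonneg (by linarith) (by simp))
      (ENNReal.mul_ne_top hDt hAt)
  -- main estimate
  have hmain : ∀ i ∈ F, ∫⁻ x, X i x * (∑ j ∈ F with j < i, X j x) ^ (q-1) ≤
      C1 ^ (q-1) * D * ∫⁻ x, G i x * T x ^ (q-1) := by
    intro i hi
    set W : ℝ × ℝ → ℝ≥0∞ := fun x => (∑ j ∈ F with j < i, Pos 2 (a j) (b j) (X j) x) ^ (q-1) with hW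
    have mW : Measurable W := (Finset.measurable_fun_sum _ fun j _ => mP j).pow_const _
    have hWS : Slow M (τ i) (B i) W := by
      apply Slow.rpow (hτ i) (hB i) (M := 2) _ (by linarith) (by exact_mod_cast hM)
      apply Slow.sum
      intro j hj
      rw [Finset.mem_filter] at hj
      obtain ⟨g1, g2⟩ := h4 i hi j hj.1 hj.2
      exact (pos_slow 2 (ha j) (hb j) (mX j)).mono_scale (hτ i) (hB i) g1 g2
    calc _ ≤ ∫⁻ x, C1 ^ (q-1) * (X i x * W x) := by
          apply lintegral_mono; intro x
          dsimp only
          have : (∑ j ∈ F with j < i, X j x) ^ (q-1) ≤ C1 ^ (q-1) * W x := by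
            rw [← ENNReal.mul_rpow_of_nonneg _ _ (by linarith), Finset.mul_sum]
            apply ENNReal.rpow_le_rpow _ (by linarith)
            exact Finset.sum_le_sum fun j _ => h1 j x
          calc _ ≤ X i x * (C1 ^ (q-1) * W x) := by gcongr
            _ = _ := by ring
      _ = C1 ^ (q-1) * ∫⁻ x, X i x * W x := by
          rw [lintegral_const_mul _ (by fun_prop)]
      _ ≤ C1 ^ (q-1) * (D * ∫⁻ x, G i x * W x) := by gcongr; exact h2 i W mW hWS
      _ ≤ _ := by
          rw [mul_assoc]
          gcongr with x
          simp only [hW]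
          apply ENNReal.rpow_le_rpow _ (by linarith)
          exact Finset.sum_le_sum_of_subset (Finset.filter_subset _ _)
  have hGT : ∑ i ∈ F, ∫⁻ x, G i x * T x ^ (q-1) ≤
      A ^ (1/q) * (CL q * ∫⁻ x, S x ^ q) ^ (1 - 1/q) := by
    have hc : q.HolderConjugate (q / (q - 1)) := Real.HolderConjugate.conjExponent hq
    rw [← lintegral_finsetSum _ (fun i _ => by fun_prop)]
    simp_rw [← Finset.sum_mul]
    refine (ENNReal.lintegral_mul_le_Lp_mul_Lq volume hc mGs.aemeasurable
      (mT.pow_const _).aemeasurable).trans ?_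
    have e : 1/(q/(q-1)) = 1 - 1/q := by
      have : q - 1 ≠ 0 := by linarith
      field_simp
    rw [e]
    gcongr
    simp_rw [← ENNReal.rpow_mul]
    have : (q-1) * (q/(q-1)) = q := by
      have : q - 1 ≠ 0 := by linarith
      field_simp
    rw [this]
    exact sumPos F a b (fun j _ => ha j) (fun j _ => hb j) mX hq
  set I := ∫⁻ x, S x ^ q with hI
  have htot : I ≤ ENNReal.ofReal (q * 2 ^ (q-1)) *
      (C1 ^ (q-1) * D * (A ^ (1/q) * (CL q * I) ^ (1 - 1/q)) + D * A) := by
    calc I ≤ ∫⁻ x, ENNReal.ofReal (q * 2 ^ (q-1)) *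
          ∑ i ∈ F, (X i x * (∑ j ∈ F with j < i, X j x) ^ (q-1) + X i x ^ q) := by
          apply lintegral_mono; intro x
          refine (telescope hq F (fun i => X i x)).trans (le_of_eq ?_)
          congr 1
          apply Finset.sum_congr rfl; intro i _
          rw [mul_add]
          congr 1
          have : q = 1 + (q-1) := by ring
          conv_rhs => rw [this, ENNReal.rpow_add_of_nonneg _ _ (by norm_num) (by linarith)]
          simp
      _ = ENNReal.ofReal (q * 2 ^ (q-1)) *
          ((∑ i ∈ F, ∫⁻ x, X i x * (∑ j ∈ F with j < i, X j x) ^ (q-1)) +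
            ∑ i ∈ F, ∫⁻ x, X i x ^ q) := by
          have m1 : ∀ i, Measurable fun x => X i x * (∑ j ∈ F with j < i, X j x) ^ (q-1) :=
            fun i => (mX i).mul ((Finset.measurable_fun_sum _ fun j _ => mX j).pow_const _)
          rw [lintegral_const_mul, lintegral_finsetSum, ← Finset.sum_add_distrib]
          · congr 1
            apply Finset.sum_congr rfl; intro i _
            rw [lintegral_add_left (m1 i)]
          · intro i _; exact (m1 i).add ((mX i).pow_const q)
          · exact Finset.measurable_fun_sum _ fun i _ => (m1 i).add ((mX i).pow_const q)
      _ ≤ _ := by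
          gcongr
          calc _ ≤ ∑ i ∈ F, C1 ^ (q-1) * D * ∫⁻ x, G i x * T x ^ (q-1) :=
                Finset.sum_le_sum hmain
            _ ≤ _ := by rw [← Finset.mul_sum]; gcongr
  rcases le_or_gt I A with hIA | hIA
  · calc I ≤ 1 * A := by simpa using hIA
      _ ≤ E ^ q * A := by gcongr; simpa using ENNReal.rpow_le_rpow hE1 hq0.le
  have hA2 : A ≤ A ^ (1/q) * I ^ (1-1/q) := by
    calc A = A ^ (1/q) * A ^ (1-1/q) := by
          rw [← ENNReal.rpow_add_of_nonneg _ _ (by positivity) h1q]; simp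
      _ ≤ _ := by gcongr
  have hfinal : I ≤ A ^ (1/q) * (E ^ (q/(q-1)) * I) ^ (1-1/q) := by
    calc I ≤ _ := htot
      _ ≤ ENNReal.ofReal (q * 2 ^ (q-1)) *
      (C1 ^ (q-1) * D * (A ^ (1/q) * (CL q * I) ^ (1 - 1/q)) + D * (A ^ (1/q) * I ^ (1-1/q))) := by
          gcongr
      _ = E * (A ^ (1/q) * I ^ (1-1/q)) := by
          rw [ENNReal.mul_rpow_of_nonneg _ _ h1q, hE]; ring
      _ = _ := by
          rw [ENNReal.mul_rpow_of_nonneg _ _ h1q, ← ENNReal.rpow_mul]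
          have : q/(q-1) * (1-1/q) = 1 := by
            have : q - 1 ≠ 0 := by linarith
            field_simp
          rw [this, ENNReal.rpow_one]; ring
  have := absorb hq hfin hfinal
  rw [← ENNReal.rpow_mul] at this
  have e : q/(q-1) * (q-1) = q := by
    have : q - 1 ≠ 0 := by linarith
    field_simp
  rw [e, mul_comm] at this
  exact this

/-- averaging along the curve -/
noncomputable def AA (α θ : ℝ → ℝ) (u : ℝ) (h : ℝ × ℝ → ℂ) (x : ℝ × ℝ) : ℂ :=
  ∫ t : ℝ, h (x.1 - t, x.2 - u * θ t) * (α t : ℂ)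

lemma mul_le_sq_add (a b : ℝ≥0∞) : a * b ≤ a ^ 2 + b ^ 2 := by
  rcases le_total a b with h | h
  · calc a * b ≤ b * b := by gcongr
      _ = b ^ 2 := by ring
      _ ≤ _ := le_add_self
  · calc a * b ≤ a * a := by gcongr
      _ = a ^ 2 := by ring
      _ ≤ _ := le_self_add

lemma lint_trans (F : ℝ × ℝ → ℝ≥0∞) (c d : ℝ) :
    ∫⁻ x : ℝ × ℝ, F (x.1 - c, x.2 - d) = ∫⁻ x, F x := by
  have := lintegral_sub_right_eq_self (μ := (volume : Measure (ℝ × ℝ))) F (c, d)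
  rw [← this]; rfl

lemma int_trans (F : ℝ × ℝ → ℂ) (c d : ℝ) :
    ∫ x : ℝ × ℝ, F (x.1 - c, x.2 - d) = ∫ x, F x := by
  have := integral_sub_right_eq_self (μ := (volume : Measure (ℝ × ℝ))) F (c, d)
  rw [← this]; rfl

lemma intble_of_bdd {E : Type*} [MeasurableSpace E] {μ : Measure E} {f : E → ℂ}
    (hm : Measurable f) {C : ℝ} (hC : ∀ x, ‖f x‖ ≤ C) {S : Set E}
    (hμ : μ S ≠ ∞) (hS : ∀ x, f x ≠ 0 → x ∈ S) : Integrable f μ := by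
  have h1 : IntegrableOn f S μ :=
    Measure.integrableOn_of_bounded hμ hm.aestronglyMeasurable (ae_of_all _ hC)
  refine (integrableOn_iff_integrable_of_support_subset ?_).1 h1
  intro x hx; exact hS x hx

lemma pair_bound {V V1 : ℝ × ℝ → ℂ} {b C R : ℝ} (hb : 0 < b)
    (mV : Measurable V) (mV1 : Measurable V1)
    (hC1 : ∀ x, ‖V1 x‖ ≤ C) (hR1 : ∀ x, V1 x ≠ 0 → |x.1| ≤ R ∧ |x.2| ≤ R)
    (hd : ∀ x : ℝ × ℝ, HasDerivAt (fun s => V (x.1, s)) (((b⁻¹ : ℝ) : ℂ) * V1 x) x.2)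
    (r δ : ℝ) :
    ‖∫ u in Icc (1:ℝ) 2, ∫ x : ℝ × ℝ, V1 (x.1 - r, x.2 - u * δ) * (starRingEnd ℂ) (V1 x)‖ₑ ≤
      ENNReal.ofReal (4 * b / (b + |δ|)) * ∫⁻ x, (‖V x‖ₑ ^ 2 + ‖V1 x‖ₑ ^ 2) := by
  set N := ∫⁻ x, (‖V x‖ₑ ^ 2 + ‖V1 x‖ₑ ^ 2) with hN
  have hN1 : ∫⁻ x, ‖V1 x‖ₑ ^ 2 ≤ N := by
    apply lintegral_mono; intro x; exact le_add_self
  have hNe : N = (∫⁻ x, ‖V x‖ₑ ^ 2) + ∫⁻ x, ‖V1 x‖ₑ ^ 2 := lintegral_add_left (by fun_prop) _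
  have first : ‖∫ u in Icc (1:ℝ) 2, ∫ x : ℝ × ℝ, V1 (x.1 - r, x.2 - u * δ) *
      (starRingEnd ℂ) (V1 x)‖ₑ ≤ 2 * N := by
    refine (enorm_integral_le_lintegral_enorm _).trans ?_
    have : ∀ u : ℝ, ‖∫ x : ℝ × ℝ, V1 (x.1 - r, x.2 - u * δ) * (starRingEnd ℂ) (V1 x)‖ₑ ≤ 2 * N := by
      intro u
      refine (enorm_integral_le_lintegral_enorm _).trans ?_
      calc _ ≤ ∫⁻ x : ℝ × ℝ, (‖V1 (x.1 - r, x.2 - u * δ)‖ₑ ^ 2 + ‖V1 x‖ₑ ^ 2) := by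
            apply lintegral_mono; intro x
            simp only [enorm_mul, RCLike.enorm_conj]
            exact mul_le_sq_add _ _
        _ = (∫⁻ x : ℝ × ℝ, ‖V1 (x.1 - r, x.2 - u * δ)‖ₑ ^ 2) + ∫⁻ x, ‖V1 x‖ₑ ^ 2 := 
            lintegral_add_left (by fun_prop) _
        _ ≤ N + N := by
            gcongr
            rw [lint_trans (fun x => ‖V1 x‖ₑ ^ 2)]; exact hN1
        _ = _ := by ring
    calc _ ≤ ∫⁻ u in Icc (1:ℝ) 2, 2 * N := lintegral_mono fun u => this u
      _ = 2 * N := by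
        rw [setLIntegral_const, Real.volume_Icc]; norm_num
  rcases le_or_gt |δ| b with hδ | hδ
  · refine first.trans ?_
    gcongr
    rw [show (2:ℝ≥0∞) = ENNReal.ofReal 2 by norm_num]
    apply ENNReal.ofReal_le_ofReal
    rw [le_div_iff₀ (by positivity)]; linarith
  have hδ0 : 0 < |δ| := hb.trans hδ
  have hδne : δ ≠ 0 := abs_pos.1 hδ0
  -- swap
  have hint : Integrable (Function.uncurry fun (u : ℝ) (x : ℝ × ℝ) =>
      V1 (x.1 - r, x.2 - u * δ) * (starRingEnd ℂ) (V1 x))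
      ((volume.restrict (Icc (1:ℝ) 2)).prod (volume : Measure (ℝ × ℝ))) := by
    have hmeas : Measurable (Function.uncurry fun (u : ℝ) (x : ℝ × ℝ) =>
      V1 (x.1 - r, x.2 - u * δ) * (starRingEnd ℂ) (V1 x)) := by
      simp only [Function.uncurry_def]
      have h2 : Measurable fun z : ℝ × (ℝ × ℝ) => (starRingEnd ℂ) (V1 z.2) :=
        (Complex.continuous_conj.measurable).comp (mV1.comp measurable_snd)
      exact Measurable.mul (by fun_prop) h2
    refine intble_of_bdd (C := C * C) (S := univ ×ˢ (Icc (-R) R ×ˢ Icc (-R) R)) hmeas ?_ ?_ ?_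
    · rintro ⟨u, x⟩
      simp only [Function.uncurry_apply_pair, norm_mul, RCLike.norm_conj]
      exact mul_le_mul (hC1 _) (hC1 _) (norm_nonneg _) ((norm_nonneg _).trans (hC1 x))
    · rw [Measure.prod_prod, Measure.volume_eq_prod, Measure.prod_prod]
      simp only [Measure.restrict_apply_univ, Real.volume_Icc]
      exact ENNReal.mul_ne_top (by simp) (ENNReal.mul_ne_top (by simp) (by simp))
    · rintro ⟨u, x⟩ h
      simp only [Function.uncurry_apply_pair] at h
      have : V1 x ≠ 0 := by
        intro h0; rw [h0] at h; simp at h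
      obtain ⟨h1, h2⟩ := hR1 x this
      simp only [mem_prod, mem_univ, true_and, mem_Icc]
      exact ⟨abs_le.1 h1, abs_le.1 h2⟩
  rw [integral_integral_swap hint]
  have inner : ∀ x : ℝ × ℝ, ∫ u in Icc (1:ℝ) 2, V1 (x.1 - r, x.2 - u * δ) * (starRingEnd ℂ) (V1 x) =
      ((b/δ : ℝ) : ℂ) * (V (x.1 - r, x.2 - δ) - V (x.1 - r, x.2 - 2 * δ)) * (starRingEnd ℂ) (V1 x) := by
    intro x
    rw [integral_mul_const]
    congr 1
    rw [integral_Icc_eq_integral_Ioc, ← intervalIntegral.integral_of_le (by norm_num)]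
    have hder : ∀ u ∈ uIcc (1:ℝ) 2, HasDerivAt (fun u : ℝ => -((b/δ : ℝ) : ℂ) * V (x.1 - r, x.2 - u * δ))
        (V1 (x.1 - r, x.2 - u * δ)) u := by
      intro u _
      have h1 := hd (x.1 - r, x.2 - u * δ)
      have h2 : HasDerivAt (fun u : ℝ => x.2 - u * δ) (-δ) u := by
        simpa using ((hasDerivAt_id u).mul_const δ).const_sub x.2
      have h3 := (HasDerivAt.scomp u h1 h2).const_mul (-((b/δ : ℝ) : ℂ))
      refine HasDerivAt.congr_deriv h3 ?_
      have : (δ : ℂ) ≠ 0 := by exact_mod_cast hδne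
      have : (b : ℂ) ≠ 0 := by exact_mod_cast hb.ne'
      rw [show (-δ) • (((b⁻¹ : ℝ) : ℂ) * V1 (x.1 - r, x.2 - u * δ)) = ((-δ : ℝ) : ℂ) * (((b⁻¹ : ℝ) : ℂ) * V1 (x.1 - r, x.2 - u * δ)) from Complex.real_smul]
      push_cast
      field_simp
    rw [intervalIntegral.integral_eq_sub_of_hasDerivAt hder]
    · simp only [one_mul]; ring
    · rw [intervalIntegrable_iff_integrableOn_Ioc_of_le (by norm_num)]
      exact Measure.integrableOn_of_bounded (M := C) (by simp) (Measurable.aestronglyMeasurable (by fun_prop)) (ae_of_all _ fun u => hC1 _)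
  simp_rw [inner]
  refine (enorm_integral_le_lintegral_enorm _).trans ?_
  calc _ ≤ ∫⁻ x : ℝ × ℝ, ENNReal.ofReal (b/|δ|) * ((‖V (x.1 - r, x.2 - δ)‖ₑ ^ 2 + ‖V1 x‖ₑ ^ 2) +
        (‖V (x.1 - r, x.2 - 2 * δ)‖ₑ ^ 2 + ‖V1 x‖ₑ ^ 2)) := by
        apply lintegral_mono; intro x
        simp only [enorm_mul, RCLike.enorm_conj]
        rw [mul_assoc]
        have e : ‖((b/δ : ℝ) : ℂ)‖ₑ = ENNReal.ofReal (b/|δ|) := by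
          rw [← ofReal_norm, Complex.norm_real, Real.norm_eq_abs, abs_div, abs_of_pos hb]
        rw [e]
        gcongr
        calc _ ≤ (‖V (x.1 - r, x.2 - δ)‖ₑ + ‖V (x.1 - r, x.2 - 2 * δ)‖ₑ) * ‖V1 x‖ₑ := by
              gcongr; exact enorm_sub_le
          _ = ‖V (x.1 - r, x.2 - δ)‖ₑ * ‖V1 x‖ₑ + ‖V (x.1 - r, x.2 - 2 * δ)‖ₑ * ‖V1 x‖ₑ := by ring
          _ ≤ _ := add_le_add (mul_le_sq_add _ _) (mul_le_sq_add _ _)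
    _ = ENNReal.ofReal (b/|δ|) * (2 * N) := by
        rw [lintegral_const_mul _ (by fun_prop), lintegral_add_left (by fun_prop),
          lintegral_add_left (by fun_prop), lintegral_add_left (by fun_prop),
          lint_trans (fun x => ‖V x‖ₑ ^ 2), lint_trans (fun x => ‖V x‖ₑ ^ 2), ← hNe]
        ring
    _ ≤ _ := by
        rw [← mul_assoc, show (2:ℝ≥0∞) = ENNReal.ofReal 2 by norm_num,
          ← ENNReal.ofReal_mul (by positivity)]
        gcongr
        rw [div_mul_eq_mul_div, div_le_div_iff₀ hδ0 (by positivity)]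
        nlinarith

lemma lemA {α θ : ℝ → ℝ} {V V1 : ℝ × ℝ → ℂ} {b C R Ca T : ℝ} (hb : 0 < b)
    (mα : Measurable α) (mθ : Measurable θ)
    (hCa : ∀ t, |α t| ≤ Ca) (hT : ∀ t, α t ≠ 0 → |t| ≤ T ∧ |θ t| ≤ T)
    (mV : Measurable V) (mV1 : Measurable V1)
    (hC1 : ∀ x, ‖V1 x‖ ≤ C) (hR1 : ∀ x, V1 x ≠ 0 → |x.1| ≤ R ∧ |x.2| ≤ R)
    (hd : ∀ x : ℝ × ℝ, HasDerivAt (fun s => V (x.1, s)) (((b⁻¹ : ℝ) : ℂ) * V1 x) x.2) :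
    ∫⁻ x, ∫⁻ u in Icc (1:ℝ) 2, ‖AA α θ u V1 x‖ₑ ^ 2 ≤
      (∫⁻ z : ℝ × ℝ, ‖α z.1‖ₑ * ‖α z.2‖ₑ * ENNReal.ofReal (4 * b / (b + |θ z.1 - θ z.2|))) *
      ∫⁻ x, (‖V x‖ₑ ^ 2 + ‖V1 x‖ₑ ^ 2) := by
  set μ := (volume.restrict (Icc (1:ℝ) 2)).prod (volume : Measure (ℝ × ℝ)) with hμ
  set Ψ : (ℝ × (ℝ × ℝ)) → (ℝ × ℝ) → ℂ := fun w z =>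
    (V1 (w.2.1 - z.1, w.2.2 - w.1 * θ z.1) * (α z.1 : ℂ)) *
      (starRingEnd ℂ) (V1 (w.2.1 - z.2, w.2.2 - w.1 * θ z.2) * (α z.2 : ℂ)) with hΨ
  have mΨ : Measurable (Function.uncurry Ψ) := by
    simp only [Function.uncurry_def, hΨ]
    have h2 : Measurable fun p : (ℝ × (ℝ × ℝ)) × (ℝ × ℝ) => (starRingEnd ℂ)
        (V1 (p.1.2.1 - p.2.2, p.1.2.2 - p.1.1 * θ p.2.2) * (α p.2.2 : ℂ)) :=
        (Complex.continuous_conj.measurable).comp (by fun_prop)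
    exact Measurable.mul (by fun_prop) h2
  have hC0 : 0 ≤ C := (norm_nonneg _).trans (hC1 0)
  have hCa0 : 0 ≤ Ca := (abs_nonneg _).trans (hCa 0)
  have hint : Integrable (Function.uncurry Ψ) (μ.prod volume) := by
    set S : Set ((ℝ × (ℝ × ℝ)) × (ℝ × ℝ)) :=
      (univ ×ˢ (Icc (-(R+T)) (R+T) ×ˢ Icc (-(R+2*T)) (R+2*T))) ×ˢ (Icc (-T) T ×ˢ Icc (-T) T) with hS
    have mS : MeasurableSet S := by
      rw [hS]; measurability
    have hSt : (μ.prod volume) S ≠ ∞ := by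
      rw [hS, Measure.prod_prod, hμ, Measure.prod_prod, Measure.volume_eq_prod, Measure.prod_prod,
        Measure.prod_prod]
      simp only [Measure.restrict_apply_univ, Real.volume_Icc]
      exact ENNReal.mul_ne_top (ENNReal.mul_ne_top (by simp) (ENNReal.mul_ne_top (by simp) (by simp)))
        (ENNReal.mul_ne_top (by simp) (by simp))
    have hbd : ∀ p, ‖Function.uncurry Ψ p‖ ≤ (C * Ca) * (C * Ca) := by
      rintro ⟨w, z⟩
      simp only [Function.uncurry_apply_pair, hΨ, norm_mul, RCLike.norm_conj, Complex.norm_real,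
        Real.norm_eq_abs]
      have h1 := mul_le_mul (hC1 (w.2.1 - z.1, w.2.2 - w.1 * θ z.1)) (hCa z.1) (abs_nonneg _) hC0
      have h2 := mul_le_mul (hC1 (w.2.1 - z.2, w.2.2 - w.1 * θ z.2)) (hCa z.2) (abs_nonneg _) hC0
      exact mul_le_mul h1 h2 (by positivity) (by positivity)
    have h1 : IntegrableOn (Function.uncurry Ψ) S (μ.prod volume) :=
      Measure.integrableOn_of_bounded hSt mΨ.aestronglyMeasurable (ae_of_all _ hbd)
    refine (h1.integrable_indicator mS).congr ?_
    have hae : ∀ᵐ p ∂(μ.prod (volume : Measure (ℝ × ℝ))), p.1.1 ∈ Icc (1:ℝ) 2 := by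
      have e1 : ∀ᵐ u ∂(volume.restrict (Icc (1:ℝ) 2)), u ∈ Icc (1:ℝ) 2 :=
        ae_restrict_mem measurableSet_Icc
      have e2 : ∀ᵐ w ∂μ, w.1 ∈ Icc (1:ℝ) 2 := Measure.quasiMeasurePreserving_fst.ae e1
      exact Measure.quasiMeasurePreserving_fst.ae e2
    filter_upwards [hae] with p hp
    by_cases hpS : p ∈ S
    · rw [indicator_of_mem hpS]
    · rw [indicator_of_notMem hpS]
      by_contra hne
      apply hpS
      obtain ⟨⟨u, x⟩, z⟩ := p
      have hne' : Ψ (u, x) z ≠ 0 := fun h => hne h.symm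
      simp only [hΨ, mul_ne_zero_iff, map_mul, map_ne_zero] at hne'
      obtain ⟨⟨n1, n2⟩, n3, n4⟩ := hne'
      have q1 := hT z.1 (by simpa using n2)
      have q2 := hT z.2 (by simpa using n4)
      have q3 := hR1 _ n1
      simp only [mem_Icc, abs_le] at hp q1 q2 q3
      simp only [hS, mem_prod, mem_univ, true_and, mem_Icc]
      refine ⟨⟨⟨by linarith, by linarith⟩, ?_, ?_⟩, ⟨by linarith, by linarith⟩, by linarith, by linarith⟩
      · nlinarith
      · nlinarith
  have hsq : ∀ w : ℝ × (ℝ × ℝ), ((‖AA α θ w.1 V1 w.2‖ ^ 2 : ℝ) : ℂ) = ∫ z, Ψ w z := by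
    intro w
    simp only [hΨ]
    rw [Measure.volume_eq_prod, integral_prod_mul (μ := volume) (ν := volume)
      (fun t => V1 (w.2.1 - t, w.2.2 - w.1 * θ t) * (α t : ℂ))
      (fun t => (starRingEnd ℂ) (V1 (w.2.1 - t, w.2.2 - w.1 * θ t) * (α t : ℂ)))]
    rw [integral_conj, Complex.mul_conj]
    simp only [AA, Complex.normSq_eq_norm_sq]
  have hint2 : Integrable (fun w => ∫ z, Ψ w z) μ := hint.integral_prod_left
  have hint3 : Integrable (fun w : ℝ × (ℝ × ℝ) => ‖AA α θ w.1 V1 w.2‖ ^ 2) μ := by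
    have := hint2.re
    refine this.congr (ae_of_all _ fun w => ?_)
    simp only [← hsq w]
    exact Complex.ofReal_re _
  have mAA : Measurable fun w : ℝ × (ℝ × ℝ) => AA α θ w.1 V1 w.2 := by
    have h : Measurable fun p : (ℝ × (ℝ × ℝ)) × ℝ =>
      V1 (p.1.2.1 - p.2, p.1.2.2 - p.1.1 * θ p.2) * (α p.2 : ℂ) := by fun_prop
    exact (h.stronglyMeasurable.integral_prod_right' (ν := volume)).measurable
  have step1 : ∫⁻ x, ∫⁻ u in Icc (1:ℝ) 2, ‖AA α θ u V1 x‖ₑ ^ 2 = ‖∫ w, ∫ z, Ψ w z ∂volume ∂μ‖ₑ := by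
    have e1 : ∫ w, ∫ z, Ψ w z ∂volume ∂μ = ((∫ w, ‖AA α θ w.1 V1 w.2‖ ^ 2 ∂μ : ℝ) : ℂ) := by
      rw [← integral_complex_ofReal]
      exact integral_congr_ae (ae_of_all _ fun w => (hsq w).symm)
    rw [e1, ← ofReal_norm, Complex.norm_real, Real.norm_eq_abs,
      abs_of_nonneg (integral_nonneg fun w => by positivity),
      ofReal_integral_eq_lintegral_ofReal hint3 (ae_of_all _ fun w => by positivity), hμ,
      lintegral_prod_symm _ (by fun_prop)]
    refine lintegral_congr fun x => lintegral_congr fun u => ?_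
    simp only [← ofReal_norm]
    rw [ENNReal.ofReal_pow (norm_nonneg _)]
  rw [step1, integral_integral_swap hint]
  refine (enorm_integral_le_lintegral_enorm _).trans ?_
  rw [← lintegral_mul_const _ (by fun_prop)]
  apply lintegral_mono_ae
  filter_upwards [hint.prod_left_ae] with z hz
  have e2 : ∫ w, Ψ w z ∂μ = ((α z.1 : ℂ) * (α z.2 : ℂ)) * ∫ u in Icc (1:ℝ) 2, ∫ x : ℝ × ℝ,
      V1 (x.1 - (z.1 - z.2), x.2 - u * (θ z.1 - θ z.2)) * (starRingEnd ℂ) (V1 x) := by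
    rw [← integral_const_mul]
    rw [hμ, integral_prod (fun w => Ψ w z) hz]
    refine integral_congr_ae (ae_of_all _ fun u => ?_)
    simp only
    symm
    rw [← integral_const_mul, ← int_trans _ z.2 (u * θ z.2)]
    refine integral_congr_ae (ae_of_all _ fun x => ?_)
    simp only [hΨ, map_mul, Complex.conj_ofReal]
    rw [show x.1 - z.2 - (z.1 - z.2) = x.1 - z.1 by ring,
      show x.2 - u * θ z.2 - u * (θ z.1 - θ z.2) = x.2 - u * θ z.1 by ring]
    ring
  rw [e2, enorm_mul, enorm_mul, mul_assoc (‖α z.1‖ₑ * ‖α z.2‖ₑ)]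
  have e3 : ∀ r : ℝ, ‖(r : ℂ)‖ₑ = ‖r‖ₑ := fun r => by
    rw [← ofReal_norm, ← ofReal_norm, Complex.norm_real]
  rw [e3, e3]
  gcongr
  exact pair_bound hb mV mV1 hC1 hR1 hd _ _

/-- single scale data -/
structure SS (K τ B b : ℝ) (α θ : ℝ → ℝ) : Prop where
  hK : 1 ≤ K
  hτ : 0 < τ
  hB : 0 < B
  hb : 0 < b
  mα : Measurable α
  mθ : Measurable θ
  supp : ∀ t, α t ≠ 0 → |t| ≤ 2 * τ
  bd : ∀ t, |α t| ≤ K / τ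
  θbd : ∀ t, α t ≠ 0 → |θ t| ≤ K * B
  sep : ∀ t s, α t ≠ 0 → α s ≠ 0 → B / (K * τ) * |(|t| - |s|)| ≤ |θ t - θ s|
  bB : b ≤ K * B

/-- kernel quantity -/
noncomputable def kern (b : ℝ) (α θ : ℝ → ℝ) : ℝ≥0∞ :=
  ∫⁻ z : ℝ × ℝ, ‖α z.1‖ₑ * ‖α z.2‖ₑ * ENNReal.ofReal (4 * b / (b + |θ z.1 - θ z.2|))

lemma lint_log {b c T : ℝ} (hb : 0 < b) (hc : 0 < c) (hT : 0 < T) :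
    ∫⁻ ρ in Icc (0:ℝ) T, ENNReal.ofReal (4 * b / (b + c * ρ)) =
      ENNReal.ofReal (4 * b / c * Real.log (1 + c * T / b)) := by
  have hder : ∀ ρ ∈ uIcc (0:ℝ) T, HasDerivAt (fun ρ => 4 * b / c * Real.log (b + c * ρ))
      (4 * b / (b + c * ρ)) ρ := by
    intro ρ hρ
    rw [uIcc_of_le hT.le] at hρ
    have hpos : 0 < b + c * ρ := by have := mul_nonneg hc.le hρ.1; linarith
    have h1 : HasDerivAt (fun ρ : ℝ => b + c * ρ) c ρ := by
      simpa using ((hasDerivAt_id ρ).const_mul c).const_add b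
    have h2 := (h1.log hpos.ne').const_mul (4 * b / c)
    refine h2.congr_deriv ?_
    field_simp
  have hcont : ContinuousOn (fun ρ => 4 * b / (b + c * ρ)) (Icc (0:ℝ) T) := by
    apply ContinuousOn.div (by fun_prop) (by fun_prop)
    intro ρ hρ
    have : 0 ≤ c * ρ := mul_nonneg hc.le hρ.1
    positivity
  have hii : IntervalIntegrable (fun ρ => 4 * b / (b + c * ρ)) volume 0 T := by
    apply ContinuousOn.intervalIntegrable; rwa [uIcc_of_le hT.le]
  have h := intervalIntegral.integral_eq_sub_of_hasDerivAt hder hii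
  rw [← ofReal_integral_eq_lintegral_ofReal (hcont.integrableOn_Icc)]
  · rw [integral_Icc_eq_integral_Ioc, ← intervalIntegral.integral_of_le hT.le, h]
    congr 1
    have hbT : 0 < b + c * T := by positivity
    rw [← mul_sub, mul_zero, add_zero, ← Real.log_div hbT.ne' hb.ne']
    congr 2; field_simp
  · filter_upwards [ae_restrict_mem measurableSet_Icc] with ρ hρ
    have : 0 ≤ c * ρ := mul_nonneg hc.le hρ.1
    simp only [Pi.zero_apply]; positivity

lemma kern_bound {K τ B b : ℝ} {α θ : ℝ → ℝ} (h : SS K τ B b α θ) :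
    kern b α θ ≤ ENNReal.ofReal (64 * K ^ 3 * (b / B) * Real.log (1 + 4 * (B / b))) := by
  obtain ⟨hK, hτ, hB, hb, mα, mθ, supp, bd, θbd, sep, bB⟩ := h
  have hK0 : 0 < K := by linarith
  set c := B / (K * τ) with hc
  have hc0 : 0 < c := by positivity
  set J : ℝ → ℝ≥0∞ := (Icc (0:ℝ) (4*τ)).indicator fun ρ => ENNReal.ofReal (4 * b / (b + c * ρ)) with hJ
  have mJ : Measurable J := by
    apply Measurable.indicator _ measurableSet_Icc
    fun_prop
  have hJint : ∫⁻ ρ, J ρ ≤ ENNReal.ofReal (4 * (K * τ * b / B) * Real.log (1 + 4 * (B / b))) := by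
    rw [hJ, lintegral_indicator measurableSet_Icc, lint_log hb hc0 (by positivity)]
    apply ENNReal.ofReal_le_ofReal
    have e1 : 4 * b / c = 4 * (K * τ * b / B) := by rw [hc]; field_simp
    rw [e1]
    have e2 : c * (4 * τ) / b ≤ 4 * (B / b) := by
      rw [hc]
      have : B / (K * τ) * (4 * τ) / b = 4 * (B / b) / K := by field_simp
      rw [this]
      exact div_le_self (by positivity) hK
    have : Real.log (1 + c * (4 * τ) / b) ≤ Real.log (1 + 4 * (B / b)) :=
      Real.log_le_log (by positivity) (by linarith)
    gcongr
  have en : ∀ t, ‖α t‖ₑ ≤ ENNReal.ofReal (K / τ) := by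
    intro t; rw [← ofReal_norm]; exact ENNReal.ofReal_le_ofReal (bd t)
  have inner : ∀ t, ‖α t‖ₑ * ∫⁻ s, ‖α s‖ₑ * ENNReal.ofReal (4 * b / (b + |θ t - θ s|)) ≤
      ‖α t‖ₑ * (ENNReal.ofReal (K / τ) * (4 * ∫⁻ ρ, J ρ)) := by
    intro t
    by_cases ht : α t = 0
    · simp [ht]
    gcongr
    calc _ ≤ ∫⁻ s, ENNReal.ofReal (K / τ) * (J (s - t) + J (t - s) + J (s + t) + J (-t - s)) := by
          apply lintegral_mono; intro s
          simp only
          by_cases hs : α s = 0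
          · simp [hs]
          refine mul_le_mul' (en s) ?_
          have key : ENNReal.ofReal (4 * b / (b + |θ t - θ s|)) ≤ J (|(|t| - |s|)|) := by
            have m : |(|t| - |s|)| ∈ Icc (0:ℝ) (4*τ) := by
              refine ⟨abs_nonneg _, ?_⟩
              have h1 := supp t ht; have h2 := supp s hs
              have h3 := abs_nonneg t; have h4 := abs_nonneg s
              rw [abs_le]; constructor <;> linarith
            rw [hJ, indicator_of_mem m]
            apply ENNReal.ofReal_le_ofReal
            have := sep t s ht hs
            have h0 : 0 ≤ c * |(|t| - |s|)| := by positivity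
            gcongr
          refine key.trans ?_
          rcases abs_cases t with ⟨e1, _⟩ | ⟨e1, _⟩ <;> rcases abs_cases s with ⟨e2, _⟩ | ⟨e2, _⟩ <;>
            rcases abs_cases (|t| - |s|) with ⟨e3, _⟩ | ⟨e3, _⟩ <;> rw [e3, e1, e2]
          all_goals ring_nf
          all_goals first
            | exact le_add_left le_rfl
            | exact le_add_right (le_add_left le_rfl)
            | exact le_add_right (le_add_right (le_add_left le_rfl))
            | exact le_add_right (le_add_right (le_add_right le_rfl))
      _ = _ := by
          rw [lintegral_const_mul _ (by fun_prop), lintegral_add_left (by fun_prop),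
            lintegral_add_left (by fun_prop), lintegral_add_left (by fun_prop),
            lintegral_sub_right_eq_self J t, lintegral_sub_left_eq_self J t,
            lintegral_add_right_eq_self J t, lintegral_sub_left_eq_self J (-t)]
          ring
  have hα : ∫⁻ t, ‖α t‖ₑ ≤ ENNReal.ofReal (4 * K) := by
    calc _ ≤ ∫⁻ t, (Icc (-(2*τ)) (2*τ)).indicator (fun _ => ENNReal.ofReal (K / τ)) t := by
          apply lintegral_mono; intro t
          simp only
          by_cases ht : α t = 0
          · simp [ht]
          rw [indicator_of_mem (mem_Icc.2 (abs_le.1 (supp t ht)))]; exact en t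
      _ = _ := by
          rw [lintegral_indicator_const measurableSet_Icc, Real.volume_Icc,
            ← ENNReal.ofReal_mul (by positivity)]
          congr 1; field_simp; ring
  have hlog : 0 ≤ Real.log (1 + 4 * (B / b)) := Real.log_nonneg (by
    have : 0 ≤ B / b := by positivity
    linarith)
  unfold kern
  rw [Measure.volume_eq_prod, lintegral_prod _ (by fun_prop)]
  calc _ = ∫⁻ t, ‖α t‖ₑ * ∫⁻ s, ‖α s‖ₑ * ENNReal.ofReal (4 * b / (b + |θ t - θ s|)) := by
        refine lintegral_congr fun t => ?_
        rw [← lintegral_const_mul _ (by fun_prop)]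
        refine lintegral_congr fun s => ?_
        simp only [mul_assoc]
    _ ≤ ∫⁻ t, ‖α t‖ₑ * (ENNReal.ofReal (K / τ) * (4 * ∫⁻ ρ, J ρ)) := lintegral_mono inner
    _ = (∫⁻ t, ‖α t‖ₑ) * (ENNReal.ofReal (K / τ) * (4 * ∫⁻ ρ, J ρ)) :=
        lintegral_mul_const _ (by fun_prop)
    _ ≤ ENNReal.ofReal (4 * K) * (ENNReal.ofReal (K / τ) * (ENNReal.ofReal 4 *
        ENNReal.ofReal (4 * (K * τ * b / B) * Real.log (1 + 4 * (B / b))))) := by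
        gcongr; norm_num
    _ = _ := by
        rw [← ENNReal.ofReal_mul (by positivity), ← ENNReal.ofReal_mul (by positivity),
          ← ENNReal.ofReal_mul (by positivity)]
        congr 1; field_simp; ring

lemma kern_bound2 {K τ B b : ℝ} {α θ : ℝ → ℝ} (h : SS K τ B b α θ) :
    ENNReal.ofReal (1 + K * (B / b)) * kern b α θ ≤
      ENNReal.ofReal (128 * K ^ 4 * Real.log (1 + 4 * (B / b))) := by
  have hk := kern_bound h
  obtain ⟨hK, hτ, hB, hb, mα, mθ, supp, bd, θbd, sep, bB⟩ := h
  have hK0 : 0 < K := by linarith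
  have hlog : 0 ≤ Real.log (1 + 4 * (B / b)) := Real.log_nonneg (by
    have : 0 ≤ B / b := by positivity
    linarith)
  calc _ ≤ _ := mul_le_mul_right hk _
    _ = ENNReal.ofReal ((1 + K * (B / b)) * (64 * K ^ 3 * (b / B) * Real.log (1 + 4 * (B / b)))) := by
        rw [← ENNReal.ofReal_mul (by positivity)]
    _ ≤ _ := by
        apply ENNReal.ofReal_le_ofReal
        have e : (1 + K * (B / b)) * (64 * K ^ 3 * (b / B) * Real.log (1 + 4 * (B / b))) =
          64 * K ^ 3 * (b / B + K) * Real.log (1 + 4 * (B / b)) := by field_simp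
        rw [e]
        have : b / B ≤ K := by rw [div_le_iff₀ hB]; exact bB
        calc _ ≤ 64 * K ^ 3 * (K + K) * Real.log (1 + 4 * (B / b)) := by gcongr
          _ = _ := by ring

/-- box -/
def box (A B : ℝ) (z : ℝ × ℝ) : Set (ℝ × ℝ) := {x | |x.1 - z.1| ≤ A ∧ |x.2 - z.2| ≤ B}

lemma box_eq (A B : ℝ) (z : ℝ × ℝ) : box A B z = Icc (z.1 - A) (z.1 + A) ×ˢ Icc (z.2 - B) (z.2 + B) := by
  ext x
  simp only [box, mem_ofPred_eq, mem_prod, mem_Icc, abs_le]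
  constructor
  · rintro ⟨⟨h1, h2⟩, h3, h4⟩; exact ⟨⟨by linarith, by linarith⟩, by linarith, by linarith⟩
  · rintro ⟨⟨h1, h2⟩, h3, h4⟩; exact ⟨⟨by linarith, by linarith⟩, by linarith, by linarith⟩

lemma box_meas (A B : ℝ) (z : ℝ × ℝ) : MeasurableSet (box A B z) := by
  rw [box_eq]; measurability

lemma box_symm {A B : ℝ} {x z : ℝ × ℝ} : x ∈ box A B z ↔ z ∈ box A B x := by
  simp only [box, mem_ofPred_eq, abs_sub_comm]

lemma box_vol {A B : ℝ} (hA : 0 ≤ A) (z : ℝ × ℝ) :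
    volume (box A B z) = ENNReal.ofReal ((2 * A) * (2 * B)) := by
  rw [box_eq, Measure.volume_eq_prod, Measure.prod_prod, Real.volume_Icc, Real.volume_Icc,
    ← ENNReal.ofReal_mul (by linarith)]
  congr 1; ring

lemma box_tonelli {A B : ℝ} (hA : 0 ≤ A) {Z : ℝ × ℝ → ℝ≥0∞} (mZ : Measurable Z) :
    ∫⁻ z, ∫⁻ x in box A B z, Z x = ENNReal.ofReal ((2 * A) * (2 * B)) * ∫⁻ x, Z x := by
  have mS : MeasurableSet {p : (ℝ × ℝ) × (ℝ × ℝ) | |p.2.1 - p.1.1| ≤ A ∧ |p.2.2 - p.1.2| ≤ B} := by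
    have h1 : MeasurableSet {p : (ℝ × ℝ) × (ℝ × ℝ) | |p.2.1 - p.1.1| ≤ A} :=
      measurableSet_le (by fun_prop) (by fun_prop)
    have h2 : MeasurableSet {p : (ℝ × ℝ) × (ℝ × ℝ) | |p.2.2 - p.1.2| ≤ B} :=
      measurableSet_le (by fun_prop) (by fun_prop)
    exact h1.inter h2
  calc _ = ∫⁻ z, ∫⁻ x, {p : (ℝ × ℝ) × (ℝ × ℝ) | |p.2.1 - p.1.1| ≤ A ∧ |p.2.2 - p.1.2| ≤ B}.indicator
          (fun p => Z p.2) (z, x) := by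
        refine lintegral_congr fun z => ?_
        rw [← lintegral_indicator (box_meas _ _ _)]
        rfl
    _ = ∫⁻ x, ∫⁻ z, {p : (ℝ × ℝ) × (ℝ × ℝ) | |p.2.1 - p.1.1| ≤ A ∧ |p.2.2 - p.1.2| ≤ B}.indicator
          (fun p => Z p.2) (z, x) := by
        apply lintegral_lintegral_swap
        apply Measurable.aemeasurable
        exact Measurable.indicator (by fun_prop) mS
    _ = ∫⁻ x, ENNReal.ofReal ((2 * A) * (2 * B)) * Z x := by
        refine lintegral_congr fun x => ?_
        calc _ = ∫⁻ z, (box A B x).indicator (fun _ => Z x) z := by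
              refine lintegral_congr fun z => ?_
              simp only [indicator]
              congr 1
              exact propext (box_symm (x := x) (z := z))
          _ = _ := by
              rw [lintegral_indicator_const (box_meas _ _ _), box_vol hA, mul_comm]
    _ = _ := lintegral_const_mul _ mZ

lemma cell_avg {M : ℕ} {τ B R : ℝ} (hτ : 0 < τ) (hB : 0 < B) (hR : 0 ≤ R) {Z Y W : ℝ × ℝ → ℝ≥0∞}
    (mZ : Measurable Z) (mY : Measurable Y) (mW : Measurable W) (hW : Slow M τ B W) {C : ℝ≥0∞} (hC : C ≠ ∞)
    (h : ∀ z, ∫⁻ x in box τ B z, Z x ≤ C * ∫⁻ x in box (3 * τ) (R * B) z, Y x) :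
    ∫⁻ x, Z x * W x ≤ (ENNReal.ofReal (4 ^ M * (4 * (1 + R)) ^ M * (3 * R)) * C) * ∫⁻ x, Y x * W x := by
  have hc : ENNReal.ofReal ((2 * τ) * (2 * B)) ≠ 0 := by
    simp only [ne_eq, ENNReal.ofReal_eq_zero, not_le]; positivity
  have key : ENNReal.ofReal ((2 * τ) * (2 * B)) * ∫⁻ x, Z x * W x ≤
      ENNReal.ofReal (4 ^ M * (4 * (1 + R)) ^ M) * C * (ENNReal.ofReal ((2 * (3 * τ)) * (2 * (R * B))) *
      ∫⁻ x, Y x * W x) := by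
    rw [← box_tonelli (A := τ) (B := B) (Z := fun x => Z x * W x) hτ.le (mZ.mul mW),
      ← box_tonelli (A := 3 * τ) (B := R * B) (Z := fun x => Y x * W x) (by positivity) (mY.mul mW),
      ← lintegral_const_mul']
    swap
    · exact ENNReal.mul_ne_top ENNReal.ofReal_ne_top hC
    apply lintegral_mono; intro z
    simp only
    calc _ ≤ ∫⁻ x in box τ B z, ENNReal.ofReal (4 ^ M) * W z * Z x := by
          apply setLIntegral_mono' (box_meas _ _ _)
          intro x hx
          rw [mul_comm]
          gcongr
          refine (hW x z).trans ?_
          gcongr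
          have h1 : |x.1 - z.1| / τ ≤ 1 := by rw [div_le_one hτ]; exact hx.1
          have h2 : |x.2 - z.2| / B ≤ 1 := by rw [div_le_one hB]; exact hx.2
          have h3 : 0 ≤ |x.1 - z.1| / τ := by positivity
          have h4 : 0 ≤ |x.2 - z.2| / B := by positivity
          nlinarith
      _ = ENNReal.ofReal (4 ^ M) * W z * ∫⁻ x in box τ B z, Z x := lintegral_const_mul _ mZ
      _ ≤ ENNReal.ofReal (4 ^ M) * W z * (C * ∫⁻ x in box (3 * τ) (R * B) z, Y x) := by
          gcongr; exact h z
      _ = ENNReal.ofReal (4 ^ M) * C * (∫⁻ x in box (3 * τ) (R * B) z, W z * Y x) := by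
          rw [lintegral_const_mul _ mY]; ring
      _ ≤ ENNReal.ofReal (4 ^ M) * C * (∫⁻ x in box (3 * τ) (R * B) z,
          ENNReal.ofReal ((4 * (1 + R)) ^ M) * (Y x * W x)) := by
          refine mul_le_mul' le_rfl ?_
          apply setLIntegral_mono' (box_meas _ _ _)
          intro x hx
          rw [mul_comm (Y x), ← mul_assoc]
          gcongr
          refine (hW z x).trans ?_
          have h1 : |z.1 - x.1| / τ ≤ 3 := by
            rw [div_le_iff₀ hτ, abs_sub_comm]; exact hx.1
          have h2 : |z.2 - x.2| / B ≤ R := by rw [div_le_iff₀ hB, abs_sub_comm]; exact hx.2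
          have h3 : 1 + |z.1 - x.1| / τ ≤ 4 := by linarith
          gcongr
      _ = _ := by
          rw [lintegral_const_mul _ (by fun_prop), ENNReal.ofReal_mul (by positivity)]
          ring
  rw [← ENNReal.mul_le_mul_iff_right hc ENNReal.ofReal_ne_top]
  refine key.trans (le_of_eq ?_)
  rw [show (2 * (3 * τ)) * (2 * (R * B)) = (2 * τ * (2 * B)) * (3 * R) by ring,
    ENNReal.ofReal_mul (p := 2 * τ * (2 * B)) (by positivity),
    ENNReal.ofReal_mul (p := 4 ^ M * (4 * (1 + R)) ^ M) (by positivity)]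
  ring

lemma bump_exists (R : ℝ) (hR : 0 < R) : ∃ χ χ1 : ℝ → ℝ, ∃ D : ℝ, 1 ≤ D ∧
    (∀ s, HasDerivAt χ (χ1 s) s) ∧ Measurable χ ∧ Measurable χ1 ∧ (∀ s, |χ s| ≤ D) ∧
    (∀ s, |χ1 s| ≤ D) ∧ (∀ s, |s| ≤ R → χ s = 1 ∧ χ1 s = 0) ∧
    (∀ s, R + 1 < |s| → χ s = 0 ∧ χ1 s = 0) := by
  let β : ContDiffBump (0:ℝ) := ⟨R + 1/4, R + 1/2, by linarith, by linarith⟩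
  have hβ : ContDiff ℝ (⊤ : ℕ∞) (β : ℝ → ℝ) := β.contDiff
  have hd : Differentiable ℝ (β : ℝ → ℝ) := hβ.differentiable (by simp)
  have hc1 : Continuous (deriv (β : ℝ → ℝ)) := hβ.continuous_deriv (by simp)
  have hcs : HasCompactSupport (β : ℝ → ℝ) := β.hasCompactSupport
  obtain ⟨D1, hD1⟩ := (hcs.deriv).exists_bound_of_continuous hc1
  refine ⟨β, deriv β, max 1 D1, le_max_left _ _, fun s => (hd s).hasDerivAt, hβ.continuous.measurable,
    hc1.measurable, ?_, ?_, ?_, ?_⟩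
  · intro s
    rw [abs_of_nonneg β.nonneg]
    exact β.le_one.trans (le_max_left _ _)
  · intro s; exact (hD1 s).trans (le_max_right _ _)
  · intro s hs
    have hm : s ∈ Metric.ball (0:ℝ) (R + 1/4) := by
      rw [mem_ball_zero_iff, Real.norm_eq_abs]; linarith
    have : (β : ℝ → ℝ) =ᶠ[nhds s] fun _ => 1 := by
      filter_upwards [Metric.isOpen_ball.mem_nhds hm] with y hy
      exact β.one_of_mem_closedBall (Metric.ball_subset_closedBall hy)
    exact ⟨this.eq_of_nhds, by rw [this.deriv_eq]; simp⟩
  · intro s hs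
    have hm : s ∈ (Metric.closedBall (0:ℝ) (R + 1/2))ᶜ := by
      rw [mem_compl_iff, mem_closedBall_zero_iff, Real.norm_eq_abs]; linarith
    have : (β : ℝ → ℝ) =ᶠ[nhds s] fun _ => 0 := by
      filter_upwards [Metric.isClosed_closedBall.isOpen_compl.mem_nhds hm] with y hy
      apply β.zero_of_le_dist
      rw [mem_compl_iff, Metric.mem_closedBall, not_le] at hy
      exact hy.le
    exact ⟨this.eq_of_nhds, by rw [this.deriv_eq]; simp⟩

lemma sq_add_le (a b : ℝ≥0∞) : (a + b) ^ 2 ≤ 2 * (a ^ 2 + b ^ 2) := by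
  have h2 : 2 * (a * b) ≤ a ^ 2 + b ^ 2 := by
    rcases eq_or_ne a ∞ with rfl | ha
    · simp
    rcases eq_or_ne b ∞ with rfl | hb
    · simp
    lift a to ℝ≥0 using ha
    lift b to ℝ≥0 using hb
    norm_cast
    have := two_mul_le_add_sq (a : ℝ) b
    rw [← NNReal.coe_le_coe]; push_cast; linarith
  calc (a + b) ^ 2 = a ^ 2 + 2 * (a * b) + b ^ 2 := by ring
    _ ≤ a ^ 2 + (a ^ 2 + b ^ 2) + b ^ 2 := by gcongr
    _ = _ := by ring

lemma cell (K : ℝ) (hK : 1 ≤ K) : ∃ C : ℝ≥0∞, C ≠ ∞ ∧ ∀ (τ B b : ℝ) (α θ : ℝ → ℝ), SS K τ B b α θ →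
    ∀ (H h : ℝ × ℝ → ℂ) (C0 : ℝ), Measurable H → Measurable h → (∀ x, ‖H x‖ ≤ C0) → (∀ x, ‖h x‖ ≤ C0) →
    (∀ x : ℝ × ℝ, HasDerivAt (fun s => H (x.1, s)) (((b⁻¹ : ℝ) : ℂ) * h x) x.2) →
    ∀ z, ∫⁻ x in box τ B z, ∫⁻ u in Icc (1:ℝ) 2, ‖AA α θ u h x‖ₑ ^ 2 ≤
      C * kern b α θ * ∫⁻ x in box (3 * τ) ((2 * K + 2) * B) z, (‖H x‖ₑ ^ 2 + ‖h x‖ₑ ^ 2) := by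
  obtain ⟨χ, χ1, D, hD, hχ, mχ, mχ1, bχ, bχ1, one, zero⟩ := bump_exists (2 * K + 1) (by linarith)
  refine ⟨ENNReal.ofReal (4 * K ^ 2 * D ^ 2), ENNReal.ofReal_ne_top, ?_⟩
  intro τ B b α θ ⟨_, hτ, hB, hb, mα, mθ, supp, bd, θbd, sep, bB⟩ H h C0 mH mh bH bh hd z
  have hK0 : 0 < K := by linarith
  have hD0 : 0 < D := by linarith
  have hC0 : 0 ≤ C0 := (norm_nonneg _).trans (bH 0)
  set I : ℝ → ℂ := fun s => if |s - z.1| ≤ 3 * τ then 1 else 0 with hI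
  have mI : Measurable I := by
    apply Measurable.ite _ measurable_const measurable_const
    exact measurableSet_le (by fun_prop) (by fun_prop)
  have bI : ∀ s, ‖I s‖ ≤ 1 := by intro s; simp only [hI]; split_ifs <;> simp
  set V : ℝ × ℝ → ℂ := fun x => I x.1 * ((χ ((x.2 - z.2) / B) : ℂ) * H x) with hV
  set V1 : ℝ × ℝ → ℂ := fun x => I x.1 * ((χ ((x.2 - z.2) / B) : ℂ) * h x +
    ((b / B * χ1 ((x.2 - z.2) / B) : ℝ) : ℂ) * H x) with hV1
  have mV : Measurable V := by fun_prop
  have mV1 : Measurable V1 := by fun_prop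
  have hbB : b / B ≤ K := by rw [div_le_iff₀ hB]; exact bB
  have hbB0 : 0 < b / B := by positivity
  have bV1' : ∀ x, ‖V1 x‖ ≤ D * ‖h x‖ + K * D * ‖H x‖ := by
    intro x
    simp only [hV1, norm_mul]
    refine (mul_le_of_le_one_left (norm_nonneg _) (bI _)).trans ((norm_add_le _ _).trans ?_)
    simp only [norm_mul, Complex.norm_real, Real.norm_eq_abs, abs_mul, abs_of_pos hbB0]
    gcongr
    · exact bχ _
    · exact bχ1 _
  have bV1 : ∀ x, ‖V1 x‖ ≤ D * C0 + K * D * C0 := by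
    intro x; refine (bV1' x).trans ?_
    have := bh x; have := bH x
    gcongr
  have bV : ∀ x, ‖V x‖ ≤ D * ‖H x‖ := by
    intro x
    simp only [hV, norm_mul, Complex.norm_real, Real.norm_eq_abs]
    refine (mul_le_of_le_one_left (by positivity) (bI _)).trans ?_
    gcongr
    exact bχ _
  have zeroV : ∀ x, x ∉ box (3 * τ) ((2 * K + 2) * B) z → V x = 0 ∧ V1 x = 0 := by
    intro x hx
    by_cases h1 : |x.1 - z.1| ≤ 3 * τ
    · have h2 : ¬ |x.2 - z.2| ≤ (2 * K + 2) * B := fun h2 => hx ⟨h1, h2⟩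
      have h3 : 2 * K + 1 + 1 < |(x.2 - z.2) / B| := by
        rw [abs_div, abs_of_pos hB, lt_div_iff₀ hB]; push Not at h2; linarith
      obtain ⟨z1, z2⟩ := zero _ h3
      simp [hV, hV1, z1, z2]
    · simp [hV, hV1, hI, h1]
  have hder : ∀ x : ℝ × ℝ, HasDerivAt (fun s => V (x.1, s)) (((b⁻¹ : ℝ) : ℂ) * V1 x) x.2 := by
    intro x
    have h1 : HasDerivAt (fun s : ℝ => (s - z.2) / B) (1 / B) x.2 :=
      ((hasDerivAt_id x.2).sub_const z.2).div_const B
    have h2 := (hχ ((x.2 - z.2) / B)).comp x.2 h1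
    have h3 := ((h2.ofReal_comp).mul (hd x)).const_mul (I x.1)
    refine h3.congr_deriv ?_
    have e1 : (b : ℂ) ≠ 0 := by exact_mod_cast hb.ne'
    have e2 : (B : ℂ) ≠ 0 := by exact_mod_cast hB.ne'
    simp only [hV1, Function.comp_apply]
    push_cast
    field_simp
    ring
  have supp1 : ∀ x, V1 x ≠ 0 → |x.1| ≤ |z.1| + 3 * τ + (|z.2| + (2 * K + 2) * B) ∧
      |x.2| ≤ |z.1| + 3 * τ + (|z.2| + (2 * K + 2) * B) := by
    intro x hx
    have hxb : x ∈ box (3 * τ) ((2 * K + 2) * B) z := by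
      by_contra hc; exact hx (zeroV x hc).2
    have h1 := hxb.1; have h2 := hxb.2
    have h3 := abs_sub_abs_le_abs_sub x.1 z.1
    have h4 := abs_sub_abs_le_abs_sub x.2 z.2
    have h5 := abs_nonneg z.1; have h6 := abs_nonneg z.2
    have h7 : 0 ≤ (2 * K + 2) * B := by positivity
    constructor <;> linarith
  have lA := lemA (T := 2 * τ + K * B) hb mα mθ bd (fun t ht => by
    have h1 := supp t ht; have h2 := θbd t ht
    have h3 : 0 < K * B := by positivity
    constructor <;> linarith) mV mV1 bV1 supp1 hder
  have eqc : ∀ x ∈ box τ B z, ∀ u ∈ Icc (1:ℝ) 2, AA α θ u h x = AA α θ u V1 x := by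
    intro x hx u hu
    unfold AA
    refine integral_congr_ae (ae_of_all _ fun t => ?_)
    simp only
    by_cases ht : α t = 0
    · simp [ht]
    congr 1
    have h1 := supp t ht; have h2 := θbd t ht
    have hx1 := hx.1; have hx2 := hx.2
    have e1 : |x.1 - t - z.1| ≤ 3 * τ := by
      rw [abs_le] at *; constructor <;> linarith
    have e2 : |u * θ t| ≤ 2 * (K * B) := by
      rw [abs_mul, abs_of_nonneg (by linarith [hu.1])]
      exact mul_le_mul hu.2 h2 (abs_nonneg _) (by norm_num)
    have e3 : |(x.2 - u * θ t - z.2) / B| ≤ 2 * K + 1 := by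
      rw [abs_div, abs_of_pos hB, div_le_iff₀ hB]
      rw [abs_le] at *; constructor <;> linarith
    obtain ⟨o1, o2⟩ := one _ e3
    simp [hV1, hI, e1, o1, o2]
  have ptw : ∀ x, ‖V x‖ₑ ^ 2 + ‖V1 x‖ₑ ^ 2 ≤ (box (3 * τ) ((2 * K + 2) * B) z).indicator
      (fun x => ENNReal.ofReal (4 * K ^ 2 * D ^ 2) * (‖H x‖ₑ ^ 2 + ‖h x‖ₑ ^ 2)) x := by
    intro x
    by_cases hx : x ∈ box (3 * τ) ((2 * K + 2) * B) z
    · rw [indicator_of_mem hx]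
      simp only [← ofReal_norm]
      simp only [← ENNReal.ofReal_pow (norm_nonneg _)]
      rw [← ENNReal.ofReal_add (by positivity) (by positivity),
        ← ENNReal.ofReal_add (by positivity) (by positivity), ← ENNReal.ofReal_mul (by positivity)]
      apply ENNReal.ofReal_le_ofReal
      have h1 := bV x; have h2 := bV1' x
      have h3 : ‖V x‖ ^ 2 ≤ (D * ‖H x‖) ^ 2 := by gcongr
      have h4 : ‖V1 x‖ ^ 2 ≤ (D * ‖h x‖ + K * D * ‖H x‖) ^ 2 := by gcongr
      have h5 : 1 ≤ K ^ 2 := one_le_pow₀ hK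
      have h6 : (D * ‖H x‖) ^ 2 ≤ K ^ 2 * (D * ‖H x‖) ^ 2 := le_mul_of_one_le_left (by positivity) h5
      have h7 : (D * ‖h x‖) ^ 2 ≤ K ^ 2 * (D * ‖h x‖) ^ 2 := le_mul_of_one_le_left (by positivity) h5
      have h8 : 0 ≤ (D * ‖h x‖) ^ 2 := by positivity
      have h9 : 0 ≤ K ^ 2 * (D * ‖H x‖) ^ 2 := by positivity
      have h10 : 0 ≤ K ^ 2 * (D * ‖h x‖) ^ 2 := by positivity
      nlinarith [sq_nonneg (D * ‖h x‖ - K * D * ‖H x‖)]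
    · rw [indicator_of_notMem hx, (zeroV x hx).1, (zeroV x hx).2]; simp
  calc _ = ∫⁻ x in box τ B z, ∫⁻ u in Icc (1:ℝ) 2, ‖AA α θ u V1 x‖ₑ ^ 2 := by
        refine setLIntegral_congr_fun (box_meas _ _ _) fun x hx => ?_
        refine setLIntegral_congr_fun measurableSet_Icc fun u hu => ?_
        simp only [eqc x hx u hu]
    _ ≤ ∫⁻ x, ∫⁻ u in Icc (1:ℝ) 2, ‖AA α θ u V1 x‖ₑ ^ 2 := setLIntegral_le_lintegral _ _
    _ ≤ _ := lA
    _ ≤ kern b α θ * ∫⁻ x, (box (3 * τ) ((2 * K + 2) * B) z).indicator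
      (fun x => ENNReal.ofReal (4 * K ^ 2 * D ^ 2) * (‖H x‖ₑ ^ 2 + ‖h x‖ₑ ^ 2)) x := by
        refine mul_le_mul' le_rfl (lintegral_mono ptw)
    _ = _ := by
        rw [lintegral_indicator (box_meas _ _ _), lintegral_const_mul _ (by fun_prop)]; ring

lemma AA_int {K τ B b : ℝ} {α θ : ℝ → ℝ} (hS : SS K τ B b α θ) {h : ℝ × ℝ → ℂ} {C0 : ℝ}
    (mh : Measurable h) (bh : ∀ x, ‖h x‖ ≤ C0) (u : ℝ) (x : ℝ × ℝ) :
    Integrable (fun t : ℝ => h (x.1 - t, x.2 - u * θ t) * (α t : ℂ)) := by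
  have mα := hS.mα; have mθ := hS.mθ
  have hC0 : 0 ≤ C0 := (norm_nonneg _).trans (bh 0)
  refine intble_of_bdd (C := C0 * (K / τ)) (S := Icc (-(2*τ)) (2*τ)) (by fun_prop) ?_ ?_ ?_
  · intro t
    rw [norm_mul, Complex.norm_real]
    exact mul_le_mul (bh _) (hS.bd t) (norm_nonneg _) hC0
  · simp
  · intro t ht
    have : α t ≠ 0 := by intro h0; simp [h0] at ht
    exact mem_Icc.2 (abs_le.1 (hS.supp t this))

lemma AA_meas {α θ : ℝ → ℝ} {h : ℝ × ℝ → ℂ} (mα : Measurable α) (mθ : Measurable θ)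
    (mh : Measurable h) : Measurable fun w : ℝ × (ℝ × ℝ) => AA α θ w.1 h w.2 := by
  have h : Measurable fun p : (ℝ × (ℝ × ℝ)) × ℝ =>
    h (p.1.2.1 - p.2, p.1.2.2 - p.1.1 * θ p.2) * (α p.2 : ℂ) := by fun_prop
  exact (h.stronglyMeasurable.integral_prod_right' (ν := volume)).measurable

lemma AA_bdd {K τ B b : ℝ} {α θ : ℝ → ℝ} (hS : SS K τ B b α θ) {h : ℝ × ℝ → ℂ} {C0 : ℝ}
    (bh : ∀ x, ‖h x‖ ≤ C0) (u : ℝ) (x : ℝ × ℝ) :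
    ‖AA α θ u h x‖ ≤ 4 * K * C0 := by
  have hC0 : 0 ≤ C0 := (norm_nonneg _).trans (bh 0)
  have hτ := hS.hτ
  have hK0 : 0 < K := by linarith [hS.hK]
  have e : AA α θ u h x = ∫ t in Icc (-(2*τ)) (2*τ), h (x.1 - t, x.2 - u * θ t) * (α t : ℂ) := by
    unfold AA
    symm
    apply setIntegral_eq_integral_of_forall_compl_eq_zero
    intro t ht
    have : α t = 0 := by
      by_contra h0; exact ht (mem_Icc.2 (abs_le.1 (hS.supp t h0)))
    simp [this]
  rw [e]
  have := norm_setIntegral_le_of_norm_le_const (μ := volume) (s := Icc (-(2*τ)) (2*τ))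
    (f := fun t => h (x.1 - t, x.2 - u * θ t) * (α t : ℂ)) (C := C0 * (K / τ)) (by simp) (fun t _ => by
      rw [norm_mul, Complex.norm_real]
      exact mul_le_mul (bh _) (hS.bd t) (norm_nonneg _) hC0)
  refine this.trans (le_of_eq ?_)
  rw [Real.volume_real_Icc_of_le (by linarith)]
  field_simp; ring

lemma SS.pp {K τ B b : ℝ} {α θ : ℝ → ℝ} (hS : SS K τ B b α θ) :
    SS K τ B b (fun t => α t * θ t / (K * B)) θ := by
  obtain ⟨hK, hτ, hB, hb, mα, mθ, supp, bd, θbd, sep, bB⟩ := hS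
  have hK0 : 0 < K := by linarith
  have ne : ∀ t, α t * θ t / (K * B) ≠ 0 → α t ≠ 0 := by
    intro t ht h0; simp [h0] at ht
  refine ⟨hK, hτ, hB, hb, by fun_prop, mθ, fun t ht => supp t (ne t ht), ?_, fun t ht => θbd t (ne t ht),
    fun t s ht hs => sep t s (ne t ht) (ne s hs), bB⟩
  intro t
  by_cases h0 : α t = 0
  · simp [h0]; positivity
  rw [abs_div, abs_mul, abs_of_pos (show 0 < K * B by positivity), div_le_iff₀ (by positivity)]
  exact mul_le_mul (bd t) (θbd t h0) (abs_nonneg _) (by positivity)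

lemma AA_deriv {K τ B b : ℝ} {α θ : ℝ → ℝ} (hS : SS K τ B b α θ) {h h2 : ℝ × ℝ → ℂ} {C0 : ℝ}
    (mh : Measurable h) (mh2 : Measurable h2) (bh : ∀ x, ‖h x‖ ≤ C0) (bh2 : ∀ x, ‖h2 x‖ ≤ C0)
    (hd : ∀ x : ℝ × ℝ, HasDerivAt (fun s => h (x.1, s)) (((b⁻¹ : ℝ) : ℂ) * h2 x) x.2)
    (u : ℝ) (x : ℝ × ℝ) :
    HasDerivAt (fun u => AA α θ u h x)
      (-((K * (B / b) : ℝ) : ℂ) * AA (fun t => α t * θ t / (K * B)) θ u h2 x) u := by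
  have hS' := hS
  obtain ⟨hK, hτ, hB, hb, mα, mθ, supp, bd, θbd, sep, bB⟩ := hS
  have hK0 : 0 < K := by linarith
  have hC0 : 0 ≤ C0 := (norm_nonneg _).trans (bh 0)
  have key := hasDerivAt_integral_of_dominated_loc_of_deriv_le (μ := (volume : Measure ℝ)) (x₀ := u)
    (s := univ) (bound := (Icc (-(2*τ)) (2*τ)).indicator fun _ => K * (B / b) * (C0 * (K / τ)))
    (F := fun u t => h (x.1 - t, x.2 - u * θ t) * (α t : ℂ))
    (F' := fun u t => -((K * (B / b) : ℝ) : ℂ) * (h2 (x.1 - t, x.2 - u * θ t) * ((α t * θ t / (K * B) : ℝ) : ℂ)))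
    Filter.univ_mem (Eventually.of_forall fun u => (AA_int hS' mh bh u x).aestronglyMeasurable)
    (AA_int hS' mh bh u x) (((AA_int hS'.pp mh2 bh2 u x).const_mul _).aestronglyMeasurable) ?_ ?_ ?_
  · refine key.2.congr_deriv ?_
    rw [integral_const_mul]; rfl
  · refine ae_of_all _ fun t v _ => ?_
    by_cases ht : α t = 0
    · simp [ht]
      apply indicator_nonneg; intro _ _; positivity
    · rw [indicator_of_mem (mem_Icc.2 (abs_le.1 (supp t ht))), norm_mul, norm_neg, Complex.norm_real,
        Real.norm_eq_abs, abs_of_pos (show 0 < K * (B / b) by positivity), norm_mul, Complex.norm_real]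
      gcongr
      · exact bh2 _
      · exact hS'.pp.bd t
  · rw [integrable_indicator_iff measurableSet_Icc]
    exact integrableOn_const (by simp) enorm_ne_top
  · refine ae_of_all _ fun t v _ => ?_
    have h1 := hd (x.1 - t, x.2 - v * θ t)
    have h2' : HasDerivAt (fun u : ℝ => x.2 - u * θ t) (-θ t) v := by
      simpa using ((hasDerivAt_id v).mul_const (θ t)).const_sub x.2
    have h3 := (HasDerivAt.scomp v h1 h2').mul_const ((α t : ℝ) : ℂ)
    refine h3.congr_deriv ?_
    rw [show (-θ t) • (((b⁻¹ : ℝ) : ℂ) * h2 (x.1 - t, x.2 - v * θ t)) = ((-θ t : ℝ) : ℂ) * (((b⁻¹ : ℝ) : ℂ) * h2 (x.1 - t, x.2 - v * θ t)) from Complex.real_smul]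
    have e1 : (b : ℂ) ≠ 0 := by exact_mod_cast hb.ne'
    have e2 : (B : ℂ) ≠ 0 := by exact_mod_cast hB.ne'
    have e3 : (K : ℂ) ≠ 0 := by exact_mod_cast hK0.ne'
    push_cast
    field_simp

lemma sup_major {K τ B b : ℝ} {α θ : ℝ → ℝ} (hS : SS K τ B b α θ) {h h2 : ℝ × ℝ → ℂ} {C0 : ℝ}
    (mh : Measurable h) (mh2 : Measurable h2) (bh : ∀ x, ‖h x‖ ≤ C0) (bh2 : ∀ x, ‖h2 x‖ ≤ C0)
    (hd : ∀ x : ℝ × ℝ, HasDerivAt (fun s => h (x.1, s)) (((b⁻¹ : ℝ) : ℂ) * h2 x) x.2)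
    (x : ℝ × ℝ) (u : ℝ) (hu : u ∈ Icc (1:ℝ) 2) :
    ‖AA α θ u h x‖ₑ ^ 2 ≤ ENNReal.ofReal (1 + K * (B / b)) *
      ((∫⁻ w in Icc (1:ℝ) 2, ‖AA α θ w h x‖ₑ ^ 2) +
       ∫⁻ w in Icc (1:ℝ) 2, ‖AA (fun t => α t * θ t / (K * B)) θ w h2 x‖ₑ ^ 2) := by
  have hder := fun u => AA_deriv hS mh mh2 bh bh2 hd u x
  have b2 := fun u => AA_bdd hS.pp bh2 u x
  have mF : Measurable fun u => AA α θ u h x := (AA_meas hS.mα hS.mθ mh).comp (by fun_prop : Measurable fun u : ℝ => (u, x))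
  have mF2 : Measurable fun u => AA (fun t => α t * θ t / (K * B)) θ u h2 x :=
    (AA_meas hS.pp.mα hS.mθ mh2).comp (by fun_prop : Measurable fun u : ℝ => (u, x))
  have b1 := fun u => AA_bdd hS bh u x
  set F : ℝ → ℂ := fun u => AA α θ u h x with hF
  set F2 : ℝ → ℂ := fun u => AA (fun t => α t * θ t / (K * B)) θ u h2 x with hF2
  set L : ℝ := K * (B / b) with hL
  have hL0 : 0 ≤ L := by
    have := hS.hB; have := hS.hb; have := hS.hK; positivity
  set I1 := ∫⁻ w in Icc (1:ℝ) 2, ‖F w‖ₑ ^ 2 with hI1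
  set I2 := ∫⁻ w in Icc (1:ℝ) 2, ‖F2 w‖ₑ ^ 2 with hI2
  have one : ∀ w ∈ Icc (1:ℝ) 2, ‖F u‖ₑ ^ 2 ≤ ‖F w‖ₑ ^ 2 + ENNReal.ofReal L * (I1 + I2) := by
    intro w hw
    have hsq : ∀ s ∈ uIcc w u, HasDerivAt (fun s => F s ^ 2) (2 * F s * (-(L : ℂ) * F2 s)) s := by
      intro s _
      have := (hder s).pow 2
      refine this.congr_deriv ?_
      simp only [hF]; push_cast; ring
    have hii : IntervalIntegrable (fun s => 2 * F s * (-(L : ℂ) * F2 s)) volume w u := by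
      rw [intervalIntegrable_iff]
      refine Measure.integrableOn_of_bounded (M := 2 * (4 * K * C0) * (L * (4 * K * C0))) (by simp)
        (Measurable.aestronglyMeasurable (by fun_prop)) (ae_of_all _ fun s => ?_)
      rw [norm_mul, norm_mul, norm_mul, norm_neg, Complex.norm_real, Real.norm_eq_abs, abs_of_nonneg hL0]
      have h1 := b1 s; have h2 := b2 s
      have h0 : 0 ≤ 4 * K * C0 := (norm_nonneg _).trans h1
      have h3 : ‖(2:ℂ)‖ = 2 := by simp
      rw [h3]
      gcongr
    have hftc := intervalIntegral.integral_eq_sub_of_hasDerivAt hsq hii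
    have hsub : uIoc w u ⊆ Icc (1:ℝ) 2 := by
      intro s hs
      rw [mem_uIoc] at hs
      rcases hs with hs | hs
      · exact ⟨hw.1.trans hs.1.le, hs.2.trans hu.2⟩
      · exact ⟨hu.1.trans hs.1.le, hs.2.trans hw.2⟩
    have e1 : F u ^ 2 = F w ^ 2 + ∫ s in w..u, 2 * F s * (-(L : ℂ) * F2 s) := by
      rw [hftc]; ring
    calc ‖F u‖ₑ ^ 2 = ‖F u ^ 2‖ₑ := (enorm_pow _ _).symm
      _ ≤ ‖F w ^ 2‖ₑ + ‖∫ s in w..u, 2 * F s * (-(L : ℂ) * F2 s)‖ₑ := by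
          rw [e1]; exact enorm_add_le _ _
      _ ≤ ‖F w‖ₑ ^ 2 + ENNReal.ofReal L * (I1 + I2) := by
          rw [enorm_pow]
          gcongr
          have e2 : ‖∫ s in w..u, 2 * F s * (-(L : ℂ) * F2 s)‖ₑ =
              ‖∫ s in uIoc w u, 2 * F s * (-(L : ℂ) * F2 s)‖ₑ := by
            rw [← ofReal_norm, ← ofReal_norm, intervalIntegral.norm_intervalIntegral_eq]
          rw [e2]
          refine (enorm_integral_le_lintegral_enorm _).trans ?_
          refine (lintegral_mono_set hsub).trans ?_
          rw [← lintegral_add_left (by fun_prop), ← lintegral_const_mul _ (by fun_prop)]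
          apply lintegral_mono; intro s
          simp only [enorm_mul, enorm_neg]
          have e3 : ‖(L : ℂ)‖ₑ = ENNReal.ofReal L := by
            rw [← ofReal_norm, Complex.norm_real, Real.norm_eq_abs, abs_of_nonneg hL0]
          have e4 : ‖(2 : ℂ)‖ₑ = 2 := by
            rw [← ofReal_norm]; simp
          rw [e3, e4]
          have := sq_add_le ‖F s‖ₑ ‖F2 s‖ₑ
          calc _ = ENNReal.ofReal L * (2 * (‖F s‖ₑ * ‖F2 s‖ₑ)) := by ring
            _ ≤ _ := by
              gcongr
              have h5 : ‖F s‖ₑ ≠ ∞ := by simp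
              have h6 : ‖F2 s‖ₑ ≠ ∞ := by simp
              rw [← ofReal_norm, ← ofReal_norm, ← ENNReal.ofReal_mul (norm_nonneg _),
                ← ENNReal.ofReal_pow (norm_nonneg _), ← ENNReal.ofReal_pow (norm_nonneg _),
                ← ENNReal.ofReal_add (by positivity) (by positivity),
                show (2:ℝ≥0∞) = ENNReal.ofReal 2 by norm_num, ← ENNReal.ofReal_mul (by norm_num)]
              apply ENNReal.ofReal_le_ofReal
              nlinarith [sq_nonneg (‖F s‖ - ‖F2 s‖)]
  have vol1 : volume (Icc (1:ℝ) 2) = 1 := by rw [Real.volume_Icc]; norm_num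
  calc ‖F u‖ₑ ^ 2 = ∫⁻ w in Icc (1:ℝ) 2, ‖F u‖ₑ ^ 2 := by rw [setLIntegral_const, vol1, mul_one]
    _ ≤ ∫⁻ w in Icc (1:ℝ) 2, (‖F w‖ₑ ^ 2 + ENNReal.ofReal L * (I1 + I2)) :=
        setLIntegral_mono' measurableSet_Icc one
    _ = I1 + ENNReal.ofReal L * (I1 + I2) := by
        rw [lintegral_add_left (by fun_prop), setLIntegral_const, vol1, mul_one]
    _ ≤ (I1 + I2) + ENNReal.ofReal L * (I1 + I2) := by gcongr; exact le_self_add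
    _ = _ := by
        rw [ENNReal.ofReal_add zero_le_one hL0, ENNReal.ofReal_one]; ring

lemma weighted (K : ℝ) (hK : 1 ≤ K) (M : ℕ) : ∃ C : ℝ≥0∞, C ≠ ∞ ∧ ∀ (τ B b : ℝ) (α θ : ℝ → ℝ),
    SS K τ B b α θ → ∀ (H h h2 : ℝ × ℝ → ℂ) (C0 : ℝ), Measurable H → Measurable h → Measurable h2 →
    (∀ x, ‖H x‖ ≤ C0) → (∀ x, ‖h x‖ ≤ C0) → (∀ x, ‖h2 x‖ ≤ C0) →
    (∀ x : ℝ × ℝ, HasDerivAt (fun s => H (x.1, s)) (((b⁻¹ : ℝ) : ℂ) * h x) x.2) →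
    (∀ x : ℝ × ℝ, HasDerivAt (fun s => h (x.1, s)) (((b⁻¹ : ℝ) : ℂ) * h2 x) x.2) →
    ∀ W : ℝ × ℝ → ℝ≥0∞, Measurable W → Slow M τ B W →
    ∫⁻ x, (⨆ u ∈ Icc (1:ℝ) 2, ‖AA α θ u h x‖ₑ ^ 2) * W x ≤
      C * ENNReal.ofReal (Real.log (1 + 4 * (B / b))) *
        ∫⁻ x, (‖H x‖ₑ ^ 2 + ‖h x‖ₑ ^ 2 + ‖h2 x‖ₑ ^ 2) * W x := by
  obtain ⟨C1, hC1, hcell⟩ := cell K hK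
  set R := 2 * K + 2 with hR
  have hR0 : 0 ≤ R := by rw [hR]; linarith
  refine ⟨ENNReal.ofReal (4 ^ M * (4 * (1 + R)) ^ M * (3 * R)) * (2 * C1 * ENNReal.ofReal (128 * K ^ 4)),
    ?_, ?_⟩
  · exact ENNReal.mul_ne_top ENNReal.ofReal_ne_top (ENNReal.mul_ne_top (ENNReal.mul_ne_top (by simp) hC1)
      ENNReal.ofReal_ne_top)
  intro τ B b α θ hS H h h2 C0 mH mh mh2 bH bh bh2 hd1 hd2 W mW hW
  have mA1 := AA_meas hS.mα hS.mθ mh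
  have mA2 := AA_meas hS.pp.mα hS.mθ mh2
  set α2 : ℝ → ℝ := fun t => α t * θ t / (K * B) with hα2
  set Z1 : ℝ × ℝ → ℝ≥0∞ := fun x => ∫⁻ w in Icc (1:ℝ) 2, ‖AA α θ w h x‖ₑ ^ 2 with hZ1
  set Z2 : ℝ × ℝ → ℝ≥0∞ := fun x => ∫⁻ w in Icc (1:ℝ) 2, ‖AA α2 θ w h2 x‖ₑ ^ 2 with hZ2
  have mZ1 : Measurable Z1 :=
    Measurable.lintegral_prod_left' (f := fun p : ℝ × (ℝ × ℝ) => ‖AA α θ p.1 h p.2‖ₑ ^ 2) (by fun_prop)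
  have mZ2 : Measurable Z2 :=
    Measurable.lintegral_prod_left' (f := fun p : ℝ × (ℝ × ℝ) => ‖AA α2 θ p.1 h2 p.2‖ₑ ^ 2) (by fun_prop)
  set Y : ℝ × ℝ → ℝ≥0∞ := fun x => ‖H x‖ₑ ^ 2 + ‖h x‖ₑ ^ 2 + ‖h2 x‖ₑ ^ 2 with hY
  have mY : Measurable Y := by fun_prop
  set L := ENNReal.ofReal (1 + K * (B / b)) with hL
  set G := ENNReal.ofReal (Real.log (1 + 4 * (B / b))) with hG
  have hk : ∀ β, SS K τ B b β θ → L * kern b β θ ≤ ENNReal.ofReal (128 * K ^ 4) * G := by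
    intro β hβ
    have := kern_bound2 hβ
    rwa [ENNReal.ofReal_mul (by positivity)] at this
  have hc : ∀ z, ∫⁻ x in box τ B z, L * (Z1 x + Z2 x) ≤
      (2 * C1 * ENNReal.ofReal (128 * K ^ 4) * G) * ∫⁻ x in box (3 * τ) (R * B) z, Y x := by
    intro z
    rw [lintegral_const_mul _ (by fun_prop), lintegral_add_left mZ1]
    have g1 := hcell τ B b α θ hS H h C0 mH mh bH bh hd1 z
    have g2 := hcell τ B b α2 θ hS.pp h h2 C0 mh mh2 bh bh2 hd2 z
    set Yz := ∫⁻ x in box (3 * τ) (R * B) z, Y x with hYz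
    have y1 : ∫⁻ x in box (3 * τ) (R * B) z, (‖H x‖ₑ ^ 2 + ‖h x‖ₑ ^ 2) ≤ Yz :=
      lintegral_mono fun x => le_self_add
    have y2 : ∫⁻ x in box (3 * τ) (R * B) z, (‖h x‖ₑ ^ 2 + ‖h2 x‖ₑ ^ 2) ≤ Yz :=
      lintegral_mono fun x => by
        simp only [hY]; rw [add_assoc]; exact le_add_self
    calc _ ≤ L * (C1 * kern b α θ * Yz + C1 * kern b α2 θ * Yz) := by
          gcongr
          · exact g1.trans (mul_le_mul' le_rfl y1)
          · exact g2.trans (mul_le_mul' le_rfl y2)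
      _ = C1 * (L * kern b α θ) * Yz + C1 * (L * kern b α2 θ) * Yz := by ring
      _ ≤ C1 * (ENNReal.ofReal (128 * K ^ 4) * G) * Yz + C1 * (ENNReal.ofReal (128 * K ^ 4) * G) * Yz := by
          exact add_le_add (mul_le_mul' (mul_le_mul' le_rfl (hk _ hS)) le_rfl)
            (mul_le_mul' (mul_le_mul' le_rfl (hk _ hS.pp)) le_rfl)
      _ = _ := by ring
  have := cell_avg hS.hτ hS.hB hR0 (by fun_prop : Measurable fun x => L * (Z1 x + Z2 x)) mY mW hW
    (C := 2 * C1 * ENNReal.ofReal (128 * K ^ 4) * G) (ENNReal.mul_ne_top (ENNReal.mul_ne_top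
      (ENNReal.mul_ne_top (by simp) hC1) ENNReal.ofReal_ne_top) ENNReal.ofReal_ne_top) hc
  calc _ ≤ ∫⁻ x, L * (Z1 x + Z2 x) * W x := by
        apply lintegral_mono; intro x
        refine mul_le_mul' ?_ le_rfl
        exact iSup₂_le fun u hu => sup_major hS mh mh2 bh bh2 hd2 x u hu
    _ ≤ _ := this
    _ = _ := by ring

lemma symbol_exists : ∃ m : ℝ → ℂ, ContDiff ℝ (⊤ : ℕ∞) m ∧ HasCompactSupport m ∧
    ∀ ζ : ℝ, 1/2 ≤ |ζ| → |ζ| ≤ 2 → (2 * Real.pi * Complex.I * ζ) * m ζ = 1 := by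
  let β : ContDiffBump (5/4 : ℝ) := ⟨3/4, 1, by norm_num, by norm_num⟩
  have β0 : ∀ x, 1 ≤ |x - 5/4| → β x = 0 := fun x hx => β.zero_of_le_dist (by
    rw [Real.dist_eq]; exact hx)
  have β1 : ∀ x, |x - 5/4| ≤ 3/4 → β x = 1 := fun x hx => β.one_of_mem_closedBall (by
    rw [Metric.mem_closedBall, Real.dist_eq]; exact hx)
  have hsm : ContDiff ℝ (⊤ : ℕ∞) (fun ζ : ℝ => ((β ζ + β (-ζ) : ℝ) : ℂ)) := by
    have h1 : ContDiff ℝ (⊤ : ℕ∞) β := β.contDiff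
    exact Complex.ofRealCLM.contDiff.comp (h1.add (h1.comp contDiff_neg))
  refine ⟨fun ζ => ((β ζ + β (-ζ) : ℝ) : ℂ) / (2 * Real.pi * Complex.I * ζ), ?_, ?_, ?_⟩
  · rw [contDiff_iff_contDiffAt]
    intro ζ
    by_cases hζ : ζ = 0
    · subst hζ
      have : (fun ζ : ℝ => ((β ζ + β (-ζ) : ℝ) : ℂ) / (2 * Real.pi * Complex.I * ζ)) =ᶠ[nhds 0]
          fun _ => 0 := by
        filter_upwards [Metric.ball_mem_nhds (0:ℝ) (by norm_num : (0:ℝ) < 1/4)] with x hx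
        rw [Metric.mem_ball, dist_zero_right, Real.norm_eq_abs, abs_lt] at hx
        rw [β0 x, β0 (-x)]; · simp
        · rw [le_abs]; right; linarith
        · rw [le_abs]; right; linarith
      exact contDiffAt_const.congr_of_eventuallyEq this
    · simp only [div_eq_mul_inv]
      refine hsm.contDiffAt.mul (ContDiffAt.inv ?_ ?_)
      · have : ContDiff ℝ (⊤ : ℕ∞) (fun ζ : ℝ => (ζ : ℂ)) := Complex.ofRealCLM.contDiff
        exact (contDiff_const.mul this).contDiffAt
      · have := Real.pi_ne_zero
        simp [hζ]
  · refine HasCompactSupport.of_support_subset_isCompact (isCompact_Icc (a := (-3:ℝ)) (b := 3)) ?_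
    intro x hx
    by_contra hn
    apply hx
    have h3 : 3 < |x| := by
      by_contra hc; push Not at hc; exact hn (mem_Icc.2 (abs_le.1 hc))
    simp only
    rw [β0 x, β0 (-x)]; · simp
    · rcases lt_abs.1 h3 with h | h
      · rw [le_abs]; right; linarith
      · rw [le_abs]; left; linarith
    · rcases lt_abs.1 h3 with h | h
      · rw [le_abs]; left; linarith
      · rw [le_abs]; right; linarith
  · intro ζ h1 h2
    have hz : ζ ≠ 0 := by rintro rfl; norm_num at h1
    have : β ζ + β (-ζ) = 1 := by
      rcases le_or_gt 0 ζ with h | h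
      · rw [abs_of_nonneg h] at h1 h2
        rw [β1 ζ (by rw [abs_le]; constructor <;> linarith), β0 (-ζ) (by rw [le_abs]; right; linarith)]; simp
      · rw [abs_of_neg h] at h1 h2
        rw [β1 (-ζ) (by rw [abs_le]; constructor <;> linarith), β0 (ζ) (by rw [le_abs]; right; linarith)]; simp
    simp only
    rw [this]
    have := Real.pi_ne_zero
    have hI := Complex.I_ne_zero
    have : (2 * Real.pi * Complex.I * ζ : ℂ) ≠ 0 := by simp [hz, this]
    field_simp
    simp [hz]

open scoped FourierTransform in
lemma kernels (N : ℕ) : ∃ (η κ κd : ℝ → ℂ) (C : ℝ), 0 < C ∧ Continuous η ∧ Continuous κ ∧ Continuous κd ∧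
    (∀ y, HasDerivAt η (κ y) y) ∧ (∀ y, HasDerivAt κ (κd y) y) ∧
    (∀ y, ‖η y‖ ≤ C * ((1 + |y|) ^ N)⁻¹) ∧ (∀ y, ‖κ y‖ ≤ C * ((1 + |y|) ^ N)⁻¹) ∧
    (∀ y, ‖κd y‖ ≤ C * ((1 + |y|) ^ N)⁻¹) ∧
    ∀ ζ : ℝ, 1/2 ≤ |ζ| → |ζ| ≤ 2 → ∫ y : ℝ, κ y * Complex.exp (-2 * Real.pi * Complex.I * (y * ζ)) = 1 := by
  obtain ⟨m, ms, mc, hm⟩ := symbol_exists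
  let mS : SchwartzMap ℝ ℂ := mc.toSchwartzMap ms
  let η : SchwartzMap ℝ ℂ := 𝓕⁻ mS
  let κ : SchwartzMap ℝ ℂ := SchwartzMap.derivCLM ℝ ℂ η
  let κd : SchwartzMap ℝ ℂ := SchwartzMap.derivCLM ℝ ℂ κ
  have dec : ∀ g : SchwartzMap ℝ ℂ, ∃ C : ℝ, 0 < C ∧ ∀ y, ‖g y‖ ≤ C * ((1 + |y|) ^ N)⁻¹ := by
    intro g
    set c := 2 ^ N * ((Finset.Iic (N, 0)).sup (fun m : ℕ × ℕ => SchwartzMap.seminorm ℝ m.1 m.2)) g with hc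
    have hc0 : 0 ≤ c := mul_nonneg (by positivity) (apply_nonneg _ _)
    refine ⟨c + 1, by linarith, fun y => ?_⟩
    have := SchwartzMap.one_add_le_sup_seminorm_apply (𝕜 := ℝ) (m := (N, 0)) (k := N) (n := 0) le_rfl le_rfl g y
    rw [norm_iteratedFDeriv_zero, Real.norm_eq_abs] at this
    rw [← div_eq_mul_inv, le_div_iff₀ (by positivity), mul_comm]
    linarith
  obtain ⟨C1, h1, d1⟩ := dec η
  obtain ⟨C2, h2, d2⟩ := dec κ
  obtain ⟨C3, h3, d3⟩ := dec κd
  have up : ∀ c, c ≤ C1 + C2 + C3 → ∀ y : ℝ, c * ((1 + |y|) ^ N)⁻¹ ≤ (C1 + C2 + C3) * ((1 + |y|) ^ N)⁻¹ :=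
    fun c hc y => mul_le_mul_of_nonneg_right hc (by positivity)
  refine ⟨η, κ, κd, C1 + C2 + C3, by positivity, η.continuous, κ.continuous, κd.continuous, ?_, ?_, 
    fun y => (d1 y).trans (up _ (by linarith) y), fun y => (d2 y).trans (up _ (by linarith) y),
    fun y => (d3 y).trans (up _ (by linarith) y), ?_⟩
  · intro y; exact (η.differentiableAt).hasDerivAt
  · intro y; exact (κ.differentiableAt).hasDerivAt
  · intro ζ hz1 hz2
    have hdf := Real.fourier_deriv (f := (η : ℝ → ℂ)) η.integrable η.differentiable (by
      have := κ.integrable (μ := volume)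
      exact this)
    have := congrFun hdf ζ
    have e1 : 𝓕 (η : ℝ → ℂ) ζ = m ζ := by
      rw [← SchwartzMap.fourier_coe]
      have : 𝓕 η = mS := by simp [η]
      rw [this]; rfl
    rw [e1, smul_eq_mul, hm ζ hz1 hz2, Real.fourier_eq'] at this
    rw [← this]
    congr 1; ext y
    rw [smul_eq_mul, mul_comm]
    congr 1
    simp
    ring_nf

/-- decaying continuous kernel -/
structure Dec (N : ℕ) (C : ℝ) (κ : ℝ → ℂ) : Prop where
  hC : 0 < C
  hN : 2 ≤ N
  cont : Continuous κ
  dec : ∀ y, ‖κ y‖ ≤ C * ((1 + |y|) ^ N)⁻¹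

/-- convolution with a tensor kernel at scales `a`, `b` -/
noncomputable def cv (κ1 κ2 : ℝ → ℂ) (a b : ℝ) (G : ℝ × ℝ → ℂ) (x : ℝ × ℝ) : ℂ :=
  ∫ y : ℝ × ℝ, κ1 y.1 * κ2 y.2 * G (x.1 - a * y.1, x.2 - b * y.2)

lemma int_rw2 : Integrable (fun y : ℝ => ((1 + |y|) ^ 2)⁻¹) := by
  refine ⟨(by fun_prop : Measurable fun y : ℝ => ((1 + |y|) ^ 2)⁻¹).aestronglyMeasurable, ?_⟩
  have := c2_lt_top
  unfold c2 wt at this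
  rw [hasFiniteIntegral_iff_ofReal (ae_of_all _ fun y => by positivity)]
  exact this

lemma int_rw22 : Integrable (fun y : ℝ × ℝ => ((1 + |y.1|) ^ 2)⁻¹ * ((1 + |y.2|) ^ 2)⁻¹) :=
  int_rw2.mul_prod int_rw2

lemma rw_anti {N : ℕ} (h : 2 ≤ N) (y : ℝ) : ((1 + |y|) ^ N)⁻¹ ≤ ((1 + |y|) ^ 2)⁻¹ := by
  have h1 : (1:ℝ) ≤ 1 + |y| := by linarith [abs_nonneg y]
  exact inv_anti₀ (by positivity) (pow_le_pow_right₀ h1 h)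

lemma Dec.two {N : ℕ} {C : ℝ} {κ : ℝ → ℂ} (h : Dec N C κ) (y : ℝ) :
    ‖κ y‖ ≤ C * ((1 + |y|) ^ 2)⁻¹ :=
  (h.dec y).trans (mul_le_mul_of_nonneg_left (rw_anti h.hN y) h.hC.le)

lemma Dec.enorm {N : ℕ} {C : ℝ} {κ : ℝ → ℂ} (h : Dec N C κ) (y : ℝ) :
    ‖κ y‖ₑ ≤ ENNReal.ofReal C * wt N y := by
  rw [← ofReal_norm, wt, ← ENNReal.ofReal_mul h.hC.le]
  exact ENNReal.ofReal_le_ofReal (h.dec y)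

lemma cv_int {N : ℕ} {C C0 : ℝ} {κ1 κ2 : ℝ → ℂ} (h1 : Dec N C κ1) (h2 : Dec N C κ2) (a b : ℝ)
    {G : ℝ × ℝ → ℂ} (mG : Measurable G) (bG : ∀ x, ‖G x‖ ≤ C0) (x : ℝ × ℝ) :
    Integrable fun y : ℝ × ℝ => κ1 y.1 * κ2 y.2 * G (x.1 - a * y.1, x.2 - b * y.2) := by
  have m1 := h1.cont.measurable
  have m2 := h2.cont.measurable
  refine (int_rw22.const_mul (C * C * C0)).mono'
    (by fun_prop : Measurable fun y : ℝ × ℝ => κ1 y.1 * κ2 y.2 * G (x.1 - a * y.1, x.2 - b * y.2)).aestronglyMeasurable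
    (ae_of_all _ fun y => ?_)
  rw [norm_mul, norm_mul]
  have hC := h1.hC
  calc _ ≤ (C * ((1 + |y.1|) ^ 2)⁻¹) * (C * ((1 + |y.2|) ^ 2)⁻¹) * C0 := by
        refine mul_le_mul (mul_le_mul (h1.two _) (h2.two _) (norm_nonneg _) (by positivity)) (bG _)
          (norm_nonneg _) (by positivity)
    _ = _ := by ring

lemma cv_meas {κ1 κ2 : ℝ → ℂ} (m1 : Measurable κ1) (m2 : Measurable κ2) (a b : ℝ)
    {G : ℝ × ℝ → ℂ} (mG : Measurable G) : Measurable (cv κ1 κ2 a b G) := by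
  have h : Measurable fun p : (ℝ × ℝ) × (ℝ × ℝ) =>
    κ1 p.2.1 * κ2 p.2.2 * G (p.1.1 - a * p.2.1, p.1.2 - b * p.2.2) := by fun_prop
  exact (h.stronglyMeasurable.integral_prod_right' (ν := volume)).measurable

lemma cv_pos {N : ℕ} {C : ℝ} {κ1 κ2 : ℝ → ℂ} (h1 : Dec N C κ1) (h2 : Dec N C κ2) (a b : ℝ)
    {G : ℝ × ℝ → ℂ} (mG : Measurable G) (x : ℝ × ℝ) :
    ‖cv κ1 κ2 a b G x‖ₑ ≤ ENNReal.ofReal (C * C) * Pos N a b (fun x => ‖G x‖ₑ) x := by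
  have mw := wt_meas N
  unfold cv Pos
  refine (enorm_integral_le_lintegral_enorm _).trans ?_
  rw [← lintegral_const_mul _ (by fun_prop)]
  refine lintegral_mono fun y => ?_
  rw [enorm_mul, enorm_mul, ENNReal.ofReal_mul h1.hC.le]
  calc _ ≤ (ENNReal.ofReal C * wt N y.1) * (ENNReal.ofReal C * wt N y.2) * 
      ‖G (x.1 - a * y.1, x.2 - b * y.2)‖ₑ := mul_le_mul' (mul_le_mul' (h1.enorm _) (h2.enorm _)) le_rfl
    _ = _ := by ring

lemma pos_sq {N : ℕ} (hN : 2 ≤ N) (a b : ℝ) {F : ℝ × ℝ → ℝ≥0∞} (mF : Measurable F) (x : ℝ × ℝ) :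
    Pos N a b F x ^ 2 ≤ (c2 * c2) * Pos N a b (fun x => F x ^ 2) x := by
  have mw := wt_meas N
  have := jensen_wt (volume : Measure (ℝ × ℝ)) (q := 2) (by norm_num)
    (w := fun y => wt N y.1 * wt N y.2) (f := fun y => F (x.1 - a * y.1, x.2 - b * y.2))
    (by fun_prop) (by fun_prop)
  norm_num at this
  unfold Pos
  refine this.trans (mul_le_mul' ?_ le_rfl)
  rw [← lint_wt2]
  exact lintegral_mono fun y => mul_le_mul' (wt_anti hN _) (wt_anti hN _)

lemma cv_sq {N : ℕ} {C : ℝ} {κ1 κ2 : ℝ → ℂ} (h1 : Dec N C κ1) (h2 : Dec N C κ2) (a b : ℝ)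
    {G : ℝ × ℝ → ℂ} (mG : Measurable G) (x : ℝ × ℝ) :
    ‖cv κ1 κ2 a b G x‖ₑ ^ 2 ≤ ENNReal.ofReal (C * C) ^ 2 * (c2 * c2) * Pos N a b (fun x => ‖G x‖ₑ ^ 2) x := by
  calc _ ≤ (ENNReal.ofReal (C * C) * Pos N a b (fun x => ‖G x‖ₑ) x) ^ 2 :=
        pow_le_pow_left' (cv_pos h1 h2 a b mG x) 2
    _ = ENNReal.ofReal (C * C) ^ 2 * Pos N a b (fun x => ‖G x‖ₑ) x ^ 2 := by ring
    _ ≤ ENNReal.ofReal (C * C) ^ 2 * ((c2 * c2) * Pos N a b (fun x => ‖G x‖ₑ ^ 2) x) :=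
        mul_le_mul' le_rfl (pos_sq h1.hN a b (by fun_prop) x)
    _ = _ := by ring

lemma cv_bdd {N : ℕ} {C C0 : ℝ} {κ1 κ2 : ℝ → ℂ} (h1 : Dec N C κ1) (h2 : Dec N C κ2) (a b : ℝ)
    {G : ℝ × ℝ → ℂ} (mG : Measurable G) (bG : ∀ x, ‖G x‖ ≤ C0) (x : ℝ × ℝ) :
    ‖cv κ1 κ2 a b G x‖ ≤ (C * C * (c2 * c2).toReal) * C0 := by
  have hC := h1.hC
  have hC0 : 0 ≤ C0 := (norm_nonneg _).trans (bG 0)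
  have mw := wt_meas 2
  have h := (cv_pos h1 h2 a b mG x).trans (mul_le_mul' le_rfl (pos_anti h1.hN x))
  have h3 : Pos 2 a b (fun x => ‖G x‖ₑ) x ≤ (c2 * c2) * ENNReal.ofReal C0 := by
    unfold Pos
    rw [← lint_wt2, ← lintegral_mul_const _ (by fun_prop)]
    refine lintegral_mono fun y => mul_le_mul' le_rfl ?_
    beta_reduce
    rw [← ofReal_norm]
    exact ENNReal.ofReal_le_ofReal (bG _)
  have hc : c2 * c2 ≠ ∞ := ENNReal.mul_ne_top c2_lt_top.ne c2_lt_top.ne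
  have h4 := h.trans (mul_le_mul' le_rfl h3)
  rw [← ENNReal.ofReal_toReal hc, ← ENNReal.ofReal_mul (by positivity), ← ENNReal.ofReal_mul (by positivity),
    ← ofReal_norm] at h4
  have := (ENNReal.ofReal_le_ofReal_iff (by positivity)).1 h4
  linarith

lemma rw_shift (y d : ℝ) (hd : |d| ≤ 1) : ((1 + |y + d|) ^ 2)⁻¹ ≤ 4 * ((1 + |y|) ^ 2)⁻¹ := by
  rw [← div_eq_mul_inv, le_div_iff₀ (by positivity), inv_mul_le_iff₀ (by positivity)]
  have : |y| ≤ |y + d| + |d| := by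
    have := abs_sub (y + d) d
    simpa using this
  nlinarith [abs_nonneg (y+d), abs_nonneg d, abs_nonneg y]

lemma cv_deriv {N : ℕ} {C C0 : ℝ} {κ1 κ2 κ3 : ℝ → ℂ} (h1 : Dec N C κ1) (h2 : Dec N C κ2)
    (h3 : Dec N C κ3) (hd : ∀ y, HasDerivAt κ2 (κ3 y) y) {a b : ℝ} (hb : 0 < b)
    {G : ℝ × ℝ → ℂ} (mG : Measurable G) (bG : ∀ x, ‖G x‖ ≤ C0) (x : ℝ × ℝ) :
    HasDerivAt (fun s => cv κ1 κ2 a b G (x.1, s)) (((b⁻¹ : ℝ) : ℂ) * cv κ1 κ3 a b G x) x.2 := by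
  have m1 := h1.cont.measurable
  have m2 := h2.cont.measurable
  have m3 := h3.cont.measurable
  have hC := h1.hC
  have e : (fun s => cv κ1 κ2 a b G (x.1, s)) = fun s => ∫ y : ℝ × ℝ,
      κ1 y.1 * κ2 (y.2 + (s - x.2) / b) * G (x.1 - a * y.1, x.2 - b * y.2) := by
    ext s
    unfold cv
    rw [← int_trans (fun y : ℝ × ℝ => κ1 y.1 * κ2 y.2 * G (x.1 - a * y.1, s - b * y.2)) 0 (-((s - x.2) / b))]
    congr 1; ext y
    simp only [sub_zero, sub_neg_eq_add]
    congr 3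
    field_simp; ring
  rw [e]
  have key := hasDerivAt_integral_of_dominated_loc_of_deriv_le (μ := (volume : Measure (ℝ × ℝ))) (x₀ := x.2)
    (s := Metric.ball x.2 b)
    (bound := fun y : ℝ × ℝ => (b⁻¹ * (C * C * 4 * C0)) * (((1 + |y.1|) ^ 2)⁻¹ * ((1 + |y.2|) ^ 2)⁻¹))
    (F := fun s y => κ1 y.1 * κ2 (y.2 + (s - x.2) / b) * G (x.1 - a * y.1, x.2 - b * y.2))
    (F' := fun s y => κ1 y.1 * (((b⁻¹ : ℝ) : ℂ) * κ3 (y.2 + (s - x.2) / b)) * G (x.1 - a * y.1, x.2 - b * y.2))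
    (Metric.ball_mem_nhds _ hb) ?_ ?_ ?_ ?_ ?_ ?_
  · refine key.2.congr_deriv ?_
    unfold cv
    rw [← integral_const_mul]
    congr 1; ext y
    simp only [sub_self, zero_div, add_zero]
    ring
  · refine Eventually.of_forall fun s => ?_
    exact (by fun_prop : Measurable fun y : ℝ × ℝ => κ1 y.1 * κ2 (y.2 + (s - x.2) / b) * G (x.1 - a * y.1, x.2 - b * y.2)).aestronglyMeasurable
  · simpa using cv_int h1 h2 a b mG bG x
  · exact (by fun_prop : Measurable fun y : ℝ × ℝ => κ1 y.1 * (((b⁻¹ : ℝ) : ℂ) * κ3 (y.2 + (x.2 - x.2) / b)) * G (x.1 - a * y.1, x.2 - b * y.2)).aestronglyMeasurable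
  · refine ae_of_all _ fun y s hs => ?_
    rw [norm_mul, norm_mul, norm_mul, Complex.norm_real, Real.norm_eq_abs, abs_of_pos (by positivity)]
    have hs' : |(s - x.2) / b| ≤ 1 := by
      rw [abs_div, abs_of_pos hb, div_le_one hb]
      rw [Metric.mem_ball, Real.dist_eq] at hs
      exact hs.le
    have := (h3.two (y.2 + (s - x.2) / b)).trans (mul_le_mul_of_nonneg_left (rw_shift y.2 _ hs') h3.hC.le)
    calc _ ≤ (C * ((1 + |y.1|) ^ 2)⁻¹) * (b⁻¹ * (C * (4 * ((1 + |y.2|) ^ 2)⁻¹))) * C0 := by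
          refine mul_le_mul (mul_le_mul (h1.two _) (mul_le_mul_of_nonneg_left this (by positivity))
            (by positivity) (by positivity)) (bG _) (norm_nonneg _) (by positivity)
      _ = _ := by ring
  · exact int_rw22.const_mul _
  · refine ae_of_all _ fun y s hs => ?_
    have hl : HasDerivAt (fun s : ℝ => y.2 + (s - x.2) / b) (b⁻¹) s := by
      have := (((hasDerivAt_id s).sub_const x.2).div_const b).const_add y.2
      simpa using this
    have := HasDerivAt.scomp s (hd (y.2 + (s - x.2) / b)) hl
    have h5 : HasDerivAt (fun s : ℝ => κ2 (y.2 + (s - x.2) / b))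
        (((b⁻¹ : ℝ) : ℂ) * κ3 (y.2 + (s - x.2) / b)) s := by
      refine this.congr_deriv ?_
      exact Complex.real_smul
    exact (h5.const_mul (κ1 y.1)).mul_const _

lemma AA_cv {K τ B b' : ℝ} {α θ : ℝ → ℝ} (hS : SS K τ B b' α θ) {N : ℕ} {C C0 : ℝ} {κ1 κ2 : ℝ → ℂ}
    (h1 : Dec N C κ1) (h2 : Dec N C κ2) (a b : ℝ)
    {G : ℝ × ℝ → ℂ} (mG : Measurable G) (bG : ∀ x, ‖G x‖ ≤ C0) (u : ℝ) (x : ℝ × ℝ) :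
    AA α θ u (cv κ1 κ2 a b G) x = cv κ1 κ2 a b (AA α θ u G) x := by
  have m1 := h1.cont.measurable
  have m2 := h2.cont.measurable
  have mα := hS.mα; have mθ := hS.mθ
  have hC := h1.hC
  have hC0 : 0 ≤ C0 := (norm_nonneg _).trans (bG 0)
  have iα : Integrable α := by
    have h3 : IntegrableOn α (Icc (-(2*τ)) (2*τ)) :=
      Measure.integrableOn_of_bounded (M := K / τ) (by simp) mα.aestronglyMeasurable (ae_of_all _ fun t => hS.bd t)
    refine (integrableOn_iff_integrable_of_support_subset ?_).1 h3
    intro t ht; exact mem_Icc.2 (abs_le.1 (hS.supp t ht))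
  unfold AA cv
  simp_rw [← integral_mul_const, ← integral_const_mul]
  rw [integral_integral_swap]
  · congr 1; ext y; congr 1; ext t
    have e : (x.1 - t - a * y.1, x.2 - u * θ t - b * y.2) = 
      (x.1 - a * y.1 - t, x.2 - b * y.2 - u * θ t) := by ext <;> simp <;> ring
    rw [e]; ring
  · have hb : Integrable (fun z : ℝ × (ℝ × ℝ) => |α z.1| * ((C * C * C0) * 
        (((1 + |z.2.1|) ^ 2)⁻¹ * ((1 + |z.2.2|) ^ 2)⁻¹))) :=
      iα.abs.mul_prod (int_rw22.const_mul (C * C * C0))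
    refine hb.mono' (Measurable.aestronglyMeasurable (by unfold Function.uncurry; fun_prop)) 
      (ae_of_all _ fun z => ?_)
    simp only [Function.uncurry]
    rw [norm_mul, norm_mul, norm_mul, Complex.norm_real, mul_comm, Real.norm_eq_abs]
    refine mul_le_mul_of_nonneg_left ?_ (abs_nonneg _)
    calc _ ≤ (C * ((1 + |z.2.1|) ^ 2)⁻¹) * (C * ((1 + |z.2.2|) ^ 2)⁻¹) * C0 := by
          refine mul_le_mul (mul_le_mul (h1.two _) (h2.two _) (norm_nonneg _) (by positivity)) (bG _)
            (norm_nonneg _) (by positivity)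
      _ = _ := by ring

lemma AA_cont {K τ B b : ℝ} {α θ : ℝ → ℝ} (hS : SS K τ B b α θ) {C0 : ℝ}
    {g : ℝ × ℝ → ℂ} (cg : Continuous g) (bg : ∀ x, ‖g x‖ ≤ C0) (u : ℝ) :
    Continuous (AA α θ u g) := by
  have mα := hS.mα; have mθ := hS.mθ
  have mg := cg.measurable
  have hC0 : 0 ≤ C0 := (norm_nonneg _).trans (bg 0)
  have iα : Integrable α := by
    have h3 : IntegrableOn α (Icc (-(2*τ)) (2*τ)) :=
      Measure.integrableOn_of_bounded (M := K / τ) (by simp) mα.aestronglyMeasurable (ae_of_all _ fun t => hS.bd t)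
    refine (integrableOn_iff_integrable_of_support_subset ?_).1 h3
    intro t ht; exact mem_Icc.2 (abs_le.1 (hS.supp t ht))
  unfold AA
  refine continuous_of_dominated (bound := fun t => C0 * |α t|) ?_ ?_ (iα.abs.const_mul C0) ?_
  · intro x
    exact (by fun_prop : Measurable fun t => g (x.1 - t, x.2 - u * θ t) * (α t : ℂ)).aestronglyMeasurable
  · intro x
    refine ae_of_all _ fun t => ?_
    rw [norm_mul, Complex.norm_real, Real.norm_eq_abs]
    exact mul_le_mul_of_nonneg_right (bg _) (abs_nonneg _)
  · exact ae_of_all _ fun t => by fun_prop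

/-- the local square of the maximal function -/
noncomputable def XX (α θ : ℝ → ℝ) (g : ℝ × ℝ → ℂ) (x : ℝ × ℝ) : ℝ≥0∞ :=
  ⨆ u ∈ Icc (1:ℝ) 2, ‖AA α θ u g x‖ₑ ^ 2

lemma XX_meas {K τ B b : ℝ} {α θ : ℝ → ℝ} (hS : SS K τ B b α θ) {C0 : ℝ}
    {g : ℝ × ℝ → ℂ} (cg : Continuous g) (bg : ∀ x, ‖g x‖ ≤ C0) : Measurable (XX α θ g) := by
  apply LowerSemicontinuous.measurable
  unfold XX
  refine lowerSemicontinuous_biSup fun u _ => ?_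
  have := AA_cont hS cg bg u
  exact Continuous.lowerSemicontinuous (by fun_prop)

lemma XX_h1 {K τ B b : ℝ} {α θ : ℝ → ℝ} (hS : SS K τ B b α θ) {N : ℕ} {C C0 : ℝ} {κ : ℝ → ℂ}
    (h1 : Dec N C κ) (a : ℝ) {g : ℝ × ℝ → ℂ} (mg : Measurable g) (bg : ∀ x, ‖g x‖ ≤ C0)
    (hg : ∀ x, cv κ κ a b g x = g x) (x : ℝ × ℝ) :
    XX α θ g x ≤ (ENNReal.ofReal (C * C) ^ 2 * (c2 * c2)) * Pos 2 a b (XX α θ g) x := by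
  have hg' : cv κ κ a b g = g := funext hg
  conv_lhs => unfold XX
  refine iSup₂_le fun u hu => ?_
  have e : AA α θ u g x = cv κ κ a b (AA α θ u g) x := by
    rw [← AA_cv hS h1 h1 a b mg bg u x, hg']
  rw [e]
  have mA : Measurable (AA α θ u g) := (AA_meas hS.mα hS.mθ mg).comp (by fun_prop : Measurable fun x : ℝ × ℝ => (u, x))
  refine (cv_sq h1 h1 a b mA x).trans (mul_le_mul' le_rfl ?_)
  refine (pos_anti h1.hN x).trans (pos_mono (fun y => ?_) x)
  exact le_iSup₂ (f := fun u (_ : u ∈ Icc (1:ℝ) 2) => ‖AA α θ u g y‖ₑ ^ 2) u hu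

lemma cv_add {N : ℕ} {C C0 C1 : ℝ} {κ1 κ2 : ℝ → ℂ} (h1 : Dec N C κ1) (h2 : Dec N C κ2) (a b : ℝ)
    {G H : ℝ × ℝ → ℂ} (mG : Measurable G) (bG : ∀ x, ‖G x‖ ≤ C0) (mH : Measurable H) (bH : ∀ x, ‖H x‖ ≤ C1)
    (x : ℝ × ℝ) : cv κ1 κ2 a b (fun x => G x + H x) x = cv κ1 κ2 a b G x + cv κ1 κ2 a b H x := by
  unfold cv
  rw [← integral_add (cv_int h1 h2 a b mG bG x) (cv_int h1 h2 a b mH bH x)]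
  congr 1; ext y; ring

lemma AA_add {K τ B b : ℝ} {α θ : ℝ → ℝ} (hS : SS K τ B b α θ) {C0 C1 : ℝ}
    {G H : ℝ × ℝ → ℂ} (mG : Measurable G) (bG : ∀ x, ‖G x‖ ≤ C0) (mH : Measurable H) (bH : ∀ x, ‖H x‖ ≤ C1)
    (u : ℝ) (x : ℝ × ℝ) : AA α θ u (fun x => G x + H x) x = AA α θ u G x + AA α θ u H x := by
  unfold AA
  rw [← integral_add (AA_int hS mG bG u x) (AA_int hS mH bH u x)]
  congr 1; ext y; ring

lemma XX_h2 {K : ℝ} (hK : 1 ≤ K) (M : ℕ) {η κ κd : ℝ → ℂ} {C : ℝ} (d1 : Dec (M+2) C η) (d2 : Dec (M+2) C κ)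
    (d3 : Dec (M+2) C κd) (hd1 : ∀ y, HasDerivAt η (κ y) y) (hd2 : ∀ y, HasDerivAt κ (κd y) y) :
    ∃ C2 : ℝ≥0∞, C2 ≠ ∞ ∧ ∀ (τ B b a : ℝ) (α θ : ℝ → ℝ), SS K τ B b α θ → 0 < a → a ≤ K * τ →
      ∀ (G : ℝ × ℝ → ℂ) (C0 : ℝ), Measurable G → (∀ x, ‖G x‖ ≤ C0) →
      ∀ W : ℝ × ℝ → ℝ≥0∞, Measurable W → Slow M τ B W →
      ∫⁻ x, XX α θ (cv κ κ a b G) x * W x ≤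
        C2 * ENNReal.ofReal (Real.log (1 + 4 * (B / b))) * ∫⁻ x, ‖G x‖ₑ ^ 2 * W x := by
  obtain ⟨Cw, hCw, hw⟩ := weighted K hK M
  have hc : c2 * c2 ≠ ∞ := ENNReal.mul_ne_top c2_lt_top.ne c2_lt_top.ne
  set Q := ENNReal.ofReal (C * C) ^ 2 * (c2 * c2) with hQ
  have hQt : Q ≠ ∞ := ENNReal.mul_ne_top (ENNReal.pow_ne_top ENNReal.ofReal_ne_top) hc
  refine ⟨Cw * (3 * Q * (ENNReal.ofReal (K ^ (2 * M)) * (c2 * c2))), ?_, ?_⟩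
  · refine ENNReal.mul_ne_top hCw (ENNReal.mul_ne_top (ENNReal.mul_ne_top (by simp) hQt) 
      (ENNReal.mul_ne_top ENNReal.ofReal_ne_top hc))
  intro τ B b a α θ hS ha haτ G C0 mG bG W mW hW
  have m1 := cv_meas d2.cont.measurable d1.cont.measurable a b mG
  have m2 := cv_meas d2.cont.measurable d2.cont.measurable a b mG
  have m3 := cv_meas d2.cont.measurable d3.cont.measurable a b mG
  have := hw τ B b α θ hS (cv κ η a b G) (cv κ κ a b G) (cv κ κd a b G) _ m1 m2 m3
    (cv_bdd d2 d1 a b mG bG) (cv_bdd d2 d2 a b mG bG) (cv_bdd d2 d3 a b mG bG)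
    (cv_deriv d2 d1 d2 hd1 hS.hb mG bG) (cv_deriv d2 d2 d3 hd2 hS.hb mG bG) W mW hW
  refine this.trans ?_
  have mP := pos_meas (M+2) a b (by fun_prop : Measurable fun x => ‖G x‖ₑ ^ 2)
  have k1 : ∫⁻ x, (‖cv κ η a b G x‖ₑ ^ 2 + ‖cv κ κ a b G x‖ₑ ^ 2 + ‖cv κ κd a b G x‖ₑ ^ 2) * W x ≤
      (3 * Q) * ∫⁻ x, Pos (M+2) a b (fun x => ‖G x‖ₑ ^ 2) x * W x := by
    rw [← lintegral_const_mul _ (by fun_prop)]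
    refine lintegral_mono fun x => ?_
    rw [← mul_assoc]
    refine mul_le_mul' ?_ le_rfl
    calc _ ≤ Q * Pos (M+2) a b (fun x => ‖G x‖ₑ ^ 2) x + Q * Pos (M+2) a b (fun x => ‖G x‖ₑ ^ 2) x +
          Q * Pos (M+2) a b (fun x => ‖G x‖ₑ ^ 2) x :=
        add_le_add (add_le_add (cv_sq d2 d1 a b mG x) (cv_sq d2 d2 a b mG x)) (cv_sq d2 d3 a b mG x)
      _ = _ := by ring
  have k2 : ∫⁻ x, Pos (M+2) a b (fun x => ‖G x‖ₑ ^ 2) x * W x ≤ 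
      (ENNReal.ofReal (K ^ (2 * M)) * (c2 * c2)) * ∫⁻ x, ‖G x‖ₑ ^ 2 * W x := by
    rw [pos_symm _ a b (by fun_prop) mW, ← lintegral_const_mul _ (by fun_prop)]
    refine lintegral_mono fun x => ?_
    calc _ ≤ ‖G x‖ₑ ^ 2 * (ENNReal.ofReal (K ^ (2 * M)) * (c2 * c2) * W x) :=
          mul_le_mul' le_rfl (pos_of_slow hK hS.hτ hS.hB ha hS.hb haτ hS.bB hW x)
      _ = _ := by ring
  calc _ ≤ Cw * ENNReal.ofReal (Real.log (1 + 4 * (B / b))) * ((3 * Q) * 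
        ((ENNReal.ofReal (K ^ (2 * M)) * (c2 * c2)) * ∫⁻ x, ‖G x‖ₑ ^ 2 * W x)) :=
        mul_le_mul' le_rfl (k1.trans (mul_le_mul' le_rfl k2))
    _ = _ := by ring

lemma slow_one (M : ℕ) {A B : ℝ} (hA : 0 < A) (hB : 0 < B) : Slow M A B (fun _ => 1) := by
  intro x y
  rw [mul_one, ENNReal.one_le_ofReal]
  apply one_le_pow₀
  have h1 : 0 ≤ |x.1 - y.1| / A := by positivity
  have h2 : 0 ≤ |x.2 - y.2| / B := by positivity
  nlinarith

lemma XX_h3 {K : ℝ} (hK : 1 ≤ K) {κ : ℝ → ℂ} {C : ℝ} {N : ℕ} (d2 : Dec N C κ) {q : ℝ} (hq : 1 < q)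
    {C2 : ℝ≥0∞} {L : ℝ≥0∞}
    {τ B b a : ℝ} {α θ : ℝ → ℝ} (hS : SS K τ B b α θ)
    (h2 : ∀ (G : ℝ × ℝ → ℂ) (C0 : ℝ), Measurable G → (∀ x, ‖G x‖ ≤ C0) →
      ∫⁻ x, XX α θ (cv κ κ a b G) x ≤ C2 * L * ∫⁻ x, ‖G x‖ₑ ^ 2)
    {g : ℝ × ℝ → ℂ} {C0 : ℝ} (cg : Continuous g) (bg : ∀ x, ‖g x‖ ≤ C0)
    (hg : ∀ x, cv κ κ a b g x = g x) :
    ∫⁻ x, XX α θ g x ^ q ≤ ENNReal.ofReal (2 * q / (2 * q - 2)) * (4 * C2 * L) *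
      ENNReal.ofReal (8 * K * (C * C * (c2 * c2).toReal + 1)) ^ (2 * q) * ∫⁻ x, (‖g x‖ₑ ^ 2) ^ q := by
  set A1 := C * C * (c2 * c2).toReal with hA1
  have hA10 : 0 ≤ A1 := by have := d2.hC; positivity
  set R := 8 * K * (A1 + 1) with hR
  have hR1 : 1 ≤ R := by rw [hR]; nlinarith
  have mg := cg.measurable
  have hg' : cv κ κ a b g = g := funext hg
  have mX := XX_meas hS cg bg
  have hm := marc (volume : Measure (ℝ × ℝ)) (p := 2 * q) (p0 := 2) (by norm_num) (by linarith)
    (F := fun x => XX α θ g x ^ (1/2 : ℝ)) (f := fun x => ENNReal.ofReal R * ‖g x‖ₑ)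
    (by fun_prop) (by fun_prop) (4 * C2 * L) ?_
  · calc _ = ∫⁻ x, (XX α θ g x ^ (1/2 : ℝ)) ^ (2 * q) := by
          congr 1; ext x
          rw [← ENNReal.rpow_mul]; congr 1; ring
      _ ≤ _ := hm
      _ = _ := by
          rw [mul_assoc _ (ENNReal.ofReal R ^ (2 * q)), ← lintegral_const_mul (ENNReal.ofReal R ^ (2 * q)) (by fun_prop)]
          congr 1; refine lintegral_congr fun x => ?_
          rw [ENNReal.mul_rpow_of_nonneg _ _ (by linarith), ENNReal.rpow_mul, ENNReal.rpow_mul]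
          norm_num
  · intro s hs
    set s1 := s / R with hs1
    have hs10 : 0 < s1 := by positivity
    set G : ℝ × ℝ → ℂ := fun x => if s1 < ‖g x‖ then g x else 0 with hG
    set G' : ℝ × ℝ → ℂ := fun x => if s1 < ‖g x‖ then 0 else g x with hG'
    have mS : MeasurableSet {x | s1 < ‖g x‖} := measurableSet_lt (by fun_prop) (by fun_prop)
    have mG : Measurable G := Measurable.ite mS mg measurable_const
    have mG' : Measurable G' := Measurable.ite mS measurable_const mg
    have hC0 : 0 ≤ C0 := (norm_nonneg _).trans (bg 0)
    have bG : ∀ x, ‖G x‖ ≤ C0 := by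
      intro x; simp only [hG]; split_ifs
      · exact bg x
      · simpa using hC0
    have bG' : ∀ x, ‖G' x‖ ≤ s1 := by
      intro x; simp only [hG']; split_ifs with h
      · simpa using hs10.le
      · exact not_lt.1 h
    have hsum : g = fun x => G x + G' x := by
      ext x; simp only [hG, hG']; split_ifs <;> simp
    have dom : ∀ x, ENNReal.ofReal s < XX α θ g x ^ (1/2 : ℝ) →
        ENNReal.ofReal ((s/2)^2) ≤ XX α θ (cv κ κ a b G) x := by
      intro x hx
      have hx2 : ENNReal.ofReal (s ^ 2) < XX α θ g x := by
        have := ENNReal.rpow_lt_rpow hx (by norm_num : (0:ℝ) < 2)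
        rw [← ENNReal.rpow_mul] at this
        norm_num at this
        rwa [ENNReal.ofReal_pow hs.le]
      unfold XX at hx2
      rw [lt_iSup_iff] at hx2
      obtain ⟨u, hx2⟩ := hx2
      rw [lt_iSup_iff] at hx2
      obtain ⟨hu, hx2⟩ := hx2
      rw [← ofReal_norm, ← ENNReal.ofReal_pow (norm_nonneg _), ENNReal.ofReal_lt_ofReal_iff_of_nonneg (by positivity)] at hx2
      have h3 : s < ‖AA α θ u g x‖ := lt_of_pow_lt_pow_left₀ 2 (norm_nonneg _) hx2
      have e : AA α θ u g x = AA α θ u (cv κ κ a b G) x + AA α θ u (cv κ κ a b G') x := by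
        rw [← AA_add hS (cv_meas d2.cont.measurable d2.cont.measurable a b mG) (cv_bdd d2 d2 a b mG bG)
          (cv_meas d2.cont.measurable d2.cont.measurable a b mG') (cv_bdd d2 d2 a b mG' bG')]
        congr 1
        ext y
        rw [← cv_add d2 d2 a b mG bG mG' bG', ← hsum, hg]
      have h4 := AA_bdd hS (cv_bdd d2 d2 a b mG' bG') u x
      have h5 : 4 * K * (A1 * s1) ≤ s / 2 := by
        have : R * s1 = s := by rw [hs1]; field_simp
        rw [← this, hR]
        have : 0 ≤ K * s1 := by positivity
        nlinarith
      have h6 : s / 2 ≤ ‖AA α θ u (cv κ κ a b G) x‖ := by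
        rw [e] at h3
        have := norm_add_le (AA α θ u (cv κ κ a b G) x) (AA α θ u (cv κ κ a b G') x)
        linarith
      refine le_trans ?_ (le_iSup₂ (f := fun u (_ : u ∈ Icc (1:ℝ) 2) => ‖AA α θ u (cv κ κ a b G) x‖ₑ ^ 2) u hu)
      rw [← ofReal_norm, ← ENNReal.ofReal_pow (norm_nonneg _)]
      exact ENNReal.ofReal_le_ofReal (pow_le_pow_left₀ (by positivity) h6 2)
    have mset : MeasurableSet {x | ENNReal.ofReal s < XX α θ g x ^ (1/2 : ℝ)} :=
      measurableSet_lt measurable_const (by fun_prop)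
    have k1 : ENNReal.ofReal ((s/2)^2) * volume {x | ENNReal.ofReal s < XX α θ g x ^ (1/2 : ℝ)} ≤
        ∫⁻ x, XX α θ (cv κ κ a b G) x := by
      rw [← lintegral_indicator_const mset]
      refine lintegral_mono fun x => ?_
      by_cases hx : ENNReal.ofReal s < XX α θ g x ^ (1/2 : ℝ)
      · rw [indicator_of_mem (by exact hx)]; exact dom x hx
      · rw [indicator_of_notMem (by exact hx)]; exact zero_le
    have k2 := k1.trans (h2 G C0 mG bG)
    have k3 : ∫⁻ x, ‖G x‖ₑ ^ 2 ≤ ∫⁻ x, (if ENNReal.ofReal s < ENNReal.ofReal R * ‖g x‖ₑ then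
        (ENNReal.ofReal R * ‖g x‖ₑ) ^ (2:ℝ) else 0) := by
      refine lintegral_mono fun x => ?_
      by_cases h : s1 < ‖g x‖
      · have : ENNReal.ofReal s < ENNReal.ofReal R * ‖g x‖ₑ := by
          rw [← ofReal_norm, ← ENNReal.ofReal_mul (by linarith), ENNReal.ofReal_lt_ofReal_iff_of_nonneg hs.le]
          rw [hs1, div_lt_iff₀ (by linarith)] at h
          linarith
        rw [if_pos this]
        simp only [hG, if_pos h]
        rw [ENNReal.rpow_two]
        refine pow_le_pow_left' ?_ 2
        exact le_mul_of_one_le_left zero_le (ENNReal.one_le_ofReal.2 hR1)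
      · simp only [hG, if_neg h]; simp
    have k4 := k2.trans (mul_le_mul' le_rfl k3)
    have e1 : ENNReal.ofReal ((s/2)^2) ≠ 0 := by
      rw [Ne, ENNReal.ofReal_eq_zero, not_le]; positivity
    rw [mul_comm] at k4
    have k5 := (ENNReal.le_div_iff_mul_le (Or.inl e1) (Or.inl ENNReal.ofReal_ne_top)).2 k4
    refine k5.trans (le_of_eq ?_)
    rw [div_eq_mul_inv, ← ENNReal.ofReal_inv_of_pos (by positivity)]
    have : ((s/2)^2)⁻¹ = 4 * s ^ (-2:ℝ) := by
      rw [Real.rpow_neg hs.le]; norm_num; field_simp; norm_num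
    rw [this, ENNReal.ofReal_mul (p := 4) (by norm_num), show ENNReal.ofReal 4 = 4 by norm_num]
    ring

/-- the data attached to one frequency index -/
structure Piece (K Λ : ℝ) (κ : ℝ → ℂ) (τ B b a : ℝ) (α θ : ℝ → ℝ) (g : ℝ × ℝ → ℂ) : Prop where
  ss : SS K τ B b α θ
  ha : 0 < a
  haτ : a ≤ K * τ
  cont : Continuous g
  bdd : ∃ C0, ∀ x, ‖g x‖ ≤ C0
  rep : ∀ x, cv κ κ a b g x = g x
  hlog : Real.log (1 + 4 * (B / b)) ≤ Λ

lemma vector_one {K q : ℝ} (hK : 1 ≤ K) (hq : 1 < q) : ∃ (κ : ℝ → ℂ) (N0 : ℕ) (C : ℝ), Dec N0 C κ ∧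
    (∀ ζ : ℝ, 1/2 ≤ |ζ| → |ζ| ≤ 2 → ∫ y : ℝ, κ y * Complex.exp (-2 * Real.pi * Complex.I * (y * ζ)) = 1) ∧
    ∃ C1 : ℝ≥0∞, C1 ≠ ∞ ∧ ∀ (Λ : ℝ) (F : Finset ℤ) (τ B b a : ℤ → ℝ) (α θ : ℤ → ℝ → ℝ) (g : ℤ → ℝ × ℝ → ℂ),
      1 ≤ Λ → (∀ i, Piece K Λ κ (τ i) (B i) (b i) (a i) (α i) (θ i) (g i)) →
      (∀ i ∈ F, ∀ j ∈ F, j < i → τ i ≤ a j ∧ B i ≤ b j) →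
      ∫⁻ x, (∑ i ∈ F, XX (α i) (θ i) (g i) x) ^ q ≤ (C1 * ENNReal.ofReal Λ) ^ q *
        ∫⁻ x, (∑ i ∈ F, ‖g i x‖ₑ ^ 2) ^ q := by
  set M : ℕ := ⌈2 * (q - 1)⌉₊ with hM
  obtain ⟨η, κ, κd, C, hC, cη, cκ, cκd, hd1, hd2, e1, e2, e3, hft⟩ := kernels (M + 2)
  have d1 : Dec (M+2) C η := ⟨hC, by omega, cη, e1⟩
  have d2 : Dec (M+2) C κ := ⟨hC, by omega, cκ, e2⟩
  have d3 : Dec (M+2) C κd := ⟨hC, by omega, cκd, e3⟩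
  obtain ⟨C2, hC2, h2⟩ := XX_h2 hK M d1 d2 d3 hd1 hd2
  refine ⟨κ, M+2, C, d2, hft, ?_⟩
  set R := ENNReal.ofReal (2 * q / (2 * q - 2)) * 4 * 
      ENNReal.ofReal (8 * K * (C * C * (c2 * c2).toReal + 1)) ^ (2 * q) with hR
  have hRt : R ≠ ∞ := ENNReal.mul_ne_top (ENNReal.mul_ne_top ENNReal.ofReal_ne_top (by simp))
    (ENNReal.rpow_ne_top_of_nonneg (by linarith) ENNReal.ofReal_ne_top)
  set C1 := ENNReal.ofReal (C * C) ^ 2 * (c2 * c2) with hC1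
  have hc : c2 * c2 ≠ ∞ := ENNReal.mul_ne_top c2_lt_top.ne c2_lt_top.ne
  have hC1t : C1 ≠ ∞ := ENNReal.mul_ne_top (ENNReal.pow_ne_top ENNReal.ofReal_ne_top) hc
  have hcl := CL_ne_top hq
  set D0 := 1 + C2 + R * C2 with hD0
  have hD0t : D0 ≠ ∞ := by
    rw [hD0]
    exact ENNReal.add_ne_top.2 ⟨ENNReal.add_ne_top.2 ⟨by simp, hC2⟩, ENNReal.mul_ne_top hRt hC2⟩
  refine ⟨ENNReal.ofReal (q*2^(q-1))*(C1^(q-1)*CL q^(1-1/q)+1) * D0, ?_, ?_⟩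
  · refine ENNReal.mul_ne_top (ENNReal.mul_ne_top ENNReal.ofReal_ne_top (ENNReal.add_ne_top.2 ⟨?_, by simp⟩)) hD0t
    refine ENNReal.mul_ne_top (ENNReal.rpow_ne_top_of_nonneg (by linarith) hC1t)
      (ENNReal.rpow_ne_top_of_nonneg ?_ hcl)
    rw [sub_nonneg, div_le_one (by linarith)]; exact hq.le
  intro Λ F τ B b a α θ g hΛ hP h4
  have hlogE : ∀ i, ENNReal.ofReal (Real.log (1 + 4 * (B i / b i))) ≤ ENNReal.ofReal Λ := fun i =>
    ENNReal.ofReal_le_ofReal (hP i).hlog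
  have hΛ1 : 1 ≤ ENNReal.ofReal Λ := ENNReal.one_le_ofReal.2 hΛ
  have hg' : ∀ i, cv κ κ (a i) (b i) (g i) = g i := fun i => funext (hP i).rep
  have := recursion hq (M := M) (Nat.le_ceil _) F (X := fun i => XX (α i) (θ i) (g i))
    (G := fun i x => ‖g i x‖ₑ ^ 2) ?_ ?_ (a := a) (b := b) (τ := τ) (B := B) (fun i => (hP i).ha)
    (fun i => (hP i).ss.hb) (fun i => (hP i).ss.hτ) (fun i => (hP i).ss.hB) (D := D0 * ENNReal.ofReal Λ)
    (C1 := C1) ?_ (ENNReal.mul_ne_top hD0t ENNReal.ofReal_ne_top) ?_ ?_ ?_ h4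
  · refine this.trans (le_of_eq ?_)
    congr 2; ring
  · intro i; obtain ⟨C0, h0⟩ := (hP i).bdd
    exact XX_meas (hP i).ss (hP i).cont h0
  · intro i; have := (hP i).cont.measurable; fun_prop
  · calc (1:ℝ≥0∞) = 1 * 1 := by simp
      _ ≤ _ := mul_le_mul' (by rw [hD0, add_assoc]; exact le_self_add) hΛ1
  · intro i x; obtain ⟨C0, h0⟩ := (hP i).bdd
    exact XX_h1 (hP i).ss d2 (a i) (hP i).cont.measurable h0 (hP i).rep x
  · intro i W mW hW
    obtain ⟨C0, h0⟩ := (hP i).bdd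
    have := h2 _ _ _ _ _ _ (hP i).ss (hP i).ha (hP i).haτ (g i) C0 (hP i).cont.measurable h0 W mW hW
    rw [hg' i] at this
    refine this.trans (mul_le_mul' (mul_le_mul' ?_ (hlogE i)) le_rfl)
    rw [hD0, add_comm 1 C2, add_assoc]; exact le_self_add
  · intro i
    obtain ⟨C0, h0⟩ := (hP i).bdd
    have := XX_h3 hK d2 hq (C2 := C2) (L := ENNReal.ofReal (Real.log (1 + 4 * (B i / b i)))) (a := a i) (hP i).ss 
      (by
        intro G C0 mG bG
        have := h2 _ _ _ _ _ _ (hP i).ss (hP i).ha (hP i).haτ G C0 mG bG (fun _ => 1) measurable_const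
          (slow_one M (hP i).ss.hτ (hP i).ss.hB)
        simpa using this) (hP i).cont h0 (hP i).rep
    refine this.trans (mul_le_mul' ?_ le_rfl)
    calc _ = R * C2 * ENNReal.ofReal (Real.log (1 + 4 * (B i / b i))) := by rw [hR]; ring
      _ ≤ _ := mul_le_mul' (by rw [hD0]; exact le_add_self) (hlogE i)

lemma rpow_sum_range {q : ℝ} (hq : 1 < q) (n : ℕ) (f : ℕ → ℝ≥0∞) :
    (∑ c ∈ Finset.range n, f c) ^ q ≤ (n:ℝ≥0∞) ^ (q - 1) * ∑ c ∈ Finset.range n, f c ^ q := by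
  have := jensen (Measure.count : Measure (Fin n)) hq (f := fun i => f i) (measurable_of_countable _).aemeasurable
  rw [lintegral_count, lintegral_count, tsum_fintype, tsum_fintype, Measure.count_univ] at this
  rw [Finset.sum_range, Finset.sum_range]
  simpa using this

lemma vector_split {K q : ℝ} (hK : 1 ≤ K) (hq : 1 < q) : ∃ (κ : ℝ → ℂ) (N0 : ℕ) (C : ℝ), Dec N0 C κ ∧
    (∀ ζ : ℝ, 1/2 ≤ |ζ| → |ζ| ≤ 2 → ∫ y : ℝ, κ y * Complex.exp (-2 * Real.pi * Complex.I * (y * ζ)) = 1) ∧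
    ∃ C1 : ℝ≥0∞, C1 ≠ ∞ ∧ ∀ (Λ : ℝ) (n : ℕ) (τ B b a : ℤ → ℝ) (α θ : ℤ → ℝ → ℝ) (g : ℤ → ℝ × ℝ → ℂ),
      1 ≤ Λ → 1 ≤ n → (∀ i, Piece K Λ κ (τ i) (B i) (b i) (a i) (α i) (θ i) (g i)) →
      (∀ i j : ℤ, (n:ℤ) ≤ i - j → τ i ≤ a j ∧ B i ≤ b j) → ∀ F : Finset ℤ,
      ∫⁻ x, (∑ i ∈ F, XX (α i) (θ i) (g i) x) ^ q ≤ (C1 * ENNReal.ofReal Λ * n) ^ q *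
        ∫⁻ x, (∑ i ∈ F, ‖g i x‖ₑ ^ 2) ^ q := by
  obtain ⟨κ, N0, C, hd, hft, C1, hC1, h⟩ := vector_one hK hq
  refine ⟨κ, N0, C, hd, hft, C1, hC1, ?_⟩
  intro Λ n τ B b a α θ g hΛ hn hP hsep F
  set X : ℤ → ℝ × ℝ → ℝ≥0∞ := fun i => XX (α i) (θ i) (g i) with hX
  have mX : ∀ i, Measurable (X i) := fun i => by
    obtain ⟨C0, h0⟩ := (hP i).bdd
    exact XX_meas (hP i).ss (hP i).cont h0
  set Fc : ℕ → Finset ℤ := fun c => F.filter (fun i => (i % (n:ℤ)).toNat = c) with hFc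
  have hn0 : (0:ℤ) < n := by exact_mod_cast hn
  have hmaps : ∀ i ∈ F, (i % (n:ℤ)).toNat ∈ Finset.range n := by
    intro i _
    rw [Finset.mem_range]
    have := Int.emod_lt_of_pos i hn0
    have := Int.emod_nonneg i hn0.ne'
    omega
  have hsum : ∀ x, ∑ i ∈ F, X i x = ∑ c ∈ Finset.range n, ∑ i ∈ Fc c, X i x := fun x =>
    (Finset.sum_fiberwise_of_maps_to hmaps _).symm
  have hone : ∀ c, ∫⁻ x, (∑ i ∈ Fc c, X i x) ^ q ≤ (C1 * ENNReal.ofReal Λ) ^ q *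
        ∫⁻ x, (∑ i ∈ F, ‖g i x‖ₑ ^ 2) ^ q := by
    intro c
    refine (h Λ (Fc c) τ B b a α θ g hΛ hP ?_).trans (mul_le_mul' le_rfl (lintegral_mono fun x => ?_))
    · intro i hi j hj hji
      apply hsep
      simp only [hFc, Finset.mem_filter] at hi hj
      have h1 := Int.emod_nonneg i hn0.ne'
      have h2 := Int.emod_nonneg j hn0.ne'
      have h3 : i % (n:ℤ) = j % (n:ℤ) := by omega
      have h4 : (n:ℤ) ∣ i - j := Int.ModEq.dvd (show j ≡ i [ZMOD n] from h3.symm)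
      exact Int.le_of_dvd (by linarith) h4
    · refine ENNReal.rpow_le_rpow ?_ (by linarith)
      exact Finset.sum_le_sum_of_subset (Finset.filter_subset _ _)
  have hq0 : (0:ℝ) ≤ q := by linarith
  calc _ ≤ ∫⁻ x, (n:ℝ≥0∞) ^ (q - 1) * ∑ c ∈ Finset.range n, (∑ i ∈ Fc c, X i x) ^ q := by
        refine lintegral_mono fun x => ?_
        have e := hsum x
        simp only [hX] at e ⊢
        rw [e]
        exact rpow_sum_range hq n (fun c => ∑ i ∈ Fc c, XX (α i) (θ i) (g i) x)
    _ = (n:ℝ≥0∞) ^ (q - 1) * ∑ c ∈ Finset.range n, ∫⁻ x, (∑ i ∈ Fc c, X i x) ^ q := by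
        rw [lintegral_const_mul _ (by fun_prop), lintegral_finsetSum _ (fun c _ => by fun_prop)]
    _ ≤ (n:ℝ≥0∞) ^ (q - 1) * ∑ c ∈ Finset.range n, ((C1 * ENNReal.ofReal Λ) ^ q *
        ∫⁻ x, (∑ i ∈ F, ‖g i x‖ₑ ^ 2) ^ q) := mul_le_mul' le_rfl (Finset.sum_le_sum fun c _ => hone c)
    _ = ((n:ℝ≥0∞) ^ (q - 1) * n) * ((C1 * ENNReal.ofReal Λ) ^ q *
        ∫⁻ x, (∑ i ∈ F, ‖g i x‖ₑ ^ 2) ^ q) := by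
        rw [Finset.sum_const, Finset.card_range, nsmul_eq_mul]; ring
    _ = _ := by
        have : (n:ℝ≥0∞) ^ (q - 1) * n = (n:ℝ≥0∞) ^ q := by
          conv_lhs => rw [← ENNReal.rpow_one (n:ℝ≥0∞), ← ENNReal.rpow_mul, one_mul]
          rw [← ENNReal.rpow_add _ _ (by simpa using (by omega : n ≠ 0)) (by simp)]
          congr 1; ring
        rw [this, ENNReal.mul_rpow_of_nonneg _ (n:ℝ≥0∞) hq0]; ring

lemma vector_inf {K q : ℝ} (hK : 1 ≤ K) (hq : 1 < q) : ∃ (κ : ℝ → ℂ) (N0 : ℕ) (C : ℝ), Dec N0 C κ ∧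
    (∀ ζ : ℝ, 1/2 ≤ |ζ| → |ζ| ≤ 2 → ∫ y : ℝ, κ y * Complex.exp (-2 * Real.pi * Complex.I * (y * ζ)) = 1) ∧
    ∃ C1 : ℝ≥0∞, C1 ≠ ∞ ∧ ∀ (Λ : ℝ) (n : ℕ) (τ B b a : ℤ → ℝ) (α θ : ℤ → ℝ → ℝ) (g : ℤ → ℝ × ℝ → ℂ),
      1 ≤ Λ → 1 ≤ n → (∀ i, Piece K Λ κ (τ i) (B i) (b i) (a i) (α i) (θ i) (g i)) →
      (∀ i j : ℤ, (n:ℤ) ≤ i - j → τ i ≤ a j ∧ B i ≤ b j) → ∀ S : ℤ → Prop,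
      ∫⁻ x, (∑' i : {i // S i}, XX (α i) (θ i) (g i) x) ^ q ≤ (C1 * ENNReal.ofReal Λ * n) ^ q *
        ∫⁻ x, (∑' i : {i // S i}, ‖g i x‖ₑ ^ 2) ^ q := by
  classical
  obtain ⟨κ, N0, C, hd, hft, C1, hC1, h⟩ := vector_split hK hq
  refine ⟨κ, N0, C, hd, hft, C1, hC1, ?_⟩
  intro Λ n τ B b a α θ g hΛ hn hP hsep S
  have hq0 : (0:ℝ) < q := by linarith
  have mX : ∀ i, Measurable (XX (α i) (θ i) (g i)) := fun i => by
    obtain ⟨C0, h0⟩ := (hP i).bdd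
    exact XX_meas (hP i).ss (hP i).cont h0
  set s : ℕ → Finset {i // S i} := fun m => (Finset.Icc (-(m:ℤ)) m).subtype S with hs
  have smono : Monotone s := by
    intro m m' hm i hi
    simp only [hs, Finset.mem_subtype, Finset.mem_Icc] at hi ⊢
    have : (m:ℤ) ≤ m' := by exact_mod_cast hm
    constructor <;> linarith
  have scov : ∀ t : Finset {i // S i}, ∃ m, t ⊆ s m := by
    intro t
    refine ⟨t.sup fun i => (i.1).natAbs, fun i hi => ?_⟩
    have : (i.1).natAbs ≤ t.sup fun i => (i.1).natAbs := Finset.le_sup (f := fun i : {i // S i} => (i.1).natAbs) hi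
    simp only [hs, Finset.mem_subtype, Finset.mem_Icc]
    omega
  have e : ∀ x, (∑' i : {i // S i}, XX (α i) (θ i) (g i) x) ^ q =
      ⨆ m, (∑ i ∈ s m, XX (α i) (θ i) (g i) x) ^ q := by
    intro x
    rw [ENNReal.tsum_eq_iSup_sum' s scov]
    exact (ENNReal.orderIsoRpow q hq0).map_iSup _
  simp_rw [e]
  rw [lintegral_iSup (fun m => by fun_prop)]
  · refine iSup_le fun m => ?_
    have := h Λ n τ B b a α θ g hΛ hn hP hsep ((Finset.Icc (-(m:ℤ)) m).filter S)
    simp_rw [← Finset.sum_subtype_eq_sum_filter] at this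
    refine this.trans (mul_le_mul' le_rfl (lintegral_mono fun x => ENNReal.rpow_le_rpow ?_ hq0.le))
    exact ENNReal.sum_le_tsum _
  · intro m m' hm x
    refine ENNReal.rpow_le_rpow ?_ hq0.le
    exact Finset.sum_le_sum_of_subset (smono hm)

/-- doubling facts about the curve -/
structure GF (γ : ℝ → ℝ) (c : ℝ) (D : ℕ) : Prop where
  hc : 0 < c
  pos : ∀ t, 0 < t → 0 < γ t
  lo : ∀ t, 0 < t → c * γ t ≤ t * deriv γ t
  hi : ∀ t, 0 < t → t * deriv γ t ≤ D * γ t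
  mono : ∀ s t, 0 < s → s ≤ t → γ s ≤ γ t
  grow : ∀ s t, 0 < s → s ≤ t → γ t ≤ (t / s) ^ D * γ s
  sep : ∀ τ s t, 0 < τ → s ∈ Icc (τ/2) (2*τ) → t ∈ Icc (τ/2) (2*τ) →
    (c / 2 / 2 ^ D) * (γ τ / τ) * |t - s| ≤ |γ t - γ s|
  meas : Measurable γ
  par : ∀ t s : ℝ, |γ t| = γ |t| ∧ |γ (|t|) - γ (|s|)| ≤ |γ t - γ s|

lemma gfacts {γ : ℝ → ℝ} (hγ0 : γ 0 = 0)
    (hparity : (∀ t, γ (-t) = γ t) ∨ (∀ t, γ (-t) = -γ t))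
    (hyp2 : ∃ c > (0 : ℝ), ∀ j ∈ ({1, 2} : Set ℕ), ∀ t ∈ Set.Ioc (0 : ℝ) 1,
      c ≤ |t ^ j * iteratedDeriv j γ t / γ t|)
    (hyp3 : ∃ C : ℝ, ∀ j : ℕ, 1 ≤ j → j ≤ 1000 → ∀ t ∈ Set.Ioc (0 : ℝ) 1,
      |t ^ j * iteratedDeriv j γ t / γ t| ≤ C)
    (hext : ∀ t : ℝ, 1 ≤ t → γ t = (γ t⁻¹)⁻¹)
    (hcont : ContinuousOn γ (Set.Ici (0 : ℝ)))
    (hmono2 : StrictMonoOn γ (Set.Ici (0 : ℝ))) : ∃ (c : ℝ) (D : ℕ), GF γ c D := by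
  obtain ⟨c, hc, h2⟩ := hyp2
  obtain ⟨C, h3⟩ := hyp3
  obtain ⟨D, hD⟩ := exists_nat_ge C
  have pos : ∀ t, 0 < t → 0 < γ t := fun t ht => by
    rw [← hγ0]; exact hmono2 (mem_Ici.2 le_rfl) (mem_Ici.2 ht.le) ht
  have mono : ∀ s t, 0 < s → s ≤ t → γ s ≤ γ t := fun s t hs hst =>
    hmono2.monotoneOn (mem_Ici.2 hs.le) (mem_Ici.2 (hs.le.trans hst)) hst
  have dnn : ∀ t, 0 < t → 0 ≤ deriv γ t := by
    intro t ht
    have := hmono2.monotoneOn.derivWithin_nonneg (x := t)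
    rwa [derivWithin_of_mem_nhds (Ici_mem_nhds ht)] at this
  have base : ∀ t, 0 < t → t ≤ 1 → DifferentiableAt ℝ γ t ∧ c * γ t ≤ t * deriv γ t ∧ t * deriv γ t ≤ D * γ t := by
    intro t ht ht1
    have a1 := h2 1 (by simp) t ⟨ht, ht1⟩
    have a2 := h3 1 le_rfl (by norm_num) t ⟨ht, ht1⟩
    have hp := pos t ht
    rw [pow_one, iteratedDeriv_one, abs_of_nonneg (by have := dnn t ht; positivity)] at a1 a2
    refine ⟨?_, ?_, ?_⟩
    · apply differentiableAt_of_deriv_ne_zero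
      intro h0; rw [h0] at a1; simp at a1; linarith
    · rwa [le_div_iff₀ hp] at a1
    · rw [div_le_iff₀ hp] at a2
      exact a2.trans (mul_le_mul_of_nonneg_right hD hp.le)
  have all : ∀ t, 0 < t → DifferentiableAt ℝ γ t ∧ c * γ t ≤ t * deriv γ t ∧ t * deriv γ t ≤ D * γ t := by
    intro t ht
    rcases le_or_gt t 1 with h | h
    · exact base t ht h
    have hs : 0 < t⁻¹ := by positivity
    obtain ⟨b1, b2, b3⟩ := base t⁻¹ hs (inv_le_one_of_one_le₀ h.le)
    have hp := pos _ hs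
    have hd : HasDerivAt (fun t => (γ t⁻¹)⁻¹) (-(deriv γ t⁻¹ * -(t ^ 2)⁻¹) / (γ t⁻¹) ^ 2) t := 
      (HasDerivAt.comp t b1.hasDerivAt (hasDerivAt_inv ht.ne')).inv hp.ne'
    have hd' : HasDerivAt γ (-(deriv γ t⁻¹ * -(t ^ 2)⁻¹) / (γ t⁻¹) ^ 2) t := by
      refine hd.congr_of_eventuallyEq ?_
      filter_upwards [Ioi_mem_nhds h] with s hs
      exact hext s (mem_Ioi.1 hs).le
    have e : t * deriv γ t = (γ t⁻¹)⁻¹ * ((t⁻¹ * deriv γ t⁻¹) / γ t⁻¹) := by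
      rw [hd'.deriv]; field_simp
    refine ⟨hd'.differentiableAt, ?_, ?_⟩
    · rw [e, hext t h.le, mul_comm]
      refine mul_le_mul_of_nonneg_left ?_ (by positivity)
      rwa [le_div_iff₀ hp]
    · rw [e, hext t h.le, mul_comm (D:ℝ)]
      refine mul_le_mul_of_nonneg_left ?_ (by positivity)
      rwa [div_le_iff₀ hp]
  have grow : ∀ s t, 0 < s → s ≤ t → γ t ≤ (t / s) ^ D * γ s := by
    have hd : ∀ t ∈ Ioi (0:ℝ), HasDerivAt (fun t => γ t * (t ^ D)⁻¹)
        (deriv γ t * (t^D)⁻¹ + γ t * (-(D * t ^ (D-1)) / (t ^ D) ^ 2)) t := by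
      intro t ht
      have ht' : 0 < t := ht
      exact (all t ht).1.hasDerivAt.mul ((hasDerivAt_pow D t).fun_inv (by positivity))
    have anti : AntitoneOn (fun t => γ t * (t ^ D)⁻¹) (Ioi 0) := by
      apply antitoneOn_of_deriv_nonpos (convex_Ioi 0)
      · exact fun t ht => (hd t ht).continuousAt.continuousWithinAt
      · rw [interior_Ioi]; exact fun t ht => (hd t ht).differentiableAt.differentiableWithinAt
      · rw [interior_Ioi]
        intro t ht
        rw [(hd t ht).deriv]
        have ht' : 0 < t := ht
        have := (all t ht).2.2
        rcases Nat.eq_zero_or_pos D with h0 | h0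
        · subst h0; simp at this ⊢
          by_contra hcon; push Not at hcon
          nlinarith
        · have e : deriv γ t * (t^D)⁻¹ + γ t * (-(D * t ^ (D-1)) / (t ^ D) ^ 2) = 
            (t * deriv γ t - D * γ t) * (t * t ^ D)⁻¹ := by
            have : t ^ D = t ^ (D-1) * t := by rw [← pow_succ]; congr 1; omega
            rw [this]; field_simp; ring
          rw [e]
          exact mul_nonpos_of_nonpos_of_nonneg (by linarith) (by positivity)
    intro s t hs hst
    have ht := hs.trans_le hst
    have := anti (mem_Ioi.2 hs) (mem_Ioi.2 ht) hst
    simp only at this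
    rw [← div_eq_mul_inv, ← div_eq_mul_inv, div_le_div_iff₀ (by positivity) (by positivity)] at this
    rw [div_pow, div_mul_eq_mul_div, le_div_iff₀ (by positivity)]
    linarith
  have sep0 : ∀ τ s t, 0 < τ → s ∈ Icc (τ/2) (2*τ) → t ∈ Icc (τ/2) (2*τ) → s ≤ t →
    (c / 2 / 2 ^ D) * (γ τ / τ) * (t - s) ≤ γ t - γ s := by
    intro τ s t hτ hs ht hst
    refine (convex_Icc (τ/2) (2*τ)).mul_sub_le_image_sub_of_le_deriv (hcont.mono ?_) ?_ ?_ s hs t ht hst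
    · intro x hx; exact mem_Ici.2 (by linarith [hx.1])
    · rw [interior_Icc]; intro x hx
      exact (all x (by linarith [hx.1])).1.differentiableWithinAt
    · rw [interior_Icc]; intro x hx
      have hx0 : 0 < x := by linarith [hx.1]
      have k1 := (all x hx0).2.1
      have k2 := mono (τ/2) x (by positivity) hx.1.le
      have k3 := grow (τ/2) τ (by positivity) (by linarith)
      have e : τ / (τ/2) = 2 := by field_simp
      rw [e] at k3
      have k4 : γ τ / 2 ^ D ≤ γ x := by
        rw [div_le_iff₀ (by positivity)]; nlinarith [pow_pos (show (0:ℝ) < 2 by norm_num) D]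
      have k5 : c * (γ τ / 2 ^ D) ≤ (2 * τ) * deriv γ x := by
        calc _ ≤ c * γ x := by gcongr
          _ ≤ x * deriv γ x := k1
          _ ≤ _ := mul_le_mul_of_nonneg_right hx.2.le (dnn x hx0)
      have : (c / 2 / 2 ^ D) * (γ τ / τ) = c * (γ τ / 2 ^ D) / (2 * τ) := by field_simp
      rw [this, div_le_iff₀ (by positivity)]; linarith
  have cabs : Continuous fun t => γ |t| := hcont.comp_continuous continuous_abs (fun t => abs_nonneg t)
  have g0 : ∀ t, 0 ≤ t → 0 ≤ γ t := fun t ht => by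
    rcases ht.eq_or_lt with h | h
    · rw [← h, hγ0]
    · exact (pos t h).le
  refine ⟨c, D, hc, pos, fun t ht => (all t ht).2.1, fun t ht => (all t ht).2.2, mono, grow, ?_, ?_, ?_⟩
  · intro τ s t hτ hs ht
    rcases le_total s t with h | h
    · rw [abs_of_nonneg (sub_nonneg.2 h)]
      exact (sep0 τ s t hτ hs ht h).trans (le_abs_self _)
    · rw [abs_sub_comm, abs_of_nonneg (sub_nonneg.2 h), abs_sub_comm]
      exact (sep0 τ t s hτ ht hs h).trans (le_abs_self _)
  · rcases hparity with h | h
    · have : γ = fun t => γ |t| := by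
        ext t; rcases abs_choice t with e | e <;> rw [e]; rw [h]
      rw [this]; exact cabs.measurable
    · have : γ = fun t => if 0 ≤ t then γ |t| else -γ |t| := by
        ext t; split_ifs with h1
        · rw [abs_of_nonneg h1]
        · rw [abs_of_neg (not_le.1 h1), h]; simp
      rw [this]
      exact Measurable.ite measurableSet_Ici cabs.measurable cabs.measurable.neg
  · intro t s
    rcases hparity with h | h
    · have e : ∀ t, γ t = γ |t| := by
        intro t; rcases abs_choice t with e | e <;> rw [e]; rw [h]
      rw [← e t, ← e s]
      exact ⟨abs_of_nonneg (by rw [e t]; exact g0 _ (abs_nonneg t)), le_rfl⟩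
    · have e : ∀ t, |γ t| = γ |t| := by
        intro t
        rcases le_total 0 t with h1 | h1
        · rw [abs_of_nonneg h1, abs_of_nonneg (g0 t h1)]
        · have := g0 (-t) (by linarith)
          rw [abs_of_nonpos h1]
          rw [h t] at this ⊢
          exact abs_of_nonpos (by linarith)
      refine ⟨e t, ?_⟩
      rw [← e t, ← e s]
      exact abs_abs_sub_abs_le_abs_sub _ _

open FourierTransform in
lemma ft_eq (h : ℝ × ℝ → ℂ) (w : WithLp 2 (ℝ × ℝ)) :
    ft h (WithLp.ofLp w) = 𝓕 (fun z : WithLp 2 (ℝ × ℝ) => h (WithLp.ofLp z)) w := by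
  rw [Real.fourier_eq']
  unfold ft
  rw [← (WithLp.volume_preserving_ofLp ℝ ℝ).integral_comp
    (MeasurableEquiv.toLp 2 (ℝ × ℝ)).symm.measurableEmbedding]
  congr 1
  funext z
  simp only [smul_eq_mul, WithLp.prod_inner_apply]
  congr 2
  push_cast
  simp
  ring

open FourierTransform in
lemma ftInv_eq (h : ℝ × ℝ → ℂ) (w : WithLp 2 (ℝ × ℝ)) :
    ftInv h (WithLp.ofLp w) = 𝓕⁻ (fun z : WithLp 2 (ℝ × ℝ) => h (WithLp.ofLp z)) w := by
  rw [Real.fourierInv_eq']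
  unfold ftInv
  rw [← (WithLp.volume_preserving_ofLp ℝ ℝ).integral_comp
    (MeasurableEquiv.toLp 2 (ℝ × ℝ)).symm.measurableEmbedding]
  congr 1
  funext z
  simp only [smul_eq_mul, WithLp.prod_inner_apply]
  congr 2
  push_cast
  simp
  ring

open FourierTransform in
lemma ft_schwartz (f : SchwartzMap (ℝ × ℝ) ℂ) :
    ∃ G : SchwartzMap (ℝ × ℝ) ℂ, ∀ ξ, G ξ = ft f ξ := by
  set F : SchwartzMap (WithLp 2 (ℝ × ℝ)) ℂ :=
    SchwartzMap.compCLMOfContinuousLinearEquiv ℂ (WithLp.prodContinuousLinearEquiv 2 ℝ ℝ ℝ) f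
  refine ⟨SchwartzMap.compCLMOfContinuousLinearEquiv ℂ
    (WithLp.prodContinuousLinearEquiv 2 ℝ ℝ ℝ).symm (𝓕 F), fun ξ => ?_⟩
  have := ft_eq f (WithLp.toLp 2 ξ)
  simp only [] at this
  rw [this]
  rw [SchwartzMap.compCLMOfContinuousLinearEquiv_apply, SchwartzMap.fourier_coe]
  rfl

open FourierTransform in
lemma ft_ftInv (b : SchwartzMap (ℝ × ℝ) ℂ) (ξ : ℝ × ℝ) : ft (ftInv b) ξ = b ξ := by
  set F : SchwartzMap (WithLp 2 (ℝ × ℝ)) ℂ :=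
    SchwartzMap.compCLMOfContinuousLinearEquiv ℂ (WithLp.prodContinuousLinearEquiv 2 ℝ ℝ ℝ) b
  have h1 := ft_eq (ftInv b) (WithLp.toLp 2 ξ)
  have h2 : (fun z : WithLp 2 (ℝ × ℝ) => ftInv b (WithLp.ofLp z)) =
      ⇑((𝓕⁻ F : SchwartzMap (WithLp 2 (ℝ × ℝ)) ℂ)) := by
    funext z
    rw [ftInv_eq, SchwartzMap.fourierInv_coe]
    rfl
  simp only [h2] at h1
  rw [h1, ← SchwartzMap.fourier_coe, FourierTransform.fourier_fourierInv_eq]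
  rfl

lemma symb_schwartz (φ : ℝ → ℝ) (hφs : ContDiff ℝ (⊤ : ℕ∞) φ) (hφc : HasCompactSupport φ)
    (L : ℝ × ℝ →L[ℝ] ℝ) (G : SchwartzMap (ℝ × ℝ) ℂ) :
    ∃ H : SchwartzMap (ℝ × ℝ) ℂ, ∀ ξ, H ξ = (φ (L ξ) : ℂ) * G ξ := by
  have hc : HasCompactSupport (fun t => (φ t : ℂ)) :=
    hφc.comp_left (g := fun r : ℝ => (r : ℂ)) Complex.ofReal_zero
  have hs : ContDiff ℝ (⊤ : ℕ∞) (fun t => (φ t : ℂ)) := Complex.ofRealCLM.contDiff.comp hφs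
  have ht : Function.HasTemperateGrowth (fun ξ => (φ (L ξ) : ℂ)) := by
    have h0 : Function.HasTemperateGrowth (fun t => (φ t : ℂ)) := hc.hasTemperateGrowth hs
    exact h0.comp L.hasTemperateGrowth
  refine ⟨SchwartzMap.smulLeftCLM ℂ (fun ξ => (φ (L ξ) : ℂ)) G, fun ξ => ?_⟩
  rw [SchwartzMap.smulLeftCLM_apply_apply ht]
  rfl

lemma PP_eq (φ : ℝ → ℝ) (hφs : ContDiff ℝ (⊤ : ℕ∞) φ) (hφc : HasCompactSupport φ)
    (f : SchwartzMap (ℝ × ℝ) ℂ) :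
    ∃ G : SchwartzMap (ℝ × ℝ) ℂ, ∀ j k : ℤ, P1 φ j (P2 φ k f) = ftInv (fun ξ =>
      (φ ((2 : ℝ) ^ (-j) * ξ.1) : ℂ) * ((φ ((2 : ℝ) ^ (-k) * ξ.2) : ℂ) * G ξ)) := by
  obtain ⟨G, hG⟩ := ft_schwartz f
  refine ⟨G, fun j k => ?_⟩
  obtain ⟨H, hH⟩ := symb_schwartz φ hφs hφc
    (((2 : ℝ) ^ (-k)) • ContinuousLinearMap.snd ℝ ℝ ℝ) G
  have e : P2 φ k f = ftInv H := by
    unfold P2 op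
    congr 1
    funext ξ
    rw [hH, hG]; rfl
  unfold P1 op
  rw [e]
  congr 1
  funext ξ
  rw [ft_ftInv, hH]; rfl

lemma nexp (r : ℂ) (s : ℝ) (h : r = 2 * Real.pi * Complex.I * s) : ‖Complex.exp r‖ = 1 := by
  have : r = ((2 * Real.pi * s : ℝ) : ℂ) * Complex.I := by rw [h]; push_cast; ring
  rw [this, Complex.norm_exp_ofReal_mul_I]

lemma nexp2 (x ξ : ℝ × ℝ) :
    ‖Complex.exp (2 * Real.pi * Complex.I * (x.1 * ξ.1 + x.2 * ξ.2))‖ = 1 :=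
  nexp _ (x.1 * ξ.1 + x.2 * ξ.2) (by push_cast; ring)

lemma ftInv_cont {S : ℝ × ℝ → ℂ} (hS : Integrable S) : Continuous (ftInv S) := by
  unfold ftInv
  refine continuous_of_dominated (bound := fun ξ => ‖S ξ‖) (fun x => ?_) (fun x => ?_) hS.norm ?_
  · exact (Continuous.aestronglyMeasurable (by fun_prop)).mul hS.aestronglyMeasurable
  · exact Eventually.of_forall fun ξ => by rw [norm_mul, nexp2, one_mul]
  · exact Eventually.of_forall fun ξ => by fun_prop

lemma ftInv_bdd (S : ℝ × ℝ → ℂ) (x : ℝ × ℝ) : ‖ftInv S x‖ ≤ ∫ ξ, ‖S ξ‖ := by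
  unfold ftInv
  refine (norm_integral_le_integral_norm _).trans (le_of_eq ?_)
  congr 1
  funext ξ
  rw [norm_mul, nexp2, one_mul]

lemma Dec.integrable {N : ℕ} {C : ℝ} {κ : ℝ → ℂ} (h : Dec N C κ) : Integrable κ := by
  refine (int_rw2.const_mul C).mono' h.cont.aestronglyMeasurable (Eventually.of_forall fun y => ?_)
  exact h.two y

lemma ftInv_rep {N : ℕ} {C : ℝ} {κ : ℝ → ℂ} (h : Dec N C κ)
    (hκ : ∀ ζ : ℝ, 1/2 ≤ |ζ| → |ζ| ≤ 2 →
      ∫ y : ℝ, κ y * Complex.exp (-2 * Real.pi * Complex.I * (y * ζ)) = 1)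
    {S : ℝ × ℝ → ℂ} (hS : Integrable S) {a b : ℝ}
    (hsupp : ∀ ξ, S ξ ≠ 0 → (1/2 ≤ |a * ξ.1| ∧ |a * ξ.1| ≤ 2) ∧ (1/2 ≤ |b * ξ.2| ∧ |b * ξ.2| ≤ 2))
    (x : ℝ × ℝ) : cv κ κ a b (ftInv S) x = ftInv S x := by
  have hi : Integrable (fun y : ℝ × ℝ => κ y.1 * κ y.2) := h.integrable.mul_prod h.integrable
  have hm := h.cont
  have h1 : cv κ κ a b (ftInv S) x = ∫ y : ℝ × ℝ, ∫ ξ : ℝ × ℝ,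
      Complex.exp (2 * Real.pi * Complex.I * ((x.1 - a * y.1) * ξ.1 + (x.2 - b * y.2) * ξ.2)) *
        ((κ y.1 * κ y.2) * S ξ) := by
    unfold cv ftInv
    congr 1
    funext y
    rw [← integral_const_mul]
    congr 1
    funext ξ
    push_cast
    ring
  rw [h1, integral_integral_swap]
  · unfold ftInv
    congr 1
    funext ξ
    by_cases h0 : S ξ = 0
    · simp [h0]
    obtain ⟨⟨q1, q2⟩, q3, q4⟩ := hsupp ξ h0
    have e : ∀ y : ℝ × ℝ,
      Complex.exp (2 * Real.pi * Complex.I * ((x.1 - a * y.1) * ξ.1 + (x.2 - b * y.2) * ξ.2)) *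
        ((κ y.1 * κ y.2) * S ξ) =
      (Complex.exp (2 * Real.pi * Complex.I * (x.1 * ξ.1 + x.2 * ξ.2)) * S ξ) *
      ((κ y.1 * Complex.exp (-2 * Real.pi * Complex.I * (y.1 * (a * ξ.1 : ℝ)))) *
       (κ y.2 * Complex.exp (-2 * Real.pi * Complex.I * (y.2 * (b * ξ.2 : ℝ))))) := by
      intro y
      have : (2 * Real.pi * Complex.I * ((x.1 - a * y.1) * ξ.1 + (x.2 - b * y.2) * ξ.2) : ℂ) =
        2 * Real.pi * Complex.I * (x.1 * ξ.1 + x.2 * ξ.2) +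
        (-2 * Real.pi * Complex.I * (y.1 * (a * ξ.1 : ℝ))) +
        (-2 * Real.pi * Complex.I * (y.2 * (b * ξ.2 : ℝ))) := by push_cast; ring
      rw [this, Complex.exp_add, Complex.exp_add]
      ring
    simp_rw [e]
    rw [integral_const_mul]
    rw [Measure.volume_eq_prod, integral_prod_mul
      (fun y : ℝ => κ y * Complex.exp (-2 * Real.pi * Complex.I * (y * (a * ξ.1 : ℝ))))
      (fun y : ℝ => κ y * Complex.exp (-2 * Real.pi * Complex.I * (y * (b * ξ.2 : ℝ)))),
      hκ _ q1 q2, hκ _ q3 q4]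
    simp
  · have h2 : Integrable (fun z : (ℝ × ℝ) × (ℝ × ℝ) => (κ z.1.1 * κ z.1.2) * S z.2) :=
      hi.mul_prod hS
    refine Integrable.bdd_mul (c := 1) h2 (Continuous.aestronglyMeasurable (by fun_prop))
      (Eventually.of_forall fun z => le_of_eq ?_)
    exact nexp _ ((x.1 - a * z.1.1) * z.2.1 + (x.2 - b * z.1.2) * z.2.2) (by push_cast; ring)

/-- symbol -/
noncomputable def sy (φ : ℝ → ℝ) (G : ℝ × ℝ → ℂ) (j k : ℤ) (ξ : ℝ × ℝ) : ℂ :=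
  (φ ((2 : ℝ) ^ (-j) * ξ.1) : ℂ) * ((φ ((2 : ℝ) ^ (-k) * ξ.2) : ℂ) * G ξ)

lemma sy_int {φ : ℝ → ℝ} (hφ : Continuous φ) {M : ℝ} (hM : ∀ t, |φ t| ≤ M)
    {G : ℝ × ℝ → ℂ} (hG : Integrable G) (j k : ℤ) : Integrable (sy φ G j k) := by
  have h1 : ∀ t, ‖(φ t : ℂ)‖ ≤ M := fun t => by
    rw [Complex.norm_real]; exact hM t
  refine Integrable.bdd_mul (c := M) (Integrable.bdd_mul (c := M) hG
    (Continuous.aestronglyMeasurable (by fun_prop)) (Eventually.of_forall fun z => h1 _))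
    (Continuous.aestronglyMeasurable (by fun_prop)) (Eventually.of_forall fun z => h1 _)

lemma overlap {φ : ℝ → ℝ} (hφsupp : Function.support φ ⊆ {t : ℝ | 1/2 ≤ |t| ∧ |t| ≤ 2})
    {M : ℝ} (hM : ∀ t, |φ t| ≤ M) (s : Finset ℤ) (t : ℝ) :
    ∑ k ∈ s, |φ ((2 : ℝ) ^ (-k) * t)| ≤ 3 * M := by
  classical
  have hM0 : 0 ≤ M := (abs_nonneg _).trans (hM 0)
  have key : (s.filter fun k => φ ((2 : ℝ) ^ (-k) * t) ≠ 0).card ≤ 3 := by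
    rcases (s.filter fun k => φ ((2 : ℝ) ^ (-k) * t) ≠ 0).eq_empty_or_nonempty with h | h
    · rw [h]; simp
    · set T := s.filter fun k => φ ((2 : ℝ) ^ (-k) * t) ≠ 0 with hT
      have hsub : T ⊆ Finset.Icc (T.min' h) (T.min' h + 2) := by
        intro k hk
        rw [Finset.mem_Icc]
        refine ⟨T.min'_le k hk, ?_⟩
        have m1 := hφsupp ((Finset.mem_filter.1 hk).2)
        have m2 := hφsupp ((Finset.mem_filter.1 (T.min'_mem h)).2)
        set j := T.min' h
        have m1' := m1.1
        have m2' := m2.2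
        rw [abs_mul, abs_of_pos (by positivity)] at m1' m2'
        by_contra hc
        push Not at hc
        have e : (2 : ℝ) ^ (-j) = 2 ^ (k - j) * 2 ^ (-k) := by
          rw [← zpow_add₀ (by norm_num)]; congr 1; ring
        have e2 : (2 : ℝ) ^ (3 : ℤ) ≤ 2 ^ (k - j) :=
          zpow_le_zpow_right₀ (by norm_num) (by omega)
        norm_num at e2
        rw [e] at m2'
        nlinarith
      calc T.card ≤ _ := Finset.card_le_card hsub
        _ = 3 := by rw [Int.card_Icc]; omega
  calc ∑ k ∈ s, |φ ((2 : ℝ) ^ (-k) * t)|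
      = ∑ k ∈ s.filter (fun k => φ ((2 : ℝ) ^ (-k) * t) ≠ 0), |φ ((2 : ℝ) ^ (-k) * t)| := by
        rw [Finset.sum_filter]
        refine Finset.sum_congr rfl fun k _ => ?_
        by_cases h : φ ((2 : ℝ) ^ (-k) * t) = 0 <;> simp [h]
    _ ≤ ∑ k ∈ s.filter (fun k => φ ((2 : ℝ) ^ (-k) * t) ≠ 0), M :=
        Finset.sum_le_sum fun k _ => hM _
    _ ≤ 3 * M := by
        rw [Finset.sum_const, nsmul_eq_mul]
        have : ((s.filter (fun k => φ ((2 : ℝ) ^ (-k) * t) ≠ 0)).card : ℝ) ≤ 3 := by exact_mod_cast key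
        nlinarith

lemma sq_summable {φ : ℝ → ℝ} (hφ : Continuous φ)
    (hφsupp : Function.support φ ⊆ {t : ℝ | 1/2 ≤ |t| ∧ |t| ≤ 2})
    {M : ℝ} (hM : ∀ t, |φ t| ≤ M) {G : ℝ × ℝ → ℂ} (hG : Integrable G) (J : ℤ → ℤ) (x : ℝ × ℝ) :
    Summable (fun k : ℤ => ‖ftInv (sy φ G (J k) k) x‖ ^ 2) := by
  have hM0 : 0 ≤ M := (abs_nonneg _).trans (hM 0)
  have h1 : Summable (fun k : ℤ => ∫ ξ, ‖sy φ G (J k) k ξ‖) := by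
    refine summable_of_sum_le (c := ∫ ξ, 3 * M * M * ‖G ξ‖)
      (fun k => integral_nonneg fun ξ => norm_nonneg _) fun s => ?_
    rw [← integral_finsetSum _ fun k _ => (sy_int hφ hM hG _ _).norm]
    refine integral_mono (integrable_finsetSum _ fun k _ => (sy_int hφ hM hG _ _).norm)
      (hG.norm.const_mul _) fun ξ => ?_
    calc ∑ k ∈ s, ‖sy φ G (J k) k ξ‖
        ≤ ∑ k ∈ s, |φ ((2 : ℝ) ^ (-k) * ξ.2)| * (M * ‖G ξ‖) := by
          refine Finset.sum_le_sum fun k _ => ?_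
          unfold sy
          rw [norm_mul, norm_mul, Complex.norm_real, Complex.norm_real, Real.norm_eq_abs,
            Real.norm_eq_abs]
          have := hM ((2 : ℝ) ^ (-(J k)) * ξ.1)
          nlinarith [mul_le_mul_of_nonneg_right this
            (mul_nonneg (abs_nonneg (φ ((2 : ℝ) ^ (-k) * ξ.2))) (norm_nonneg (G ξ)))]
      _ = (∑ k ∈ s, |φ ((2 : ℝ) ^ (-k) * ξ.2)|) * (M * ‖G ξ‖) := by rw [Finset.sum_mul]
      _ ≤ 3 * M * (M * ‖G ξ‖) :=
          mul_le_mul_of_nonneg_right (overlap hφsupp hM s ξ.2) (by positivity)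
      _ = 3 * M * M * ‖G ξ‖ := by ring
  have h2 : Summable (fun k : ℤ => ‖ftInv (sy φ G (J k) k) x‖) :=
    Summable.of_nonneg_of_le (fun k => norm_nonneg _) (fun k => ftInv_bdd _ _) h1
  set A := ∑' k : ℤ, ‖ftInv (sy φ G (J k) k) x‖
  refine Summable.of_nonneg_of_le (fun k => by positivity) (fun k => ?_) (h2.mul_left A)
  rw [sq]
  exact mul_le_mul_of_nonneg_right (h2.le_tsum k fun _ _ => norm_nonneg _) (norm_nonneg _)

lemma ss_of {γ : ℝ → ℝ} {c : ℝ} {D : ℕ} (h : GF γ c D) {φ φt : ℝ → ℝ}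
    (hφ : Measurable φ) (hφt : Measurable φt) {M M' : ℝ} (hM : ∀ t, |φ t| ≤ M)
    (hM' : ∀ t, |φt t| ≤ M')
    (hφsupp : Function.support φ ⊆ {t : ℝ | 1/2 ≤ |t| ∧ |t| ≤ 2})
    {K cγ : ℝ} (hcγ : 0 < cγ) (hK : 1 ≤ K) (hK1 : 2 * (M * M') ≤ K) (hK2 : 2 ^ D ≤ K)
    (hK3 : 2 * 2 ^ D / c ≤ K) (hK4 : 1 / cγ ≤ K) (v m : ℤ) {b : ℝ} (hb : 0 < b)
    (hB : cγ * b ≤ 2 ^ v * γ (2 ^ (-m))) :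
    SS K (2 ^ (-m)) (2 ^ v * γ (2 ^ (-m))) b (fun t => φ (2 ^ m * t) * φt t / t)
      (fun t => 2 ^ v * γ t) := by
  have hc := h.hc
  set τ : ℝ := 2 ^ (-m) with hτd
  have hτ : 0 < τ := by positivity
  have hγτ := h.pos τ hτ
  have h2v : (0 : ℝ) < 2 ^ v := by positivity
  have hmτ : (2 : ℝ) ^ m * τ = 1 := by
    rw [hτd, ← zpow_add₀ (by norm_num)]; simp
  have hsup : ∀ t, φ (2 ^ m * t) * φt t / t ≠ 0 → τ / 2 ≤ |t| ∧ |t| ≤ 2 * τ := by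
    intro t ht
    have h0 : φ (2 ^ m * t) ≠ 0 := by
      intro h0; apply ht; rw [h0]; simp
    have h1 := hφsupp h0
    have h1a := h1.1
    have h1b := h1.2
    rw [abs_mul, abs_of_pos (by positivity)] at h1a h1b
    have e : |t| = τ * (2 ^ m * |t|) := by rw [← mul_assoc, mul_comm τ, hmτ, one_mul]
    constructor <;> rw [e] <;> nlinarith
  refine ⟨hK, hτ, by positivity, hb, by fun_prop, h.meas.const_mul _, fun t ht => (hsup t ht).2,
    fun t => ?_, fun t ht => ?_, fun t s ht hs => ?_, ?_⟩
  · by_cases ht : φ (2 ^ m * t) * φt t / t = 0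
    · rw [ht, abs_zero]; positivity
    · have h1 := (hsup t ht).1
      rw [abs_div, abs_mul]
      have h2 : |φ (2 ^ m * t)| * |φt t| ≤ M * M' :=
        mul_le_mul (hM _) (hM' _) (abs_nonneg _) ((abs_nonneg _).trans (hM 0))
      rw [div_le_div_iff₀ (by linarith) hτ]
      have : 0 ≤ M * M' := (by positivity : 0 ≤ |φ (2 ^ m * t)| * |φt t|).trans h2
      nlinarith
  · rw [abs_mul, abs_of_pos h2v, (h.par t t).1]
    have h1 := hsup t ht
    have h2 := h.mono |t| (2 * τ) (by linarith) h1.2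
    have h3 := h.grow τ (2 * τ) hτ (by linarith)
    have e : 2 * τ / τ = 2 := by field_simp
    rw [e] at h3
    calc 2 ^ v * γ |t| ≤ 2 ^ v * (2 ^ D * γ τ) := by gcongr; linarith
      _ = 2 ^ D * (2 ^ v * γ τ) := by ring
      _ ≤ K * (2 ^ v * γ τ) := by gcongr
  · have h1 := hsup t ht
    have h2 := hsup s hs
    have h3 := h.sep τ |s| |t| hτ ⟨h2.1, h2.2⟩ ⟨h1.1, h1.2⟩
    have h4 := (h.par t s).2
    rw [← mul_sub, abs_mul, abs_of_pos h2v]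
    have h5 : 1 / K ≤ c / 2 / 2 ^ D := by
      rw [div_le_iff₀ hc] at hK3
      rw [div_div, div_le_div_iff₀ (by linarith) (by positivity)]
      linarith
    calc 2 ^ v * γ τ / (K * τ) * |(|t| - |s|)| = 2 ^ v * ((1 / K) * (γ τ / τ) * |(|t| - |s|)|) := by
          field_simp
      _ ≤ 2 ^ v * ((c / 2 / 2 ^ D) * (γ τ / τ) * |(|t| - |s|)|) := by gcongr
      _ ≤ 2 ^ v * |γ t - γ s| := by gcongr; linarith
  · rw [div_le_iff₀ hcγ] at hK4
    have : 0 ≤ 2 ^ v * γ τ := by positivity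
    nlinarith [mul_le_mul_of_nonneg_left hB (by linarith : (0 : ℝ) ≤ K)]

lemma scales {γ : ℝ → ℝ} {c : ℝ} {D : ℕ} (h : GF γ c D)
    {cγ Cγ : ℝ} (hcγ : 0 < cγ) (hcC : cγ ≤ Cγ) (l₀ : ℤ → ℤ → ℤ)
    (hl₀ : ∀ w k : ℤ, cγ ≤ (2 : ℝ) ^ (w + k) * γ ((2 : ℝ) ^ (-(l₀ w k))) ∧
      (2 : ℝ) ^ (w + k) * γ ((2 : ℝ) ^ (-(l₀ w k))) ≤ Cγ)
    (k₁ : ℤ → ℤ → ℤ → ℤ)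
    (hk₁ : ∀ w k m : ℤ,
      cγ * ((2 : ℝ) ^ w * (2 : ℝ) ^ k * deriv γ ((2 : ℝ) ^ (-m))) ≤
          (2 : ℝ) ^ (k₁ w k m) ∧
        (2 : ℝ) ^ (k₁ w k m) ≤
          Cγ * ((2 : ℝ) ^ w * (2 : ℝ) ^ k * deriv γ ((2 : ℝ) ^ (-m))))
    {v : ℤ} {l : ℕ} (k : ℤ) :
    let τ : ℝ := 2 ^ (-(l₀ v k - l))
    let a : ℝ := 2 ^ (-(k₁ v k (l₀ v k - l)))
    let b : ℝ := 2 ^ (-k)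
    let B : ℝ := 2 ^ v * γ τ
    τ = 2 ^ l * 2 ^ (-(l₀ v k)) ∧ cγ * b ≤ B ∧ B ≤ Cγ * (2 ^ l) ^ D * b ∧
      a ≤ 1 / (cγ ^ 2 * c) * τ ∧ τ ≤ Cγ ^ 2 * D * (2 ^ l) ^ D * a := by
  intro τ a b B
  have hc := h.hc
  have hτe : τ = 2 ^ l * 2 ^ (-(l₀ v k)) := by
    have : τ = 2 ^ ((l : ℤ) + -(l₀ v k)) := by
      show (2 : ℝ) ^ (-(l₀ v k - l)) = _
      congr 1; ring
    rw [this, zpow_add₀ (by norm_num), zpow_natCast]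
  have hτ : 0 < τ := by positivity
  set τ0 : ℝ := 2 ^ (-(l₀ v k)) with hτ0d
  have hτ0 : 0 < τ0 := by positivity
  have h1l : (1 : ℝ) ≤ 2 ^ l := one_le_pow₀ (by norm_num)
  have hle : τ0 ≤ τ := by rw [hτe]; nlinarith
  have hb : 0 < b := by positivity
  have hbk : (2 : ℝ) ^ k * b = 1 := by
    show (2 : ℝ) ^ k * 2 ^ (-k) = 1
    rw [← zpow_add₀ (by norm_num)]; simp
  have hz : (2 : ℝ) ^ (v + k) = 2 ^ v * 2 ^ k := zpow_add₀ (by norm_num) _ _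
  obtain ⟨p1, p2⟩ := hl₀ v k
  rw [hz] at p1 p2
  obtain ⟨r1, r2⟩ := hk₁ v k (l₀ v k - l)
  have h2v : (0 : ℝ) < 2 ^ v := by positivity
  have h2k : (0 : ℝ) < 2 ^ k := by positivity
  have hγτ := h.pos τ hτ
  have hγτ0 := h.pos τ0 hτ0
  have hm := h.mono τ0 τ hτ0 hle
  have hg := h.grow τ0 τ hτ0 hle
  have e1 : τ / τ0 = 2 ^ l := by rw [hτe]; field_simp
  rw [e1] at hg
  have hlo := h.lo τ hτ
  have hhi := h.hi τ hτ
  have hBpos : 0 < B := by positivity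
  have hC : 0 < Cγ := hcγ.trans_le hcC
  have q1 : cγ * b ≤ B := by
    calc cγ * b ≤ (2 ^ v * 2 ^ k * γ τ0) * b := by gcongr
      _ = (2 ^ k * b) * (2 ^ v * γ τ0) := by ring
      _ ≤ B := by rw [hbk, one_mul]; show _ ≤ 2 ^ v * γ τ; gcongr
  have q2 : B ≤ Cγ * (2 ^ l) ^ D * b := by
    calc B = (2 ^ k * b) * (2 ^ v * γ τ) := by rw [hbk, one_mul]
      _ ≤ (2 ^ k * b) * (2 ^ v * ((2 ^ l) ^ D * γ τ0)) := by gcongr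
      _ = (2 ^ v * 2 ^ k * γ τ0) * ((2 ^ l) ^ D * b) := by ring
      _ ≤ Cγ * ((2 ^ l) ^ D * b) := by gcongr
      _ = _ := by ring
  have ha : 0 < a := by positivity
  have hak : (2 : ℝ) ^ (k₁ v k (l₀ v k - l)) * a = 1 := by
    show (2 : ℝ) ^ (k₁ v k (l₀ v k - l)) * 2 ^ (-(k₁ v k (l₀ v k - l))) = 1
    rw [← zpow_add₀ (by norm_num)]; simp
  set X : ℝ := 2 ^ (k₁ v k (l₀ v k - l)) with hX
  have hX0 : 0 < X := by positivity
  change cγ * (2 ^ v * 2 ^ k * deriv γ τ) ≤ X at r1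
  change X ≤ Cγ * (2 ^ v * 2 ^ k * deriv γ τ) at r2
  refine ⟨hτe, q1, q2, ?_, ?_⟩
  · have s1 : cγ ^ 2 * c ≤ X * τ := by
      calc cγ ^ 2 * c = cγ * c * (cγ * b) * 2 ^ k := by
            calc cγ ^ 2 * c = cγ ^ 2 * c * (2 ^ k * b) := by rw [hbk, mul_one]
              _ = _ := by ring
        _ ≤ cγ * c * (2 ^ v * γ τ) * 2 ^ k := by gcongr
        _ = cγ * (2 ^ v * 2 ^ k) * (c * γ τ) := by ring
        _ ≤ cγ * (2 ^ v * 2 ^ k) * (τ * deriv γ τ) := by gcongr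
        _ = cγ * (2 ^ v * 2 ^ k * deriv γ τ) * τ := by ring
        _ ≤ X * τ := by gcongr
    rw [one_div, inv_mul_eq_div, le_div_iff₀ (by positivity)]
    calc a * (cγ ^ 2 * c) ≤ a * (X * τ) := by gcongr
      _ = (X * a) * τ := by ring
      _ = τ := by rw [hak, one_mul]
  · calc τ = (X * a) * τ := by rw [hak, one_mul]
      _ = X * τ * a := by ring
      _ ≤ (Cγ * (2 ^ v * 2 ^ k * deriv γ τ)) * τ * a := by gcongr
      _ = Cγ * 2 ^ v * 2 ^ k * (τ * deriv γ τ) * a := by ring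
      _ ≤ Cγ * 2 ^ v * 2 ^ k * (D * γ τ) * a := by gcongr
      _ = Cγ * D * 2 ^ k * B * a := by show _ = Cγ * D * 2 ^ k * (2 ^ v * γ τ) * a; ring
      _ ≤ Cγ * D * 2 ^ k * (Cγ * (2 ^ l) ^ D * b) * a := by gcongr
      _ = Cγ ^ 2 * D * (2 ^ l) ^ D * a * (2 ^ k * b) := by ring
      _ = _ := by rw [hbk, mul_one]

lemma choose_n (Y : ℝ) (E : ℕ) : ∃ n0 : ℕ, 1 ≤ n0 ∧ ∀ l : ℕ,
    Y * (2 ^ l) ^ E < 2 ^ (n0 * (l + 1)) := by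
  obtain ⟨N, hN⟩ := pow_unbounded_of_one_lt Y (by norm_num : (1 : ℝ) < 2)
  refine ⟨N + E + 1, by omega, fun l => ?_⟩
  calc Y * ((2 : ℝ) ^ l) ^ E < 2 ^ N * (2 ^ l) ^ E := by gcongr
    _ = 2 ^ (N + l * E) := by rw [← pow_mul, ← pow_add]
    _ ≤ 2 ^ ((N + E + 1) * (l + 1)) := by
        apply pow_le_pow_right₀ (by norm_num)
        nlinarith [Nat.zero_le (N * l), Nat.zero_le l]

lemma sparse {γ : ℝ → ℝ} {c : ℝ} {D : ℕ} (h : GF γ c D)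
    {cγ Cγ : ℝ} (hcγ : 0 < cγ) (hcC : cγ ≤ Cγ) (l₀ : ℤ → ℤ → ℤ)
    (hl₀ : ∀ w k : ℤ, cγ ≤ (2 : ℝ) ^ (w + k) * γ ((2 : ℝ) ^ (-(l₀ w k))) ∧
      (2 : ℝ) ^ (w + k) * γ ((2 : ℝ) ^ (-(l₀ w k))) ≤ Cγ)
    (k₁ : ℤ → ℤ → ℤ → ℤ)
    (hk₁ : ∀ w k m : ℤ,
      cγ * ((2 : ℝ) ^ w * (2 : ℝ) ^ k * deriv γ ((2 : ℝ) ^ (-m))) ≤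
          (2 : ℝ) ^ (k₁ w k m) ∧
        (2 : ℝ) ^ (k₁ w k m) ≤
          Cγ * ((2 : ℝ) ^ w * (2 : ℝ) ^ k * deriv γ ((2 : ℝ) ^ (-m)))) :
    ∃ n0 : ℕ, 1 ≤ n0 ∧ ∀ (v : ℤ) (l : ℕ) (i j : ℤ), ((n0 * (l + 1) : ℕ) : ℤ) ≤ i - j →
      (2 : ℝ) ^ (-(l₀ v i - l)) ≤ 2 ^ (-(k₁ v j (l₀ v j - l))) ∧
      (2 : ℝ) ^ v * γ (2 ^ (-(l₀ v i - l))) ≤ 2 ^ (-j) := by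
  have hC : 0 < Cγ := hcγ.trans_le hcC
  set R0 : ℝ := max 1 (Cγ ^ 2 * D)
  have hR0 : 1 ≤ R0 := le_max_left _ _
  obtain ⟨n1, hn1, H1⟩ := choose_n Cγ D
  obtain ⟨n2, hn2, H2⟩ := choose_n (Cγ / cγ * R0 ^ D) (D * D)
  refine ⟨n1 + n2, by omega, fun v l i j hij => ?_⟩
  have h1l : (1 : ℝ) ≤ 2 ^ l := one_le_pow₀ (by norm_num)
  obtain ⟨e1, -, s2, -, -⟩ := scales h hcγ hcC l₀ hl₀ k₁ hk₁ (v := v) (l := l) i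
  obtain ⟨f1, -, -, -, t2⟩ := scales h hcγ hcC l₀ hl₀ k₁ hk₁ (v := v) (l := l) j
  have hbig : ∀ n : ℕ, n ≤ n1 + n2 → (2 : ℝ) ^ (n * (l + 1)) ≤ 2 ^ (i - j) := by
    intro n hn
    rw [← zpow_natCast]
    apply zpow_le_zpow_right₀ (by norm_num)
    refine le_trans ?_ hij
    exact_mod_cast Nat.mul_le_mul_right _ hn
  have w1 : Cγ * (2 ^ l) ^ D ≤ 2 ^ (i - j) := (H1 l).le.trans (hbig n1 (by omega))
  have w2 : Cγ / cγ * R0 ^ D * (2 ^ l) ^ (D * D) < 2 ^ (i - j) :=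
    (H2 l).trans_le (hbig n2 (by omega))
  have ez : (2 : ℝ) ^ (i - j) * 2 ^ (-i) = 2 ^ (-j) := by
    rw [← zpow_add₀ (by norm_num)]; congr 1; ring
  have ez2 : (2 : ℝ) ^ (v + i) = 2 ^ (i - j) * 2 ^ (v + j) := by
    rw [← zpow_add₀ (by norm_num)]; congr 1; ring
  constructor
  · set a : ℝ := 2 ^ (-(k₁ v j (l₀ v j - l)))
    have ha : 0 < a := by positivity
    rw [e1]
    rw [f1] at t2
    set τi : ℝ := 2 ^ (-(l₀ v i))
    set τj : ℝ := 2 ^ (-(l₀ v j))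
    have hτi : 0 < τi := by positivity
    have hτj : 0 < τj := by positivity
    set R : ℝ := R0 * (2 ^ l) ^ D with hR
    have hR1 : 1 ≤ R := by
      have : (1 : ℝ) ≤ (2 ^ l) ^ D := one_le_pow₀ h1l
      nlinarith
    have key : R * τi ≤ τj := by
      by_contra hc
      push Not at hc
      have g1 := h.mono τj (R * τi) hτj hc.le
      have g2 := h.grow τi (R * τi) hτi (by nlinarith)
      have e : R * τi / τi = R := by field_simp
      rw [e] at g2
      have p1 := (hl₀ v j).1
      have p2 := (hl₀ v i).2
      change cγ ≤ 2 ^ (v + j) * γ τj at p1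
      change 2 ^ (v + i) * γ τi ≤ Cγ at p2
      rw [ez2] at p2
      have hi := h.pos τi hτi
      have hz : (0 : ℝ) < 2 ^ (v + j) := by positivity
      have c1 : cγ ≤ R ^ D * (2 ^ (v + j) * γ τi) := by
        calc cγ ≤ 2 ^ (v + j) * γ τj := p1
          _ ≤ 2 ^ (v + j) * (R ^ D * γ τi) := by gcongr; linarith
          _ = _ := by ring
      have c2' : cγ * 2 ^ (i - j) ≤ R ^ D * Cγ := by
        calc cγ * 2 ^ (i - j) ≤ R ^ D * (2 ^ (v + j) * γ τi) * 2 ^ (i - j) := by gcongr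
          _ = R ^ D * (2 ^ (i - j) * 2 ^ (v + j) * γ τi) := by ring
          _ ≤ R ^ D * Cγ := by gcongr
      have c3 : Cγ / cγ * R0 ^ D * (2 ^ l) ^ (D * D) = Cγ / cγ * R ^ D := by
        rw [hR, mul_pow, ← pow_mul _ D D]; ring
      rw [c3] at w2
      have c4 : cγ * (Cγ / cγ * R ^ D) = R ^ D * Cγ := by field_simp
      have := mul_lt_mul_of_pos_left w2 hcγ
      linarith
    have t3 : 2 ^ l * τj ≤ R * a := by
      refine t2.trans ?_
      rw [hR]
      have : Cγ ^ 2 * D ≤ R0 := le_max_right _ _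
      gcongr
    have t4 : R * (2 ^ l * τi) ≤ R * a := by
      calc R * (2 ^ l * τi) = 2 ^ l * (R * τi) := by ring
        _ ≤ 2 ^ l * τj := by gcongr
        _ ≤ _ := t3
    exact le_of_mul_le_mul_left t4 (by linarith)
  · refine s2.trans ?_
    rw [← ez]
    gcongr

lemma log_bd {Cγ : ℝ} (hC : 0 < Cγ) (D : ℕ) : ∃ Λ0 : ℝ, 1 ≤ Λ0 ∧ ∀ (l : ℕ) (r : ℝ), 0 ≤ r →
    r ≤ Cγ * (2 ^ l) ^ D → Real.log (1 + 4 * r) ≤ Λ0 * (l + 1) := by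
  have h0 : 0 ≤ Real.log (1 + 4 * Cγ) := Real.log_nonneg (by linarith)
  refine ⟨1 + Real.log (1 + 4 * Cγ) + D, by nlinarith [(Nat.cast_nonneg D : (0 : ℝ) ≤ D)], fun l r hr h => ?_⟩
  have h1 : (1 : ℝ) ≤ (2 ^ l) ^ D := one_le_pow₀ (one_le_pow₀ (by norm_num))
  have h2 : Real.log (1 + 4 * r) ≤ Real.log ((1 + 4 * Cγ) * (2 ^ l) ^ D) :=
    Real.log_le_log (by linarith) (by nlinarith)
  rw [Real.log_mul (by linarith) (by positivity), ← pow_mul, Real.log_pow] at h2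
  have h3 : Real.log 2 ≤ 1 := by linarith [Real.log_two_lt_d9]
  have h4 : ((l * D : ℕ) : ℝ) * Real.log 2 ≤ l * D := by
    push_cast
    have : (0 : ℝ) ≤ l * D := by positivity
    nlinarith
  have h5 : 0 ≤ Real.log (1 + 4 * Cγ) * l := by positivity
  have h6 : (0 : ℝ) ≤ D := by positivity
  have h7 : (0 : ℝ) ≤ l := by positivity
  nlinarith

lemma Aop_eq (γ φ φt : ℝ → ℝ) (v m : ℤ) (u : ℝ) (g : ℝ × ℝ → ℂ) (x : ℝ × ℝ) :
    Aop γ φ φt ((2 : ℝ) ^ v * u) m g x =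
      AA (fun t => φ (2 ^ m * t) * φt t / t) (fun t => 2 ^ v * γ t) u g x := by
  unfold Aop AA
  congr 1
  funext t
  have : (2 : ℝ) ^ v * u * γ t = u * (2 ^ v * γ t) := by ring
  rw [this]
  push_cast
  ring

lemma sqrt_enorm_rpow {r p : ℝ} (hr : 0 ≤ r) (hp : 0 ≤ p) :
    ‖Real.sqrt r‖ₑ ^ p = (ENNReal.ofReal r) ^ (p / 2) := by
  rw [Real.enorm_eq_ofReal (Real.sqrt_nonneg _), Real.sqrt_eq_rpow,
    ← ENNReal.ofReal_rpow_of_nonneg hr (by norm_num), ← ENNReal.rpow_mul]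
  congr 1
  ring

lemma ofReal_sq_norm (z : ℂ) : ENNReal.ofReal (‖z‖ ^ 2) = ‖z‖ₑ ^ 2 := by
  rw [ENNReal.ofReal_pow (norm_nonneg _), ofReal_norm]

lemma lhs_pt {ι : Type*} (α θ : ι → ℝ → ℝ) (g : ι → ℝ × ℝ → ℂ) (x : ℝ × ℝ) {p : ℝ} (hp : 0 < p) :
    ‖⨆ u : Set.Icc (1 : ℝ) 2, Real.sqrt (∑' k, ‖AA (α k) (θ k) u (g k) x‖ ^ 2)‖ₑ ^ p ≤
      (∑' k, XX (α k) (θ k) (g k) x) ^ (p / 2) := by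
  by_cases ht : (∑' k, XX (α k) (θ k) (g k) x) = ∞
  · rw [ht, ENNReal.top_rpow_of_pos (by linarith)]
    exact le_top
  set T := (∑' k, XX (α k) (θ k) (g k) x).toReal with hT
  have hT0 : 0 ≤ T := ENNReal.toReal_nonneg
  have h1 : ∀ u : Set.Icc (1 : ℝ) 2, (∑' k, ‖AA (α k) (θ k) u (g k) x‖ ^ 2) ≤ T := by
    intro u
    by_cases hs : Summable (fun k => ‖AA (α k) (θ k) u (g k) x‖ ^ 2)
    · rw [hT, ← ENNReal.ofReal_le_iff_le_toReal ht,
        ENNReal.ofReal_tsum_of_nonneg (fun k => by positivity) hs]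
      refine ENNReal.tsum_le_tsum fun k => ?_
      rw [ofReal_sq_norm]
      exact le_iSup₂ (f := fun (u : ℝ) (_ : u ∈ Icc (1 : ℝ) 2) =>
        ‖AA (α k) (θ k) u (g k) x‖ₑ ^ 2) u.1 u.2
    · rw [tsum_eq_zero_of_not_summable hs]; exact hT0
  have h2 : (⨆ u : Set.Icc (1 : ℝ) 2, Real.sqrt (∑' k, ‖AA (α k) (θ k) u (g k) x‖ ^ 2)) ≤
      Real.sqrt T := Real.iSup_le (fun u => Real.sqrt_le_sqrt (h1 u)) (Real.sqrt_nonneg _)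
  have h3 : 0 ≤ (⨆ u : Set.Icc (1 : ℝ) 2, Real.sqrt (∑' k, ‖AA (α k) (θ k) u (g k) x‖ ^ 2)) :=
    Real.iSup_nonneg fun u => Real.sqrt_nonneg _
  calc _ ≤ ‖Real.sqrt T‖ₑ ^ p := by
        refine ENNReal.rpow_le_rpow ?_ hp.le
        rw [Real.enorm_eq_ofReal h3, Real.enorm_eq_ofReal (Real.sqrt_nonneg _)]
        exact ENNReal.ofReal_le_ofReal h2
    _ = _ := by rw [sqrt_enorm_rpow hT0 hp.le, hT, ENNReal.ofReal_toReal ht]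

lemma rhs_pt {ι : Type*} (g : ι → ℂ) (hs : Summable fun k => ‖g k‖ ^ 2) {p : ℝ} (hp : 0 < p) :
    ‖Real.sqrt (∑' k, ‖g k‖ ^ 2)‖ₑ ^ p = (∑' k, ‖g k‖ₑ ^ 2) ^ (p / 2) := by
  rw [sqrt_enorm_rpow (tsum_nonneg fun k => by positivity) hp.le,
    ENNReal.ofReal_tsum_of_nonneg (fun k => by positivity) hs]
  simp_rw [ofReal_sq_norm]

lemma const_bd {W : ℝ≥0∞} (hW : W ≠ ∞) (l : ℕ) :
    (W * ((l : ℝ≥0∞) + 1) ^ 2) ^ (1 / 2 : ℝ) ≤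
      ENNReal.ofReal ((W.toReal + 1) * ((l : ℝ) + 1) ^ 5) := by
  set C := W.toReal + 1 with hC
  have hC1 : 1 ≤ C := by have : 0 ≤ W.toReal := ENNReal.toReal_nonneg; linarith
  have h1 : W * ((l : ℝ≥0∞) + 1) ^ 2 ≤ ENNReal.ofReal ((C * ((l : ℝ) + 1) ^ 5) ^ 2) := by
    have e : W * ((l : ℝ≥0∞) + 1) ^ 2 = ENNReal.ofReal (W.toReal * ((l : ℝ) + 1) ^ 2) := by
      rw [ENNReal.ofReal_mul ENNReal.toReal_nonneg, ENNReal.ofReal_toReal hW,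
        ENNReal.ofReal_pow (by positivity), ENNReal.ofReal_add (by positivity) (by norm_num)]
      simp
    rw [e]
    apply ENNReal.ofReal_le_ofReal
    have hl : (1 : ℝ) ≤ (l : ℝ) + 1 := by
      have : (0 : ℝ) ≤ l := by positivity
      linarith
    calc W.toReal * ((l : ℝ) + 1) ^ 2 ≤ C ^ 2 * ((l : ℝ) + 1) ^ 10 := by
          apply mul_le_mul
          · nlinarith
          · exact pow_le_pow_right₀ hl (by norm_num)
          · positivity
          · positivity
      _ = _ := by ring
  refine (ENNReal.rpow_le_rpow h1 (by norm_num)).trans (le_of_eq ?_)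
  rw [ENNReal.ofReal_rpow_of_nonneg (by positivity) (by norm_num), ← Real.sqrt_eq_rpow,
    Real.sqrt_sq (by positivity)]

lemma bdd_of_cs {φ : ℝ → ℝ} (h : Continuous φ) (hc : HasCompactSupport φ) :
    ∃ M, ∀ t, |φ t| ≤ M := by
  obtain ⟨M, hM⟩ := hc.exists_bound_of_continuous h
  exact ⟨M, hM⟩

theorem vector_valued_maximal_estimate
    (γ : ℝ → ℝ)
    (hγ0 : γ 0 = 0)
    (hsmooth : ContDiffOn ℝ (⊤ : ℕ∞) γ (Set.Icc (-1 : ℝ) 1))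
    (hparity : (∀ t, γ (-t) = γ t) ∨ (∀ t, γ (-t) = -γ t))
    (hmono : StrictMonoOn γ (Set.Icc (0 : ℝ) 1))
    (hyp1 : ∃ c > (0 : ℝ), ∀ t ∈ Set.Ioc (0 : ℝ) 1,
      c ≤ |deriv (fun s => deriv γ s / deriv (deriv γ) s) t|)
    (hyp2 : ∃ c > (0 : ℝ), ∀ j ∈ ({1, 2} : Set ℕ), ∀ t ∈ Set.Ioc (0 : ℝ) 1,
      c ≤ |t ^ j * iteratedDeriv j γ t / γ t|)
    (hyp3 : ∃ C : ℝ, ∀ j : ℕ, 1 ≤ j → j ≤ 1000 → ∀ t ∈ Set.Ioc (0 : ℝ) 1,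
      |t ^ j * iteratedDeriv j γ t / γ t| ≤ C)
    (hγ1 : γ 1 = 1)
    (hconv : ∀ t ∈ Set.Ioc (0 : ℝ) 1, 0 < iteratedDeriv 2 γ t)
    (hext : ∀ t : ℝ, 1 ≤ t → γ t = (γ t⁻¹)⁻¹)
    (hcont : ContinuousOn γ (Set.Ici (0 : ℝ)))
    (hmono2 : StrictMonoOn γ (Set.Ici (0 : ℝ)))
    (hsurj : γ '' Set.Ici (0 : ℝ) = Set.Ici (0 : ℝ))
    (φ : ℝ → ℝ) (hφs : ContDiff ℝ (⊤ : ℕ∞) φ) (hφc : HasCompactSupport φ)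
    (hφsupp : Function.support φ ⊆ {t : ℝ | 1/2 ≤ |t| ∧ |t| ≤ 2})
    (hφsum : ∀ t : ℝ, t ≠ 0 → HasSum (fun k : ℤ => φ ((2 : ℝ) ^ (-k) * t)) 1)
    (ε₀ : ℝ) (hε₀ : 0 < ε₀)
    (φt : ℝ → ℝ) (hφts : ContDiff ℝ (⊤ : ℕ∞) φt) (hφtnn : ∀ t, 0 ≤ φt t)
    (hφtsupp : Function.support φt ⊆ Set.Ioo (-ε₀) ε₀)
    (hφt1 : ∀ t ∈ Set.Icc (-(ε₀/2)) (ε₀/2), φt t = 1)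
    (cγ Cγ : ℝ) (hcγ : 0 < cγ) (hcC : cγ ≤ Cγ)
    (l₀ : ℤ → ℤ → ℤ)
    (hl₀ : ∀ w k : ℤ, cγ ≤ (2 : ℝ) ^ (w + k) * γ ((2 : ℝ) ^ (-(l₀ w k))) ∧
      (2 : ℝ) ^ (w + k) * γ ((2 : ℝ) ^ (-(l₀ w k))) ≤ Cγ)
    (k₁ : ℤ → ℤ → ℤ → ℤ)
    (hk₁ : ∀ w k m : ℤ,
      cγ * ((2 : ℝ) ^ w * (2 : ℝ) ^ k * deriv γ ((2 : ℝ) ^ (-m))) ≤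
          (2 : ℝ) ^ (k₁ w k m) ∧
        (2 : ℝ) ^ (k₁ w k m) ≤
          Cγ * ((2 : ℝ) ^ w * (2 : ℝ) ^ k * deriv γ ((2 : ℝ) ^ (-m))))
    (p : ℝ) (hp : 2 < p) :
    ∃ C : ℝ, 0 < C ∧ ∀ (v : ℤ) (l : ℕ) (f : SchwartzMap (ℝ × ℝ) ℂ),
      eLpNorm (fun x : ℝ × ℝ =>
          ⨆ u : Set.Icc (1 : ℝ) 2, Real.sqrt
            (∑' k : {k : ℤ // (1 : ℝ) ≤ (2 : ℝ) ^ (v + k) * γ (ε₀ / 2)},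
              ‖Aop γ φ φt ((2 : ℝ) ^ v * ↑u) (l₀ v ↑k - (l : ℤ))
                  (P1 φ (k₁ v ↑k (l₀ v ↑k - (l : ℤ))) (P2 φ ↑k (⇑f))) x‖ ^ 2))
        (ENNReal.ofReal p) volume ≤
      ENNReal.ofReal (C * ((l : ℝ) + 1) ^ 5) *
        eLpNorm (fun x : ℝ × ℝ => Real.sqrt
            (∑' k : {k : ℤ // (1 : ℝ) ≤ (2 : ℝ) ^ (v + k) * γ (ε₀ / 2)},
              ‖P1 φ (k₁ v ↑k (l₀ v ↑k - (l : ℤ))) (P2 φ ↑k (⇑f)) x‖ ^ 2))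
          (ENNReal.ofReal p) volume := by
  obtain ⟨c, D, h⟩ := gfacts hγ0 hparity hyp2 hyp3 hext hcont hmono2
  have hc := h.hc
  have hC : 0 < Cγ := hcγ.trans_le hcC
  have hφcont := hφs.continuous
  have hφtcont := hφts.continuous
  obtain ⟨M, hM⟩ := bdd_of_cs hφcont hφc
  have hφtc : HasCompactSupport φt := by
    refine HasCompactSupport.intro (isCompact_Icc (a := -ε₀) (b := ε₀)) fun t ht => ?_
    by_contra hn
    exact ht (Ioo_subset_Icc_self (hφtsupp hn))
  obtain ⟨M', hM'⟩ := bdd_of_cs hφtcont hφtc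
  have hMM : 0 ≤ M * M' :=
    mul_nonneg ((abs_nonneg _).trans (hM 0)) ((abs_nonneg _).trans (hM' 0))
  set K : ℝ := 1 + 2 * (M * M') + 2 ^ D + 2 * 2 ^ D / c + 1 / cγ + 1 / (cγ ^ 2 * c) with hKd
  have z1 : (0 : ℝ) ≤ 2 ^ D := by positivity
  have z2 : (0 : ℝ) ≤ 2 * 2 ^ D / c := by positivity
  have z3 : (0 : ℝ) ≤ 1 / cγ := by positivity
  have z4 : (0 : ℝ) ≤ 1 / (cγ ^ 2 * c) := by positivity
  obtain ⟨κ, N0, Cκ, hdec, hrep, C1, hC1, main⟩ :=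
    vector_inf (K := K) (q := p / 2) (by linarith) (by linarith)
  obtain ⟨n0, hn0, hsparse⟩ := sparse h hcγ hcC l₀ hl₀ k₁ hk₁
  obtain ⟨Λ0, hΛ0, hlog⟩ := log_bd hC D
  set W : ℝ≥0∞ := C1 * ENNReal.ofReal Λ0 * n0 with hW
  have hWt : W ≠ ∞ := by
    rw [hW]
    exact ENNReal.mul_ne_top (ENNReal.mul_ne_top hC1 ENNReal.ofReal_ne_top)
      (ENNReal.natCast_ne_top _)
  refine ⟨W.toReal + 1, by positivity, fun v l f => ?_⟩
  obtain ⟨G, hG⟩ := PP_eq φ hφs hφc f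
  have hGi : Integrable (⇑G) := G.integrable
  set J : ℤ → ℤ := fun k => k₁ v k (l₀ v k - (l : ℤ)) with hJ
  set g : ℤ → ℝ × ℝ → ℂ := fun k => ftInv (sy φ G (J k) k) with hg
  have hgk : ∀ k : ℤ, P1 φ (k₁ v k (l₀ v k - (l : ℤ))) (P2 φ k f) = g k := fun k => hG _ _
  set α : ℤ → ℝ → ℝ := fun k t => φ (2 ^ (l₀ v k - (l : ℤ)) * t) * φt t / t with hα
  set θ : ℤ → ℝ → ℝ := fun _ t => 2 ^ v * γ t with hθ
  simp only [hgk, Aop_eq]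
  have hpiece : ∀ k : ℤ, Piece K (Λ0 * (l + 1)) κ (2 ^ (-(l₀ v k - (l : ℤ))))
      (2 ^ v * γ (2 ^ (-(l₀ v k - (l : ℤ))))) (2 ^ (-k)) (2 ^ (-(J k))) (α k) (θ k) (g k) := by
    intro k
    obtain ⟨-, s1, s2, s3, -⟩ := scales h hcγ hcC l₀ hl₀ k₁ hk₁ (v := v) (l := l) k
    have hSi := sy_int hφcont hM hGi (J k) k
    refine ⟨ss_of h hφcont.measurable hφtcont.measurable hM hM' hφsupp hcγ (by linarith)
      (by linarith) (by linarith) (by linarith) (by linarith) v _ (by positivity) s1,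
      by positivity, ?_, ftInv_cont hSi, ⟨_, ftInv_bdd _⟩, ?_, ?_⟩
    · refine s3.trans (mul_le_mul_of_nonneg_right (by linarith) (by positivity))
    · refine ftInv_rep hdec hrep hSi fun ξ hξ => ?_
      unfold sy at hξ
      have a1 : φ (2 ^ (-(J k)) * ξ.1) ≠ 0 := by
        intro h0; apply hξ; rw [h0]; simp
      have a2 : φ (2 ^ (-k) * ξ.2) ≠ 0 := by
        intro h0; apply hξ; rw [h0]; simp
      exact ⟨hφsupp a1, hφsupp a2⟩
    · have hp2 : (0 : ℝ) < 2 ^ (-k) := by positivity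
      have := h.pos (2 ^ (-(l₀ v k - (l : ℤ)))) (by positivity)
      refine hlog l _ (by positivity) ?_
      rw [div_le_iff₀ hp2]
      exact s2
  have hl1 : (1 : ℝ) ≤ (l : ℝ) + 1 := by
    have : (0 : ℝ) ≤ l := by positivity
    linarith
  have key := main (Λ0 * (l + 1)) (n0 * (l + 1)) _ _ _ _ α θ g (by nlinarith)
    (by nlinarith) hpiece (fun i j hij => hsparse v l i j hij)
    (fun k => (1 : ℝ) ≤ (2 : ℝ) ^ (v + k) * γ (ε₀ / 2))
  have hp0 : 0 < p := by linarith
  have hpt : (ENNReal.ofReal p).toReal = p := ENNReal.toReal_ofReal hp0.le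
  have hpn : ENNReal.ofReal p ≠ 0 := by simpa using hp0
  rw [eLpNorm_eq_lintegral_rpow_enorm_toReal hpn ENNReal.ofReal_ne_top,
    eLpNorm_eq_lintegral_rpow_enorm_toReal hpn ENNReal.ofReal_ne_top, hpt]
  have eR : ∀ x, ‖Real.sqrt (∑' k : {k : ℤ // (1 : ℝ) ≤ (2 : ℝ) ^ (v + k) * γ (ε₀ / 2)},
      ‖g k x‖ ^ 2)‖ₑ ^ p =
      (∑' k : {k : ℤ // (1 : ℝ) ≤ (2 : ℝ) ^ (v + k) * γ (ε₀ / 2)}, ‖g k x‖ₑ ^ 2) ^ (p / 2) :=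
    fun x => rhs_pt _ ((sq_summable hφcont hφsupp hM hGi J x).subtype _) hp0
  simp_rw [eR]
  set I := ∫⁻ x : ℝ × ℝ, (∑' k : {k : ℤ // (1 : ℝ) ≤ (2 : ℝ) ^ (v + k) * γ (ε₀ / 2)},
    ‖g k x‖ₑ ^ 2) ^ (p / 2) with hI
  calc _ ≤ (∫⁻ x : ℝ × ℝ, (∑' k : {k : ℤ // (1 : ℝ) ≤ (2 : ℝ) ^ (v + k) * γ (ε₀ / 2)},
        XX (α k) (θ k) (g k) x) ^ (p / 2)) ^ (1 / p) := by
        refine ENNReal.rpow_le_rpow (lintegral_mono fun x => ?_) (by positivity)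
        exact lhs_pt (fun k : {k : ℤ // (1 : ℝ) ≤ (2 : ℝ) ^ (v + k) * γ (ε₀ / 2)} => α k)
          (fun k => θ k) (fun k => g k) x hp0
    _ ≤ ((W * ((l : ℝ≥0∞) + 1) ^ 2) ^ (p / 2) * I) ^ (1 / p) := by
        refine ENNReal.rpow_le_rpow (key.trans (le_of_eq ?_)) (by positivity)
        congr 2
        rw [hW, ENNReal.ofReal_mul (by linarith),
          ENNReal.ofReal_add (by positivity) (by norm_num)]
        push_cast
        simp only [ENNReal.ofReal_natCast, ENNReal.ofReal_one]
        ring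
    _ = (W * ((l : ℝ≥0∞) + 1) ^ 2) ^ (1 / 2 : ℝ) * I ^ (1 / p) := by
        rw [ENNReal.mul_rpow_of_nonneg _ _ (by positivity), ← ENNReal.rpow_mul]
        congr 2
        field_simp
    _ ≤ _ := mul_le_mul' (const_bd hWt l) le_rfl
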